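/- Let X be a circulant sesquiclosed scheme on a finite cyclic group G. Assume X is the 𝔖-wreath product of the circulant schemes X₀ = X_{G/e(L)} and X₁ = X_U for some 𝔖 = U/L ∈ 𝔖₀(X), and that (1) the section 𝔖 is subnormal both as a section of X₀ and as a section of X₁, and (2) the schemes X₀ and X₁ are schurian and sesquiseparable. Then X is schurian and sesquiseparable. -/

import Mathlib

open Set

universe u

/-- A coherent configuration on a finite set `Ω`: a partition `S` of `Ω × Ω`
satisfying (C1) the diagonal is a union of classes, (C2) closure under converse,
(C3) well-defined intersection numbers. -/
structure CohCfg (Ω : Type u) : Type u where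
  S : Set (Set (Ω × Ω))
  finite : Finite Ω
  cover : ∀ p : Ω × Ω, ∃ s ∈ S, p ∈ s
  disj : ∀ s ∈ S, ∀ t ∈ S, s ≠ t → s ∩ t = ∅
  nonemp : ∀ s ∈ S, s.Nonempty
  diag : ∀ s ∈ S, (∃ p ∈ s, p.1 = p.2) → ∀ p ∈ s, p.1 = p.2
  conv : ∀ s ∈ S, {p : Ω × Ω | (p.2, p.1) ∈ s} ∈ S
  inum : ∀ r ∈ S, ∀ s ∈ S, ∀ t ∈ S, ∀ p ∈ t, ∀ q ∈ t,
    {γ : Ω | (p.1, γ) ∈ r ∧ (γ, p.2) ∈ s}.ncard =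
    {γ : Ω | (q.1, γ) ∈ r ∧ (γ, q.2) ∈ s}.ncard

namespace CohCfg

variable {Ω Ω' : Type u}

/-- The intersection number `c^t_{rs}` computed at the pair `p`. -/
noncomputable def cnum (r s : Set (Ω × Ω)) (p : Ω × Ω) : ℕ :=
  {γ : Ω | (p.1, γ) ∈ r ∧ (γ, p.2) ∈ s}.ncard

/-- `X` is a scheme (homogeneous) if the full diagonal is a basis relation. -/
def IsScheme (X : CohCfg Ω) : Prop := {p : Ω × Ω | p.1 = p.2} ∈ X.S

/-- Commutativity: `c^t_{rs} = c^t_{sr}`. -/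
def IsCommutative (X : CohCfg Ω) : Prop :=
  ∀ r ∈ X.S, ∀ s ∈ X.S, ∀ p : Ω × Ω, cnum r s p = cnum s r p

/-- `s` is a relation of `X`, i.e. a union of basis relations. -/
def IsRelationOf (X : CohCfg Ω) (s : Set (Ω × Ω)) : Prop :=
  ∀ t ∈ X.S, (t ∩ s).Nonempty → t ⊆ s

/-- `X ≤ Y`: every (basis) relation of `X` is a relation of `Y`. -/
def le (X Y : CohCfg Ω) : Prop := ∀ s ∈ X.S, IsRelationOf Y s

/-- The diagonal relation `1_Δ` of a subset `Δ`. -/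
def diagRel (Δ : Set Ω) : Set (Ω × Ω) := {p | p.1 = p.2 ∧ p.1 ∈ Δ}

/-- `Δ` is a fiber of `X`. -/
def IsFiber (X : CohCfg Ω) (Δ : Set Ω) : Prop := diagRel Δ ∈ X.S

/-- `αs = {β | (α,β) ∈ s}`. -/
def pointSet (s : Set (Ω × Ω)) (α : Ω) : Set Ω := {β | (α, β) ∈ s}

/-- `X` is partly regular: some point `α` has `|αs| ≤ 1` for all basis relations. -/
def PartlyRegular (X : CohCfg Ω) : Prop :=
  ∃ α : Ω, ∀ s ∈ X.S, (pointSet s α).ncard ≤ 1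

/-- The image `s^f` of a relation under a map of points. -/
def relImage (f : Ω → Ω') (s : Set (Ω × Ω)) : Set (Ω' × Ω') :=
  (fun p : Ω × Ω => (f p.1, f p.2)) '' s

/-- `φ` is an algebraic isomorphism from `X` to `X'`. -/
structure IsAlgIso (X : CohCfg Ω) (X' : CohCfg Ω')
    (φ : Set (Ω × Ω) → Set (Ω' × Ω')) : Prop where
  bijOn : Set.BijOn φ X.S X'.S
  cnum_eq : ∀ r ∈ X.S, ∀ s ∈ X.S, ∀ t ∈ X.S, ∀ p ∈ t, ∀ q ∈ φ t,
    cnum r s p = cnum (φ r) (φ s) q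

/-- The natural extension of an algebraic isomorphism to unions of basis relations. -/
def algImage (X : CohCfg Ω) (φ : Set (Ω × Ω) → Set (Ω' × Ω')) (s : Set (Ω × Ω)) :
    Set (Ω' × Ω') := ⋃₀ (φ '' {t | t ∈ X.S ∧ t ⊆ s})

/-- The image `Δ^φ` of a fiber under an algebraic isomorphism. -/
def fiberImage (X : CohCfg Ω) (φ : Set (Ω × Ω) → Set (Ω' × Ω')) (Δ : Set Ω) : Set Ω' :=
  {α' | (α', α') ∈ φ (diagRel Δ)}

/-- `Y` is the point extension `X_α`: the smallest coherent configuration `≥ X`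
having `1_α` as a basis relation. -/
def IsPointExt (X : CohCfg Ω) (α : Ω) (Y : CohCfg Ω) : Prop :=
  le X Y ∧ ({(α, α)} : Set (Ω × Ω)) ∈ Y.S ∧
    ∀ Z : CohCfg Ω, le X Z → ({(α, α)} : Set (Ω × Ω)) ∈ Z.S → le Y Z

/-- `φ` has an `(α,α')`-extension: an algebraic isomorphism `X_α → X'_{α'}`
extending `φ` and sending `1_α` to `1_{α'}`. -/
def HasExtension (X : CohCfg Ω) (X' : CohCfg Ω') (φ : Set (Ω × Ω) → Set (Ω' × Ω'))
    (α : Ω) (α' : Ω') : Prop :=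
  ∃ (Y : CohCfg Ω) (Y' : CohCfg Ω') (ψ : Set (Ω × Ω) → Set (Ω' × Ω')),
    IsPointExt X α Y ∧ IsPointExt X' α' Y' ∧ IsAlgIso Y Y' ψ ∧
    (∀ s ∈ X.S, algImage Y ψ s = φ s) ∧ ψ {(α, α)} = {(α', α')}

/-- A sesquiclosed algebraic isomorphism: has an `(α,α')`-extension for all
`α ∈ Δ ∈ F(X)` and `α' ∈ Δ^φ`. -/
def SesquiclosedIso (X : CohCfg Ω) (X' : CohCfg Ω')
    (φ : Set (Ω × Ω) → Set (Ω' × Ω')) : Prop :=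
  IsAlgIso X X' φ ∧
  ∀ Δ : Set Ω, IsFiber X Δ → ∀ α ∈ Δ, ∀ α' ∈ fiberImage X φ Δ, HasExtension X X' φ α α'

/-- `φ` is induced by the combinatorial isomorphism `f`. -/
def InducedBy (X : CohCfg Ω) (X' : CohCfg Ω') (φ : Set (Ω × Ω) → Set (Ω' × Ω'))
    (f : Ω → Ω') : Prop :=
  Function.Bijective f ∧ ∀ s ∈ X.S, φ s = relImage f s

/-- `X` is separable: every algebraic isomorphism from `X` is induced by an isomorphism. -/
def Separable (X : CohCfg Ω) : Prop :=
  ∀ (Ω'' : Type u) (X' : CohCfg Ω'') (φ : Set (Ω × Ω) → Set (Ω'' × Ω'')),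
    IsAlgIso X X' φ → ∃ f : Ω → Ω'', InducedBy X X' φ f

/-- `X` is sesquiseparable: every sesquiclosed algebraic isomorphism from `X`
is induced by an isomorphism. -/
def Sesquiseparable (X : CohCfg Ω) : Prop :=
  ∀ (Ω'' : Type u) (X' : CohCfg Ω'') (φ : Set (Ω × Ω) → Set (Ω'' × Ω'')),
    SesquiclosedIso X X' φ → ∃ f : Ω → Ω'', InducedBy X X' φ f

/-- A sesquiclosed coherent configuration: (S1) the fibers of every one-point
extension `X_α` are the nonempty sets `αs`, and (S2) the identity algebraic
automorphism is sesquiclosed. -/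
def SesquiclosedCfg (X : CohCfg Ω) : Prop :=
  (∀ α : Ω, ∀ Y : CohCfg Ω, IsPointExt X α Y →
     ∀ Δ : Set Ω, (IsFiber Y Δ ↔ ∃ s ∈ X.S, Δ = pointSet s α ∧ Δ.Nonempty)) ∧
  SesquiclosedIso X X id

/-- A parabolic of `X`: a relation that is an equivalence relation on `Ω`. -/
def IsParabolic (X : CohCfg Ω) (e : Set (Ω × Ω)) : Prop :=
  IsRelationOf X e ∧ (∀ a : Ω, (a, a) ∈ e) ∧ (∀ p ∈ e, (p.2, p.1) ∈ e) ∧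
    ∀ a b c : Ω, (a, b) ∈ e → (b, c) ∈ e → (a, c) ∈ e

/-- The class of `a` modulo the equivalence relation `e`. -/
def eClass (e : Set (Ω × Ω)) (a : Ω) : Set Ω := {b | (a, b) ∈ e}

/-- `Δ/e` is a section of `X`: `e` is a parabolic and `Δ` is a class of a
parabolic containing `e`. -/
def IsSection (X : CohCfg Ω) (Δ : Set Ω) (e : Set (Ω × Ω)) : Prop :=
  IsParabolic X e ∧ ∃ d : Set (Ω × Ω), IsParabolic X d ∧ e ⊆ d ∧ ∃ a : Ω, Δ = eClass d a

/-- The point set of the section `Δ/e`: the `e`-classes of points of `Δ`. -/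
abbrev Sec (Δ : Set Ω) (e : Set (Ω × Ω)) : Type u :=
  {Γ : Set Ω // ∃ a ∈ Δ, Γ = eClass e a}

/-- The relation `s_𝔖` on the section `𝔖 = Δ/e`. -/
def secRel (Δ : Set Ω) (e : Set (Ω × Ω)) (s : Set (Ω × Ω)) :
    Set (Sec Δ e × Sec Δ e) :=
  {p | ∃ a ∈ p.1.1, ∃ b ∈ p.2.1, (a, b) ∈ s}

/-- `Y` is the coherent configuration `X_𝔖` on the section `𝔖 = Δ/e`. -/
def IsSectionCfg (X : CohCfg Ω) (Δ : Set Ω) (e : Set (Ω × Ω))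
    (Y : CohCfg (Sec Δ e)) : Prop :=
  Y.S = {t | ∃ s ∈ X.S, t = secRel Δ e s ∧ t.Nonempty}

/-- The restriction `s_Δ` of a relation to a subset `Δ`. -/
def restRel (Δ : Set Ω) (s : Set (Ω × Ω)) : Set (↥Δ × ↥Δ) := {p | (p.1.1, p.2.1) ∈ s}

/-- `Y` is the restriction `X_Δ` of `X` to `Δ`. -/
def IsRestrictionCfg (X : CohCfg Ω) (Δ : Set Ω) (Y : CohCfg ↥Δ) : Prop :=
  Y.S = {t | ∃ s ∈ X.S, t = restRel Δ s ∧ t.Nonempty}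

/-- `Iso(X, X', φ)`: isomorphisms inducing the algebraic isomorphism `φ`. -/
def IsoSet (X : CohCfg Ω) (X' : CohCfg Ω') (φ : Set (Ω × Ω) → Set (Ω' × Ω')) :
    Set (Ω → Ω') :=
  {f | Function.Bijective f ∧ ∀ s ∈ X.S, relImage f s = φ s}

/-- `X` is schurian: its basis relations are the orbits of `Aut(X)` on `Ω × Ω`. -/
def Schurian (X : CohCfg Ω) : Prop :=
  ∀ s ∈ X.S, ∀ p ∈ s, ∀ q ∈ s, ∃ f : Ω → Ω,
    (Function.Bijective f ∧ ∀ t ∈ X.S, relImage f t = t) ∧ (f p.1, f p.2) = q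

/-- `e ⊆ rad(s)`: `s` is a union of products of pairs of `e`-classes it meets. -/
def RadGE (e s : Set (Ω × Ω)) : Prop :=
  ∀ p ∈ s, ∀ a b : Ω, (p.1, a) ∈ e → (p.2, b) ∈ e → (a, b) ∈ s

/-- The `e₁/e₀`-condition: every basis relation disjoint from `e₁` has `e₀` in
its radical. -/
def WedgeCond (X : CohCfg Ω) (e0 e1 : Set (Ω × Ω)) : Prop :=
  ∀ s ∈ X.S, s ∩ e1 = ∅ → RadGE e0 s

/-- A circulant coherent configuration on a group `G`: right translations are
automorphisms. -/
def IsCirculant {G : Type u} [Group G] (X : CohCfg G) : Prop :=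
  ∀ g : G, ∀ s ∈ X.S, relImage (fun x => x * g) s = s

/-- The equivalence relation `e(H)` whose classes are the cosets of `H`. -/
def eRelSet {G : Type u} [Group G] (H : Subgroup G) : Set (G × G) :=
  {p | p.1⁻¹ * p.2 ∈ H}

/-- `H` is an `X`-group. -/
def IsXGroup {G : Type u} [Group G] (X : CohCfg G) (H : Subgroup G) : Prop :=
  IsParabolic X (eRelSet H)

/-- A normal circulant scheme: every automorphism fixing the identity is a
group automorphism. -/
def IsNormalCirc {G : Type u} [Group G] (X : CohCfg G) : Prop :=
  ∀ f : G → G, Function.Bijective f → (∀ s ∈ X.S, relImage f s = s) → f 1 = 1 →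
    ∀ a b : G, f (a * b) = f a * f b

/-- Normality of a circulant scheme presented on a section `Δ/e` of a group `G`
(the points are cosets): every automorphism fixing the class of `1` respects the
coset multiplication. -/
def IsNormalSec {G : Type u} [Group G] (Δ : Set G) (e : Set (G × G))
    (Y : CohCfg (Sec Δ e)) : Prop :=
  ∀ F : Sec Δ e → Sec Δ e, Function.Bijective F → (∀ t ∈ Y.S, relImage F t = t) →
    (∀ Γ : Sec Δ e, (1 : G) ∈ Γ.1 → F Γ = Γ) →
    ∀ Γ Γ' Γ'' : Sec Δ e, Γ''.1 = Set.image2 (· * ·) Γ.1 Γ'.1 →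
      (F Γ'').1 = Set.image2 (· * ·) (F Γ).1 (F Γ').1

/-- Normality of a circulant scheme presented on (the subtype of) a subgroup `U ⊆ G`. -/
def IsNormalRest {G : Type u} [Group G] (U : Set G) (Y : CohCfg ↥U) : Prop :=
  ∀ F : ↥U → ↥U, Function.Bijective F → (∀ t ∈ Y.S, relImage F t = t) →
    (∀ x : ↥U, x.1 = 1 → F x = x) →
    ∀ x y z : ↥U, z.1 = x.1 * y.1 → (F z).1 = (F x).1 * (F y).1

/-- `N` is an `X_U`-group: `N ≤ U` and the restriction of `e(N)` to `U` is a
relation of the restriction `X_U`. -/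
def SubXGroup {G : Type u} [Group G] (X : CohCfg G) (U N : Subgroup G) : Prop :=
  N ≤ U ∧ ∀ s ∈ X.S, (∃ p ∈ s, p.1 ∈ U ∧ p.2 ∈ U ∧ p.1⁻¹ * p.2 ∈ N) →
    ∀ p ∈ s, p.1 ∈ U → p.2 ∈ U → p.1⁻¹ * p.2 ∈ N

end CohCfg

namespace Circ
open CohCfg

/-- families of relations closed under the coherent operations -/
structure Closed {Ω : Type u} (𝓡 : Set (Set (Ω × Ω))) : Prop where
  diag : {p : Ω × Ω | p.1 = p.2} ∈ 𝓡
  compl : ∀ R ∈ 𝓡, Rᶜ ∈ 𝓡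
  inter : ∀ R ∈ 𝓡, ∀ S ∈ 𝓡, R ∩ S ∈ 𝓡
  conv : ∀ R ∈ 𝓡, {p : Ω × Ω | (p.2, p.1) ∈ R} ∈ 𝓡
  count : ∀ R ∈ 𝓡, ∀ S ∈ 𝓡, ∀ k : ℕ, {p : Ω × Ω | cnum R S p = k} ∈ 𝓡

def ind {Ω : Type u} (𝓡 : Set (Set (Ω × Ω))) (p q : Ω × Ω) : Prop :=
  ∀ R ∈ 𝓡, p ∈ R → q ∈ R

section
variable {Ω : Type u} {𝓡 : Set (Set (Ω × Ω))}

theorem Closed.univ (h : Closed 𝓡) : (Set.univ : Set (Ω × Ω)) ∈ 𝓡 := by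
  have h1 := h.inter _ h.diag _ (h.compl _ h.diag)
  have h2 := h.compl _ h1
  simpa using h2

theorem Closed.empty (h : Closed 𝓡) : (∅ : Set (Ω × Ω)) ∈ 𝓡 := by
  simpa using h.compl _ h.univ

theorem Closed.union (h : Closed 𝓡) {R S : Set (Ω × Ω)} (hR : R ∈ 𝓡) (hS : S ∈ 𝓡) :
    R ∪ S ∈ 𝓡 := by
  have := h.compl _ (h.inter _ (h.compl _ hR) _ (h.compl _ hS))
  simpa [Set.compl_inter] using this

theorem Closed.sUnion (h : Closed 𝓡) {T : Set (Set (Ω × Ω))} (hf : T.Finite) (hT : T ⊆ 𝓡) :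
    ⋃₀ T ∈ 𝓡 := by
  induction T, hf using Set.Finite.induction_on with
  | empty => simpa using h.empty
  | insert _ _ ih =>
    rw [Set.sUnion_insert]
    exact h.union (hT (Set.mem_insert _ _)) (ih fun x hx => hT (Set.mem_insert_of_mem _ hx))

theorem Closed.sInter (h : Closed 𝓡) {T : Set (Set (Ω × Ω))} (hf : T.Finite) (hT : T ⊆ 𝓡) :
    ⋂₀ T ∈ 𝓡 := by
  induction T, hf using Set.Finite.induction_on with
  | empty => simpa using h.univ
  | insert _ _ ih =>
    rw [Set.sInter_insert]
    exact h.inter _ (hT (Set.mem_insert _ _)) _ (ih fun x hx => hT (Set.mem_insert_of_mem _ hx))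

theorem ind_refl (p : Ω × Ω) : ind 𝓡 p p := fun _ _ h => h

theorem ind_trans {p q r : Ω × Ω} (h1 : ind 𝓡 p q) (h2 : ind 𝓡 q r) : ind 𝓡 p r :=
  fun R hR h => h2 R hR (h1 R hR h)

theorem Closed.ind_symm (h : Closed 𝓡) {p q : Ω × Ω} (h1 : ind 𝓡 p q) : ind 𝓡 q p := by
  intro R hR hq
  by_contra hp
  exact h1 _ (h.compl _ hR) hp hq

theorem Closed.ind_iff (h : Closed 𝓡) {p q : Ω × Ω} (h1 : ind 𝓡 p q) {R} (hR : R ∈ 𝓡) :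
    p ∈ R ↔ q ∈ R := ⟨h1 R hR, h.ind_symm h1 R hR⟩

theorem Closed.atom_mem [Finite Ω] (h : Closed 𝓡) (p : Ω × Ω) : {q | ind 𝓡 p q} ∈ 𝓡 := by
  have : {q | ind 𝓡 p q} = ⋂₀ {R | R ∈ 𝓡 ∧ p ∈ R} := by
    ext q
    simp only [ind, Set.mem_ofPred_eq, Set.mem_sInter, and_imp]
  rw [this]
  exact h.sInter (Set.toFinite _) fun R hR => hR.1

theorem Closed.mem_of_sat [Finite Ω] (h : Closed 𝓡) {R : Set (Ω × Ω)}
    (hR : ∀ p q, ind 𝓡 p q → p ∈ R → q ∈ R) : R ∈ 𝓡 := by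
  have : R = ⋃₀ ((fun p => {q | ind 𝓡 p q}) '' R) := by
    ext q
    constructor
    · intro hq
      exact ⟨_, ⟨q, hq, rfl⟩, ind_refl q⟩
    · rintro ⟨_, ⟨p, hp, rfl⟩, hq⟩
      exact hR p q hq hp
  rw [this]
  apply h.sUnion (Set.toFinite _)
  rintro _ ⟨p, _, rfl⟩
  exact h.atom_mem p

theorem cnum_pos [Finite Ω] {R S : Set (Ω × Ω)} {p : Ω × Ω} :
    cnum R S p ≠ 0 ↔ ∃ z, (p.1, z) ∈ R ∧ (z, p.2) ∈ S := by
  unfold cnum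
  rw [Ne, Set.ncard_eq_zero (Set.toFinite _), ← Ne, ← Set.nonempty_iff_ne_empty]
  rfl

theorem Closed.comp [Finite Ω] (h : Closed 𝓡) {R S : Set (Ω × Ω)} (hR : R ∈ 𝓡) (hS : S ∈ 𝓡) :
    {p : Ω × Ω | ∃ z, (p.1, z) ∈ R ∧ (z, p.2) ∈ S} ∈ 𝓡 := by
  have := h.compl _ (h.count R hR S hS 0)
  convert this using 1
  ext p
  simp only [Set.mem_ofPred_eq, Set.mem_compl_iff]
  rw [← cnum_pos]

theorem Closed.transport [Finite Ω] (h : Closed 𝓡) {x y x' y' : Ω} (hi : ind 𝓡 (x, y) (x', y'))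
    (z : Ω) : ∃ z', ind 𝓡 (x, z) (x', z') ∧ ind 𝓡 (z, y) (z', y') := by
  have := hi _ (h.comp (h.atom_mem (x, z)) (h.atom_mem (z, y))) ⟨z, ind_refl _, ind_refl _⟩
  exact this

theorem Closed.ind_conv (h : Closed 𝓡) {x y x' y' : Ω} (hi : ind 𝓡 (x, y) (x', y')) :
    ind 𝓡 (y, x) (y', x') := by
  intro R hR hm
  exact hi _ (h.conv R hR) hm

/-- measurable functions are closed under matrix multiplication -/
theorem Closed.matmul [Fintype Ω] {K : Type} [CommRing K] [Fintype K] (h : Closed 𝓡)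
    {F H : Ω × Ω → K} (hF : ∀ p q, ind 𝓡 p q → F p = F q) (hH : ∀ p q, ind 𝓡 p q → H p = H q)
    {p q : Ω × Ω} (hi : ind 𝓡 p q) :
    ∑ z, F (p.1, z) * H (z, p.2) = ∑ z, F (q.1, z) * H (z, q.2) := by
  classical
  have key : ∀ r : Ω × Ω, ∑ z, F (r.1, z) * H (z, r.2) =
      ∑ ab : K × K, (cnum {p | F p = ab.1} {p | H p = ab.2} r : K) * (ab.1 * ab.2) := by
    intro r
    rw [← Finset.sum_fiberwise (s := Finset.univ) (g := fun z => (F (r.1, z), H (z, r.2)))]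
    apply Finset.sum_congr rfl
    intro ab _
    have : ∀ z ∈ Finset.univ.filter (fun z => (F (r.1, z), H (z, r.2)) = ab),
        F (r.1, z) * H (z, r.2) = ab.1 * ab.2 := by
      intro z hz
      rw [Finset.mem_filter] at hz
      rw [← hz.2]
    rw [Finset.sum_congr rfl this, Finset.sum_const, nsmul_eq_mul]
    congr 2
    unfold cnum
    rw [← Set.ncard_coe_finset]
    congr 1
    ext z
    simp [Prod.ext_iff]
  rw [key, key]
  apply Finset.sum_congr rfl
  intro ab _
  congr 2
  have h1 : {p | F p = ab.1} ∈ 𝓡 := h.mem_of_sat fun p q hpq hp => by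
    rw [Set.mem_ofPred_eq, ← hF p q hpq]; exact hp
  have h2 : {p | H p = ab.2} ∈ 𝓡 := h.mem_of_sat fun p q hpq hp => by
    rw [Set.mem_ofPred_eq, ← hH p q hpq]; exact hp
  exact (hi _ (h.count _ h1 _ h2 _) rfl).symm

end
end Circ

namespace Circ

open Polynomial

section
variable {p : ℕ} [hp : Fact p.Prime]

/-- multiply coefficients by a sequence -/
noncomputable def scaleC (lam : ℕ → ZMod p) (f : (ZMod p)[X]) : (ZMod p)[X] :=
  f.sum fun i a => monomial i (lam i * a)

theorem scaleC_coeff (lam : ℕ → ZMod p) (f : (ZMod p)[X]) (i : ℕ) :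
    (scaleC lam f).coeff i = lam i * f.coeff i := by
  unfold scaleC
  rw [Polynomial.sum_def, Polynomial.finsetSum_coeff]
  simp only [coeff_monomial]
  rw [Finset.sum_ite_eq']
  split_ifs with h
  · rfl
  · rw [notMem_support_iff.mp h, mul_zero]

theorem sum_B_pow (B : Subgroup (ZMod p)ˣ) [Fintype B] (m : ℕ) (hm : Nat.card B = m) (e : ℕ) :
    ∑ b : B, (((b : (ZMod p)ˣ) : ZMod p)) ^ e = if m ∣ e then (m : ZMod p) else 0 := by
  classical
  have hmpos : 0 < m := hm ▸ Nat.card_pos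
  have hpow : ∀ b : B, ((b : (ZMod p)ˣ) : ZMod p) ^ m = 1 := by
    intro b
    have : b ^ m = 1 := by rw [← hm]; exact pow_card_eq_one'
    have h2 := congrArg (fun x : B => ((x : (ZMod p)ˣ) : ZMod p)) this
    simpa using h2
  have hred : ∀ b : B, ((b : (ZMod p)ˣ) : ZMod p) ^ e = ((b : (ZMod p)ˣ) : ZMod p) ^ (e % m) := by
    intro b
    conv_lhs => rw [← Nat.div_add_mod e m, pow_add, pow_mul, hpow, one_pow, one_mul]
  rw [Finset.sum_congr rfl fun b _ => hred b]
  split_ifs with h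
  · rw [Nat.mod_eq_zero_of_dvd h]
    simp [← hm]
  · have h0 : e % m ≠ 0 := fun h' => h (Nat.dvd_of_mod_eq_zero h')
    have hlt : e % m < Fintype.card B := by
      rw [← Nat.card_eq_fintype_card, hm]; exact Nat.mod_lt _ hmpos
    have   := FiniteField.sum_subgroup_pow_eq_zero (G := B) h0 hlt
    simpa using this

theorem sum_pow_all (e : ℕ) (he : 0 < e) :
    ∑ x : ZMod p, x ^ e = if (p - 1) ∣ e then -1 else 0 := by
  classical
  have h := FiniteField.sum_pow_units (ZMod p) e
  rw [ZMod.card] at h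
  rw [← h, ← Finset.sum_erase_add Finset.univ _ (Finset.mem_univ (0 : ZMod p)), zero_pow he.ne',
    add_zero]
  symm
  apply Finset.sum_bij (fun (x : (ZMod p)ˣ) _ => (x : ZMod p))
  · intro a _; simp
  · intro a _ b _ h; exact Units.ext h
  · intro b hb
    simp at hb
    exact ⟨Units.mk0 b hb, Finset.mem_univ _, rfl⟩
  · intro a _; simp

theorem eval_scale_B (B : Subgroup (ZMod p)ˣ) [Fintype B] (mu : B → ZMod p) (z : (ZMod p)[X])
    (s : ZMod p) :
    ∑ b : B, mu b * z.eval (s * ((b : (ZMod p)ˣ) : ZMod p)) =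
      (scaleC (fun k => ∑ b : B, mu b * ((b : (ZMod p)ˣ) : ZMod p) ^ k) z).eval s := by
  unfold scaleC
  rw [Polynomial.sum_def, Polynomial.eval_finsetSum]
  simp only [eval_monomial, Finset.sum_mul]
  have : ∀ b : B, mu b * z.eval (s * ((b : (ZMod p)ˣ) : ZMod p)) = ∑ k ∈ z.support,
      mu b * (z.coeff k * (s * ((b : (ZMod p)ˣ) : ZMod p)) ^ k) := by
    intro b
    rw [Polynomial.eval_eq_sum, Polynomial.sum_def, Finset.mul_sum]
  rw [Finset.sum_congr rfl fun b _ => this b, Finset.sum_comm]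
  refine Finset.sum_congr rfl fun k _ => Finset.sum_congr rfl fun b _ => ?_
  ring

/-- the main polynomial lemma -/
theorem poly_lemma (B : Subgroup (ZMod p)ˣ) [Fintype B] (m : ℕ) (hm : Nat.card B = m)
    (hmp : m < p - 1) (V : Subalgebra (ZMod p) (ZMod p → ZMod p))
    (h1 : (fun s => (1 - s) ^ m) ∈ V) (h2 : (fun s => s ^ (p - 1)) ∈ V)
    (hτ : ∀ v ∈ V, ∀ w ∈ V, ∀ z ∈ V,
      (fun s => ∑ b : B, (∑ x, v x * w (x * ((b : (ZMod p)ˣ) : ZMod p))) *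
        z (s * ((b : (ZMod p)ˣ) : ZMod p))) ∈ V) :
    (fun s : ZMod p => s) ∈ V := by
  classical
  have hmpos : 0 < m := hm ▸ Nat.card_pos
  have hmd : m ∣ p - 1 := by
    rw [← hm, ← ZMod.card_units p, ← Nat.card_eq_fintype_card]
    exact Subgroup.card_subgroup_dvd_card B
  have hp2 := hp.out.two_le
  obtain ⟨r, hr⟩ := hmd
  have hr2 : 2 ≤ r := by
    by_contra h
    interval_cases r <;> omega
  have hm0 : (m : ZMod p) ≠ 0 := by
    rw [Ne, ZMod.natCast_eq_zero_iff]
    intro h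
    have := Nat.le_of_dvd hmpos h
    omega
  -- polynomial form
  let W : Set ((ZMod p)[X]) := {f | (fun s => f.eval s) ∈ V}
  have Wmul : ∀ f ∈ W, ∀ g ∈ W, f * g ∈ W := by
    intro f hf g hg
    have := V.mul_mem hf hg
    change (fun s => (f * g).eval s) ∈ V
    convert this using 1
    ext s
    simp
  have Wadd : ∀ f ∈ W, ∀ g ∈ W, f + g ∈ W := by
    intro f hf g hg
    have := V.add_mem hf hg
    change (fun s => (f + g).eval s) ∈ V
    convert this using 1
    ext s
    simp
  have WC : ∀ a : ZMod p, C a ∈ W := by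
    intro a
    have := V.algebraMap_mem a
    change (fun s => (C a : (ZMod p)[X]).eval s) ∈ V
    convert this using 1
    ext s
    simp
  set c : (ZMod p)[X] := (1 - X) ^ m with hcdef
  have Wc : c ∈ W := by
    change (fun s => c.eval s) ∈ V
    simpa [hcdef] using h1
  have Wp : X ^ (p - 1) ∈ W := by
    change (fun s => (X ^ (p - 1) : (ZMod p)[X]).eval s) ∈ V
    simpa using h2
  have hccoeff : ∀ i, c.coeff i = (-1) ^ i * (m.choose i : ZMod p) := by
    intro i
    have : c = ((1 + X) ^ m).comp (C (-1) * X) := by simp [hcdef, sub_eq_add_neg]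
    rw [this, comp_C_mul_X_coeff, coeff_one_add_X_pow]
    ring
  have hc_ne : ∀ i, i ≤ m → c.coeff i ≠ 0 := by
    intro i hi
    rw [hccoeff]
    apply mul_ne_zero
    · exact pow_ne_zero _ (by simp)
    · rw [Ne, ZMod.natCast_eq_zero_iff]
      intro h
      have h3 : p ∣ m.factorial := by
        rw [← Nat.choose_mul_factorial_mul_factorial hi]
        exact Dvd.dvd.mul_right (Dvd.dvd.mul_right h _) _
      rw [hp.out.dvd_factorial] at h3
      omega
  have hc_gt : ∀ i, m < i → c.coeff i = 0 := by
    intro i hi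
    rw [hccoeff, Nat.choose_eq_zero_of_lt hi]; simp
  -- the algebra of multipliers
  let K : Set (ℕ → ZMod p) := {lam | ∀ f ∈ W, scaleC lam f ∈ W}
  have Kmul : ∀ a ∈ K, ∀ b ∈ K, a * b ∈ K := by
    intro a ha b hb f hf
    have : scaleC (a * b) f = scaleC a (scaleC b f) := by
      ext i; simp only [scaleC_coeff, Pi.mul_apply]; ring
    rw [this]
    exact ha _ (hb _ hf)
  have Kadd : ∀ a ∈ K, ∀ b ∈ K, a + b ∈ K := by
    intro a ha b hb f hf
    have : scaleC (a + b) f = scaleC a f + scaleC b f := by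
      ext i; simp only [scaleC_coeff, Pi.add_apply, coeff_add]; ring
    rw [this]
    exact Wadd _ (ha _ hf) _ (hb _ hf)
  have Kconst : ∀ a : ZMod p, (fun _ => a) ∈ K := by
    intro a f hf
    have : scaleC (fun _ => a) f = C a * f := by
      ext i; simp only [scaleC_coeff, coeff_C_mul]
    rw [this]
    exact Wmul _ (WC a) _ hf
  have Kτ : ∀ v ∈ W, ∀ w ∈ W, (fun k => ∑ b : B, (∑ x, v.eval x *
      w.eval (x * ((b : (ZMod p)ˣ) : ZMod p))) * ((b : (ZMod p)ˣ) : ZMod p) ^ k) ∈ K := by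
    intro v hv w hw z hz
    have := hτ _ hv _ hw _ hz
    change (fun s => (scaleC _ z).eval s) ∈ V
    convert this using 1
    ext s
    rw [eval_scale_B B (fun b => ∑ x, v.eval x * w.eval (x * ((b : (ZMod p)ˣ) : ZMod p)))]
  -- (a)
  have K0 : (fun k => if m ∣ k then (1 : ZMod p) else 0) ∈ K := by
    have h := Kmul _ (Kconst (-(m : ZMod p)⁻¹)) _ (Kτ _ Wp 1 (by simpa using WC 1))
    convert h using 1
    ext k
    simp only [Pi.mul_apply, eval_pow, eval_X, eval_one, mul_one]
    rw [sum_pow_all (p - 1) (by omega), if_pos dvd_rfl, ← Finset.mul_sum, sum_B_pow B m hm]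
    split_ifs
    · field_simp
    · simp
  have WXm : X ^ m ∈ W := by
    have h := K0 c Wc
    have hc0 : scaleC (fun k => if m ∣ k then (1 : ZMod p) else 0) c =
        C (c.coeff 0) + C (c.coeff m) * X ^ m := by
      ext i
      rw [scaleC_coeff]
      simp only [coeff_add, coeff_C, coeff_C_mul, coeff_X_pow]
      rcases Nat.eq_zero_or_pos i with h0 | h0
      · subst h0
        simp [hmpos.ne]
      · rcases lt_trichotomy i m with h' | h' | h'
        · rw [if_neg (fun hd => by have := Nat.le_of_dvd h0 hd; omega), if_neg h0.ne', if_neg h'.ne]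
          simp
        · subst h'; simp [h0.ne']
        · rw [hc_gt i h', if_neg h0.ne', if_neg h'.ne']; simp
    rw [hc0] at h
    have h3 := Wmul _ (WC (c.coeff m)⁻¹) _ (Wadd _ h _ (WC (-c.coeff 0)))
    convert h3 using 1
    have := hc_ne m le_rfl
    rw [C_neg, add_comm (C (c.coeff 0)), add_assoc, add_neg_cancel, add_zero, ← mul_assoc,
      ← C_mul, inv_mul_cancel₀ this, C_1, one_mul]
  have WXml : ∀ l, X ^ (m * l) ∈ W := by
    intro l
    induction l with
    | zero => simpa using WC 1
    | succ l ih =>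
      rw [Nat.mul_succ, pow_add]
      exact Wmul _ ih _ WXm
  -- (b)
  have Kb : ∀ v ∈ W, v.natDegree < p - 1 → ∃ lam ∈ K, ∀ k, 1 ≤ k → k < m →
      lam k = v.coeff k * c.coeff (m - k) := by
    intro v hv hvd
    refine ⟨_, Kmul _ (Kconst (-(m : ZMod p)⁻¹)) _
      (Kτ _ hv (c * X ^ (m * (r - 1))) (Wmul _ Wc _ (WXml _))), ?_⟩
    intro k hk1 hkm
    have e1 : ∀ x : ZMod p, ∑ b : B, (c * X ^ (m * (r - 1))).eval (x * ((b : (ZMod p)ˣ) : ZMod p)) *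
        ((b : (ZMod p)ˣ) : ZMod p) ^ k = m * c.coeff (m - k) * x ^ (p - 1 - k) := by
      intro x
      have hb : ∀ b : B, (c * X ^ (m * (r - 1))).eval (x * ((b : (ZMod p)ˣ) : ZMod p)) *
        ((b : (ZMod p)ˣ) : ZMod p) ^ k = ∑ t ∈ Finset.range (m + 1),
          c.coeff t * x ^ (t + m * (r - 1)) * ((b : (ZMod p)ˣ) : ZMod p) ^ (t + m * (r - 1) + k) := by
        intro b
        have hd : c.natDegree < m + 1 := by
          rw [Nat.lt_succ_iff, natDegree_le_iff_coeff_eq_zero]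
          exact hc_gt
        rw [eval_mul, eval_eq_sum_range' hd, eval_pow, eval_X, Finset.sum_mul, Finset.sum_mul]
        refine Finset.sum_congr rfl fun t _ => ?_
        ring
      rw [Finset.sum_congr rfl fun b _ => hb b, Finset.sum_comm]
      simp only [← Finset.mul_sum, sum_B_pow B m hm]
      rw [Finset.sum_eq_single (m - k)]
      · have e2 : m - k + m * (r - 1) + k = m * r := by
          obtain ⟨r', rfl⟩ : ∃ r', r = r' + 1 := ⟨r - 1, by omega⟩
          simp only [Nat.add_sub_cancel, Nat.mul_succ]
          omega
        have e3 : m - k + m * (r - 1) = p - 1 - k := by omega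
        rw [e2, if_pos (Dvd.intro _ rfl), e3]
        ring
      · intro t ht hne
        rw [if_neg, mul_zero]
        intro hd
        rw [Finset.mem_range] at ht
        have : t + m * (r - 1) + k = m * (r - 1) + (t + k) := by ring
        rw [this, Nat.dvd_add_right (Dvd.intro _ rfl)] at hd
        obtain ⟨q, hq⟩ := hd
        have : q < 2 := by
          by_contra hq2
          have : m * 2 ≤ m * q := Nat.mul_le_mul_left _ (by omega)
          omega
        interval_cases q <;> omega
      · intro h
        exact absurd (Finset.mem_range.mpr (by omega)) h
    simp only [Pi.mul_apply, Finset.sum_mul]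
    rw [Finset.sum_comm]
    simp only [mul_assoc, ← Finset.mul_sum]
    have e4 : ∀ x : ZMod p, v.eval x * ∑ b : B, (c * X ^ (m * (r - 1))).eval
        (x * ((b : (ZMod p)ˣ) : ZMod p)) * ((b : (ZMod p)ˣ) : ZMod p) ^ k =
        ∑ i ∈ Finset.range (p - 1), m * c.coeff (m - k) * v.coeff i * x ^ (i + (p - 1 - k)) := by
      intro x
      rw [e1, eval_eq_sum_range' hvd, Finset.sum_mul]
      refine Finset.sum_congr rfl fun i _ => ?_
      ring
    rw [Finset.sum_congr rfl fun x _ => e4 x, Finset.sum_comm]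
    simp only [← Finset.mul_sum]
    rw [Finset.sum_eq_single k]
    · rw [sum_pow_all _ (by omega), if_pos (by
        rw [show k + (p - 1 - k) = p - 1 by omega])]
      field_simp
    · intro i hi hne
      rw [Finset.mem_range] at hi
      rw [sum_pow_all _ (by omega), if_neg, mul_zero]
      rintro ⟨q, hq⟩
      have : q < 2 := by
        by_contra hq2
        have : (p - 1) * 2 ≤ (p - 1) * q := Nat.mul_le_mul_left _ (by omega)
        omega
      interval_cases q <;> omega
    · intro h
      exact absurd (Finset.mem_range.mpr (by omega)) h
  -- case m = 1
  rcases Nat.lt_or_ge m 2 with hm1 | hm2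
  · have : m = 1 := by omega
    have h := V.sub_mem (V.algebraMap_mem 1) h1
    convert h using 1
    ext s
    simp [this]
  -- classes
  let rel : ℕ → ℕ → Prop := fun i j => ∀ lam ∈ K, lam i = lam j
  have classK : ∀ j, 1 ≤ j → j < m → ∃ lam ∈ K, ∀ i, i ≤ m →
      (rel i j → lam i = 1) ∧ (¬ rel i j → lam i = 0) := by
    intro j hj1 hjm
    have step : ∀ T : Finset ℕ, (∀ i ∈ T, ¬ rel i j) → ∃ lam ∈ K, lam j = 1 ∧ ∀ i ∈ T, lam i = 0 := by
      intro T
      induction T using Finset.induction_on with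
      | empty => intro _; exact ⟨_, Kconst 1, rfl, by simp⟩
      | insert a T ha ih =>
        intro hT
        obtain ⟨l1, hl1, hl1j, hl1T⟩ := ih fun i hi => hT i (Finset.mem_insert_of_mem hi)
        have hna := hT a (Finset.mem_insert_self _ _)
        simp only [rel, not_forall] at hna
        obtain ⟨l2, hl2, hne⟩ := hna
        have hne' : l2 j - l2 a ≠ 0 := sub_ne_zero.mpr (Ne.symm hne)
        refine ⟨_, Kmul _ hl1 _ (Kmul _ (Kconst (l2 j - l2 a)⁻¹) _
          (Kadd _ hl2 _ (Kconst (-l2 a)))), ?_, ?_⟩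
        · simp only [Pi.mul_apply, Pi.add_apply, hl1j, one_mul, ← sub_eq_add_neg]
          exact inv_mul_cancel₀ hne'
        · intro i hi
          rcases Finset.mem_insert.mp hi with rfl | hi
          · simp
          · simp [hl1T i hi]
    obtain ⟨lam, hl, hlj, hl0⟩ := step ((Finset.range (m + 1)).filter fun i => ¬ rel i j)
      (fun i hi => (Finset.mem_filter.mp hi).2)
    refine ⟨lam, hl, fun i hi => ⟨fun h => ?_, fun h => ?_⟩⟩
    · rw [h lam hl, hlj]
    · exact hl0 i (Finset.mem_filter.mpr ⟨Finset.mem_range.mpr (by omega), h⟩)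
  have rel0 : ∀ i j, m ∣ i → 1 ≤ j → j < m → ¬ rel i j := by
    intro i j hi hj1 hj2 h
    have := h _ K0
    rw [if_pos hi, if_neg (fun hd => by have := Nat.le_of_dvd hj1 hd; omega)] at this
    exact one_ne_zero this
  -- the homogeneous parts
  have part : ∀ j, 1 ≤ j → j < m → ∃ f ∈ W, (∀ i, rel i j → i ≤ m → f.coeff i = c.coeff i) ∧
      (∀ i, ¬ rel i j ∨ m ≤ i ∨ i = 0 → f.coeff i = 0) := by
    intro j hj1 hj2
    obtain ⟨lam, hl, hcl⟩ := classK j hj1 hj2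
    refine ⟨scaleC lam c, hl c Wc, ?_, ?_⟩
    · intro i hi him
      rw [scaleC_coeff, (hcl i him).1 hi, one_mul]
    · intro i hi
      rw [scaleC_coeff]
      rcases le_or_gt i m with him | him
      · rw [(hcl i him).2, zero_mul]
        rcases hi with hi | hi | hi
        · exact hi
        · exact rel0 i j (by rw [show i = m by omega]) hj1 hj2
        · exact rel0 i j (by rw [hi]; exact dvd_zero m) hj1 hj2
      · rw [hc_gt i him, mul_zero]
  have claim : ∀ j, 1 ≤ j → j < m → ∀ k, 1 ≤ k → k < m → rel k j → j ≤ k := by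
    intro j hj1
    induction j, hj1 using Nat.le_induction with
    | base => intro _ k hk _ _; exact hk
    | succ j hj ih =>
      intro hjm k hk1 hkm hrel
      by_contra hlt
      obtain ⟨f, hf, hf1, hf0⟩ := part j hj (by omega)
      obtain ⟨g, hg, hg1, hg0⟩ := part 1 le_rfl (by omega)
      have hdeg : ∀ h : (ZMod p)[X], (∀ i, m ≤ i → h.coeff i = 0) → h.natDegree ≤ m - 1 := by
        intro h hh
        rw [natDegree_le_iff_coeff_eq_zero]
        intro N hN
        exact hh N (by omega)
      have hfd := hdeg f fun i hi => hf0 i (Or.inr (Or.inl hi))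
      have hgd := hdeg g fun i hi => hg0 i (Or.inr (Or.inl hi))
      have hfg : (f * g).natDegree < p - 1 := by
        have h3 := natDegree_mul_le (p := f) (q := g)
        have h4 : m * 2 ≤ m * r := Nat.mul_le_mul_left _ hr2
        omega
      obtain ⟨lam, hl, hlam⟩ := Kb _ (Wmul _ hf _ hg) hfg
      have heq := hrel lam hl
      rw [hlam k hk1 hkm, hlam (j + 1) (by omega) hjm] at heq
      have hvk : (f * g).coeff k = 0 := by
        rw [coeff_mul]
        apply Finset.sum_eq_zero
        rintro ⟨a, b⟩ hab
        rw [Finset.HasAntidiagonal.mem_antidiagonal] at hab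
        simp only at hab ⊢
        by_cases ha : f.coeff a = 0
        · rw [ha, zero_mul]
        · by_cases hb : g.coeff b = 0
          · rw [hb, mul_zero]
          · exfalso
            have ha1 : rel a j ∧ ¬ m ≤ a ∧ a ≠ 0 := by
              have := mt (hf0 a) ha
              push Not at this
              exact ⟨this.1, by omega, this.2.2⟩
            have hb1 : b ≠ 0 := by
              have := mt (hg0 b) hb
              push Not at this
              exact this.2.2
            have := ih (by omega) a (by omega) (by omega) ha1.1
            omega
      have hvj : (f * g).coeff (j + 1) = c.coeff j * c.coeff 1 := by
        rw [coeff_mul, Finset.sum_eq_single (j, 1)]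
        · rw [hf1 j (fun _ _ => rfl) (by omega), hg1 1 (fun _ _ => rfl) (by omega)]
        · rintro ⟨a, b⟩ hab hne
          rw [Finset.HasAntidiagonal.mem_antidiagonal] at hab
          simp only at hab ⊢
          by_cases ha : f.coeff a = 0
          · rw [ha, zero_mul]
          · by_cases hb : g.coeff b = 0
            · rw [hb, mul_zero]
            · exfalso
              have ha1 : rel a j ∧ ¬ m ≤ a ∧ a ≠ 0 := by
                have := mt (hf0 a) ha
                push Not at this
                exact ⟨this.1, by omega, this.2.2⟩
              have hb1 : b ≠ 0 := by
                have := mt (hg0 b) hb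
                push Not at this
                exact this.2.2
              have := ih (by omega) a (by omega) (by omega) ha1.1
              apply hne
              rw [Prod.mk.injEq]
              omega
        · intro h
          exact (h (by rw [Finset.HasAntidiagonal.mem_antidiagonal])).elim
      rw [hvk, hvj, zero_mul] at heq
      exact mul_ne_zero (mul_ne_zero (hc_ne j (by omega)) (hc_ne 1 (by omega)))
        (hc_ne _ (by omega)) heq.symm
  obtain ⟨g, hg, hg1, hg0⟩ := part 1 le_rfl (by omega)
  have hgX : g = C (c.coeff 1) * X := by
    ext i
    rw [coeff_C_mul, coeff_X]
    by_cases hi : i = 1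
    · subst hi
      rw [hg1 1 (fun _ _ => rfl) (by omega)]; simp
    · rw [if_neg (Ne.symm hi), mul_zero]
      apply hg0
      by_cases h0 : i = 0
      · exact Or.inr (Or.inr h0)
      by_cases h3 : m ≤ i
      · exact Or.inr (Or.inl h3)
      left
      intro hrel
      have := claim i (by omega) (by omega) 1 le_rfl (by omega) (fun l hl => (hrel l hl).symm)
      omega
  have hX : X ∈ W := by
    have h3 := Wmul _ (WC (c.coeff 1)⁻¹) _ hg
    rw [hgX, ← mul_assoc, ← C_mul, inv_mul_cancel₀ (hc_ne 1 (by omega)), C_1, one_mul] at h3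
    exact h3
  have h3 : (fun s => (X : (ZMod p)[X]).eval s) ∈ V := hX
  simpa using h3

end
end Circ

set_option linter.unusedSectionVars false
namespace Circ
open CohCfg

section zmod
variable {n : ℕ} [NeZero n]

/-- reduction modulo a divisor -/
abbrev red {n : ℕ} (d : ℕ) (h : d ∣ n) : ZMod n →+* ZMod d := ZMod.castHom h (ZMod d)

theorem red_natCast {d : ℕ} (h : d ∣ n) (k : ℕ) : red d h (k : ZMod n) = k := map_natCast _ _

theorem red_surj {d : ℕ} (h : d ∣ n) (x : ZMod d) : ∃ y : ZMod n, red d h y = x :=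
  ZMod.castHom_surjective h x

theorem red_eq_zero_iff {d : ℕ} (h : d ∣ n) (x : ZMod n) :
    red d h x = 0 ↔ ∃ t : ZMod n, x = d * t := by
  constructor
  · intro hx
    have h1 : x = ((x.val : ℕ) : ZMod n) := (ZMod.natCast_zmod_val x).symm
    rw [h1, red_natCast, ZMod.natCast_eq_zero_iff] at hx
    obtain ⟨t, ht⟩ := hx
    refine ⟨t, ?_⟩
    conv_lhs => rw [h1, ht, Nat.cast_mul]
  · rintro ⟨t, rfl⟩
    rw [map_mul, red_natCast, ZMod.natCast_self, zero_mul]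

theorem mul_eq_zero_iff_red {d e : ℕ} (h : n = d * e) (x : ZMod n) :
    (d : ZMod n) * x = 0 ↔ red e ⟨d, by rw [h, mul_comm]⟩ x = 0 := by
  rw [red_eq_zero_iff]
  have hn : n ≠ 0 := NeZero.ne n
  constructor
  · intro hx
    have h1 : x = ((x.val : ℕ) : ZMod n) := (ZMod.natCast_zmod_val x).symm
    rw [h1, ← Nat.cast_mul, ZMod.natCast_eq_zero_iff] at hx
    have hd : 0 < d := by
      rcases Nat.eq_zero_or_pos d with h0 | h0
      · rw [h0, zero_mul] at h; exact absurd h hn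
      · exact h0
    have : e ∣ x.val := by
      have h2 : d * e ∣ d * x.val := h ▸ hx
      exact Nat.dvd_of_mul_dvd_mul_left hd h2
    obtain ⟨t, ht⟩ := this
    refine ⟨t, ?_⟩
    conv_lhs => rw [h1, ht, Nat.cast_mul]
  · rintro ⟨t, rfl⟩
    rw [← mul_assoc, ← Nat.cast_mul, ← h, ZMod.natCast_self, zero_mul]

theorem mul_eq_iff_red {d e : ℕ} (h : n = d * e) (x y : ZMod n) :
    (d : ZMod n) * x = d * y ↔ red e ⟨d, by rw [h, mul_comm]⟩ x =
      red e ⟨d, by rw [h, mul_comm]⟩ y := by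
  rw [← sub_eq_zero, ← mul_sub, mul_eq_zero_iff_red h, map_sub, sub_eq_zero]

theorem crt_inj {d e : ℕ} (h : n = d * e) (hco : Nat.Coprime d e) {x y : ZMod n}
    (h1 : red d ⟨e, h⟩ x = red d ⟨e, h⟩ y)
    (h2 : red e ⟨d, by rw [h, mul_comm]⟩ x = red e ⟨d, by rw [h, mul_comm]⟩ y) : x = y := by
  rw [← sub_eq_zero, ← map_sub, red_eq_zero_iff] at h1
  obtain ⟨t, ht⟩ := h1
  rw [← mul_eq_iff_red h] at h2
  rw [← sub_eq_zero]
  have hn : (d : ZMod n) * (x - y) = 0 := by rw [mul_sub, h2, sub_self]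
  have hm : (e : ZMod n) * (x - y) = 0 := by
    rw [ht, ← mul_assoc, ← Nat.cast_mul, mul_comm e d, ← h, ZMod.natCast_self, zero_mul]
  have := Nat.isCoprime_iff_coprime.mpr hco
  obtain ⟨u, v, huv⟩ := this
  have h3 : ((u * d + v * e : ℤ) : ZMod n) * (x - y) = 0 := by
    push_cast
    rw [add_mul, mul_assoc, mul_assoc, hn, hm]; simp
  rw [huv] at h3
  simpa using h3

theorem crt_surj {d e : ℕ} (h : n = d * e) (hco : Nat.Coprime d e) (a : ZMod d) (b : ZMod e) :
    ∃ x : ZMod n, red d ⟨e, h⟩ x = a ∧ red e ⟨d, by rw [h, mul_comm]⟩ x = b := by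
  have hn : n ≠ 0 := NeZero.ne n
  have hd : NeZero d := ⟨fun h0 => hn (by rw [h, h0, zero_mul])⟩
  have he : NeZero e := ⟨fun h0 => hn (by rw [h, h0, mul_zero])⟩
  obtain ⟨k, hk1, hk2⟩ := Nat.chineseRemainder hco a.val b.val
  refine ⟨k, ?_, ?_⟩
  · rw [red_natCast, ← ZMod.natCast_zmod_val a, ZMod.natCast_eq_natCast_iff]; exact hk1
  · rw [red_natCast, ← ZMod.natCast_zmod_val b, ZMod.natCast_eq_natCast_iff]; exact hk2

theorem isUnit_crt {d e : ℕ} (h : n = d * e) (hco : Nat.Coprime d e) {x : ZMod n}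
    (h1 : IsUnit (red d ⟨e, h⟩ x)) (h2 : IsUnit (red e ⟨d, by rw [h, mul_comm]⟩ x)) :
    IsUnit x := by
  obtain ⟨a, ha⟩ := h1.exists_right_inv
  obtain ⟨b, hb⟩ := h2.exists_right_inv
  obtain ⟨y, hy1, hy2⟩ := crt_surj h hco a b
  apply IsUnit.of_mul_eq_one y
  apply crt_inj h hco
  · rw [map_mul, hy1, ha, map_one]
  · rw [map_mul, hy2, hb, map_one]

end zmod

section norm
variable {n : ℕ} [NeZero n]

/-- all scheme automorphisms fixing zero are additive -/
def NormA (A : Subgroup (ZMod n)ˣ) : Prop :=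
  ∀ F : ZMod n → ZMod n, Function.Bijective F → F 0 = 0 →
    (∀ x y, ∃ a ∈ A, F y - F x = (a : ZMod n) * (y - x)) → ∀ x y, F (x + y) = F x + F y

theorem NormA.app {A : Subgroup (ZMod n)ˣ} (h : NormA A) (F : ZMod n → ZMod n) (h0 : F 0 = 0)
    (h1 : ∀ x y, ∃ a ∈ A, F y - F x = (a : ZMod n) * (y - x)) (x y : ZMod n) :
    F (x + y) = F x + F y := by
  refine h F ?_ h0 h1 x y
  apply Function.Injective.bijective_of_finite
  intro x y hxy
  obtain ⟨a, _, ha⟩ := h1 x y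
  rw [hxy, sub_self] at ha
  have := (Units.mul_right_eq_zero a).mp ha.symm
  exact (sub_eq_zero.mp this).symm

/-- (N1) -/
theorem N1 {A : Subgroup (ZMod n)ˣ} (h : NormA A) {p m : ℕ} (hp : p.Prime) (hp2 : p ≠ 2)
    (hn : n = p * m) (hpm : p ∣ m) (a : (ZMod n)ˣ) (ha : a ∈ A)
    (ha1 : (p : ZMod n) * ((a : ZMod n) - 1) = 0) : a = 1 := by
  classical
  have : Fact p.Prime := ⟨hp⟩
  have hn' : n = m * p := by rw [hn, mul_comm]
  have hpn : p ∣ n := ⟨m, hn⟩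
  by_contra hne
  rw [mul_eq_zero_iff_red hn, red_eq_zero_iff] at ha1
  obtain ⟨t, ht⟩ := ha1
  have hmm : (m : ZMod n) * m = 0 := by
    obtain ⟨q, hq⟩ := hpm
    rw [← Nat.cast_mul]
    conv_lhs => rw [hq]
    rw [show p * q * (p * q) = p * (p * q) * q by ring, ← hq, ← hn, Nat.cast_mul, ZMod.natCast_self,
      zero_mul]
  have hpow : ∀ j : ℕ, ((a ^ j : (ZMod n)ˣ) : ZMod n) = 1 + m * (t * j) := by
    intro j
    have ha' : (a : ZMod n) = 1 + m * t := by rw [← ht]; ring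
    induction j with
    | zero => simp
    | succ j ih =>
      rw [pow_succ, Units.val_mul, ih, ha']
      push_cast
      linear_combination (t * j * t) * hmm
  have htp : red p hpn t ≠ 0 := by
    intro h0
    apply hne
    rw [← mul_eq_zero_iff_red hn'] at h0
    rw [h0] at ht
    exact Units.ext (by simpa using sub_eq_zero.mp ht)
  have hall : ∀ s : ZMod n, ∃ b ∈ A, (b : ZMod n) = 1 + m * s := by
    intro s
    have hj : ∃ j : ℕ, (j : ZMod p) = red p hpn s * (red p hpn t)⁻¹ :=
      ⟨(red p hpn s * (red p hpn t)⁻¹).val, ZMod.natCast_zmod_val _⟩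
    obtain ⟨j, hj⟩ := hj
    refine ⟨a ^ j, A.pow_mem ha j, ?_⟩
    rw [hpow, add_right_inj, mul_eq_iff_red hn', map_mul, map_natCast, hj]
    field_simp
  have hadd := h.app (fun x => x + if red p hpn x = 1 then (m : ZMod n) else 0) (by simp) (by
    intro x y
    by_cases hxy : red p hpn x = red p hpn y
    · refine ⟨1, A.one_mem, ?_⟩
      simp only [hxy]
      simp
    · have hxy' : red p hpn y - red p hpn x ≠ 0 := sub_ne_zero.mpr (Ne.symm hxy)
      have key : ∀ ε : ZMod n, ∃ b ∈ A, (b : ZMod n) * (y - x) = (y - x) + m * ε := by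
        intro ε
        obtain ⟨s, hs⟩ := red_surj hpn (red p hpn ε * (red p hpn y - red p hpn x)⁻¹)
        obtain ⟨b, hb, hbs⟩ := hall s
        refine ⟨b, hb, ?_⟩
        rw [hbs, add_mul, one_mul, add_right_inj, mul_assoc, mul_eq_iff_red hn', map_mul, hs,
          map_sub]
        field_simp
      obtain ⟨b, hb, hb2⟩ := key ((if red p hpn y = 1 then 1 else 0) -
        (if red p hpn x = 1 then 1 else 0))
      refine ⟨b, hb, ?_⟩
      rw [hb2]
      split_ifs <;> ring) 1 1
  have e2 : red p hpn (1 + 1) ≠ 1 := by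
    rw [map_add, map_one]
    intro h
    exact one_ne_zero (add_eq_left.mp h)
  simp only [if_neg e2, map_one, if_true] at hadd
  have h2m : (m : ZMod n) * 2 = 0 := by linear_combination -hadd
  rw [mul_eq_zero_iff_red hn', ← Nat.cast_two, red_natCast, ZMod.natCast_eq_zero_iff] at h2m
  have := Nat.le_of_dvd (by norm_num) h2m
  have := hp.two_le
  omega

/-- (N2) -/
theorem N2 {A : Subgroup (ZMod n)ˣ} (h : NormA A) {p m : ℕ} (hp : p.Prime) (hp5 : 5 ≤ p)
    (hn : n = p * m) (hco : Nat.Coprime p m)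
    (hB : ∀ s : ZMod p, s ≠ 0 → ∃ a ∈ A, red p ⟨m, hn⟩ (a : ZMod n) = s ∧
      red m ⟨p, by rw [hn, mul_comm]⟩ (a : ZMod n) = 1) : False := by
  classical
  have : Fact p.Prime := ⟨hp⟩
  choose F hF1 hF2 using fun x : ZMod n => crt_surj hn hco
    (Equiv.swap (1 : ZMod p) 2 (red p ⟨m, hn⟩ x)) (red m ⟨p, by rw [hn, mul_comm]⟩ x)
  have nz : ∀ k : ℕ, 0 < k → k < 5 → (k : ZMod p) ≠ 0 := by
    intro k h1 h2 h0
    rw [ZMod.natCast_eq_zero_iff] at h0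
    have := Nat.le_of_dvd h1 h0
    omega
  have n1 : (1 : ZMod p) ≠ 0 := one_ne_zero
  have n2 : (2 : ZMod p) ≠ 0 := by exact_mod_cast nz 2 (by norm_num) (by norm_num)
  have n3 : (3 : ZMod p) ≠ 0 := by exact_mod_cast nz 3 (by norm_num) (by norm_num)
  have hadd := h.app F (by
      apply crt_inj hn hco
      · rw [hF1, map_zero, Equiv.swap_apply_of_ne_of_ne n1.symm n2.symm]
      · rw [hF2]) (by
    intro x y
    by_cases hxy : red p ⟨m, hn⟩ x = red p ⟨m, hn⟩ y
    · refine ⟨1, A.one_mem, ?_⟩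
      rw [Units.val_one, one_mul]
      apply crt_inj hn hco
      · rw [map_sub, map_sub, hF1, hF1, hxy]; simp
      · rw [map_sub, map_sub, hF2, hF2]
    · have hxy' : red p ⟨m, hn⟩ y - red p ⟨m, hn⟩ x ≠ 0 := sub_ne_zero.mpr (Ne.symm hxy)
      have hF' : red p ⟨m, hn⟩ (F y) - red p ⟨m, hn⟩ (F x) ≠ 0 := by
        rw [hF1, hF1, sub_ne_zero]
        exact fun h => hxy ((Equiv.swap _ _).injective h).symm
      obtain ⟨a, ha, ha1, ha2⟩ := hB ((red p ⟨m, hn⟩ (F y) - red p ⟨m, hn⟩ (F x)) *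
        (red p ⟨m, hn⟩ y - red p ⟨m, hn⟩ x)⁻¹) (mul_ne_zero hF' (inv_ne_zero hxy'))
      refine ⟨a, ha, ?_⟩
      apply crt_inj hn hco
      · rw [map_sub, map_mul, ha1, map_sub]; field_simp
      · rw [map_sub, map_mul, ha2, map_sub, hF2, hF2, one_mul]) 1 1
  have h3 := congrArg (red p ⟨m, hn⟩) hadd
  rw [map_add, hF1, hF1, map_add, map_one, Equiv.swap_apply_left, one_add_one_eq_two,
    Equiv.swap_apply_right] at h3
  apply n3
  linear_combination -h3

/-- (N3) -/
theorem N3 {A : Subgroup (ZMod n)ˣ} (h : NormA A) {m : ℕ} (hn : n = 2 * (2 * m))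
    (b : (ZMod n)ˣ) (hb : b ∈ A) (hb1 : (b : ZMod n) = 1 + (2 * m : ℕ))
    (a : (ZMod n)ˣ) (ha : a ∈ A) (ha1 : 2 * ((a : ZMod n) - 1) = (2 * m : ℕ)) : False := by
  classical
  have hn0 : n ≠ 0 := NeZero.ne n
  have h4 : 4 ∣ n := ⟨m, by rw [hn]; ring⟩
  set hh : ZMod n := ((2 * m : ℕ) : ZMod n) with hhdef
  have h2h : 2 * hh = 0 := by
    rw [hhdef, show (2 : ZMod n) = ((2 : ℕ) : ZMod n) by norm_num, ← Nat.cast_mul, ← hn,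
      ZMod.natCast_self]
  have key : ∀ z : ZMod n, red 4 h4 z ≠ 0 → ∃ c ∈ A, (c : ZMod n) * z = z + hh := by
    intro z hz
    have hz' : ∃ w, z = 2 * w ∨ z = 2 * w + 1 := by
      have h1 : z = ((z.val : ℕ) : ZMod n) := (ZMod.natCast_zmod_val z).symm
      rcases Nat.even_or_odd' z.val with ⟨k, hk | hk⟩
      · refine ⟨k, Or.inl ?_⟩
        conv_lhs => rw [h1, hk]
        push_cast; ring
      · refine ⟨k, Or.inr ?_⟩
        conv_lhs => rw [h1, hk]
        push_cast; ring
    obtain ⟨w, hw | hw⟩ := hz'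
    · -- w is odd
      refine ⟨a, ha, ?_⟩
      have h1 : w = ((w.val : ℕ) : ZMod n) := (ZMod.natCast_zmod_val w).symm
      have hodd : ∃ k : ZMod n, w = 2 * k + 1 := by
        rcases Nat.even_or_odd' w.val with ⟨k, hk | hk⟩
        · exfalso
          apply hz
          rw [hw, h1, hk]
          rw [show (2 : ZMod n) * ((2 * k : ℕ) : ZMod n) = ((4 * k : ℕ) : ZMod n) by push_cast; ring]
          rw [red_natCast, ZMod.natCast_eq_zero_iff]
          exact ⟨k, rfl⟩
        · refine ⟨k, ?_⟩
          conv_lhs => rw [h1, hk]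
          push_cast; ring
      obtain ⟨k, hk⟩ := hodd
      rw [hw, hk]
      linear_combination (2 * k + 1) * ha1 + k * h2h
    · refine ⟨b, hb, ?_⟩
      rw [hb1, hw]
      linear_combination w * h2h
  have hadd := h.app (fun x => x + if red 4 h4 x = 1 then hh else 0) (by
      have : (0 : ZMod 4) ≠ 1 := by decide
      simp [this]) (by
    intro x y
    by_cases hxy : red 4 h4 x = red 4 h4 y
    · refine ⟨1, A.one_mem, ?_⟩
      simp only [hxy]
      simp
    · have hxy' : red 4 h4 (y - x) ≠ 0 := by
        rw [map_sub]; exact sub_ne_zero.mpr (Ne.symm hxy)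
      obtain ⟨c, hc, hc1⟩ := key _ hxy'
      by_cases hx : red 4 h4 x = 1
      · have hy : red 4 h4 y ≠ 1 := fun h => hxy (hx.trans h.symm)
        refine ⟨c, hc, ?_⟩
        rw [hc1]
        simp only [if_pos hx, if_neg hy]
        linear_combination -h2h
      · by_cases hy : red 4 h4 y = 1
        · refine ⟨c, hc, ?_⟩
          rw [hc1]
          simp only [if_neg hx, if_pos hy]
          ring
        · refine ⟨1, A.one_mem, ?_⟩
          simp only [if_neg hx, if_neg hy]
          simp) 1 2
  have e2 : red 4 h4 2 ≠ 1 := by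
    rw [show (2 : ZMod n) = ((2 : ℕ) : ZMod n) by norm_num, red_natCast]; decide
  have e3 : red 4 h4 (1 + 2) ≠ 1 := by
    rw [show (1 + 2 : ZMod n) = ((3 : ℕ) : ZMod n) by norm_num, red_natCast]; decide
  simp only [if_neg e2, if_neg e3, map_one, if_true] at hadd
  have h0 : hh = 0 := by linear_combination -hadd
  rw [hhdef, ZMod.natCast_eq_zero_iff, hn] at h0
  have := Nat.le_of_dvd (by omega) h0
  omega

end norm
end Circ

set_option linter.unusedSectionVars false
namespace Circ
open CohCfg

section good
variable {n : ℕ} [NeZero n]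

def orb (A : Subgroup (ZMod n)ˣ) (d : ZMod n) : Set (ZMod n × ZMod n) :=
  {p | ∃ a ∈ A, p.2 - p.1 = (a : ZMod n) * d}

structure Good (A : Subgroup (ZMod n)ˣ) (𝓡 : Set (Set (ZMod n × ZMod n))) : Prop where
  closed : Closed 𝓡
  orb : ∀ d, orb A d ∈ 𝓡
  zero : {((0 : ZMod n), (0 : ZMod n))} ∈ 𝓡
  inv : ∀ R ∈ 𝓡, ∀ a ∈ A, ∀ x y : ZMod n, (x, y) ∈ R → ((a : ZMod n) * x, (a : ZMod n) * y) ∈ R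

variable {A : Subgroup (ZMod n)ˣ} {𝓡 : Set (Set (ZMod n × ZMod n))}

theorem Good.ind_mul (h : Good A 𝓡) {a : (ZMod n)ˣ} (ha : a ∈ A) (x y : ZMod n) :
    ind 𝓡 (x, y) ((a : ZMod n) * x, (a : ZMod n) * y) :=
  fun R hR hm => h.inv R hR a ha x y hm

theorem Good.ind_diff (h : Good A 𝓡) {x y x' y' : ZMod n} (hi : ind 𝓡 (x, y) (x', y')) :
    ∃ a ∈ A, y' - x' = (a : ZMod n) * (y - x) :=
  hi _ (h.orb (y - x)) ⟨1, A.one_mem, by simp⟩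

theorem Good.left_mem (h : Good A 𝓡) (d : ZMod n) :
    {p : ZMod n × ZMod n | ∃ a ∈ A, p.1 = (a : ZMod n) * d} ∈ 𝓡 := by
  have h1 := h.closed.comp h.zero (h.orb d)
  have h2 := h.closed.comp (h.closed.conv _ h1) h.closed.univ
  convert h2 using 1
  ext ⟨x, y⟩
  constructor
  · rintro ⟨a, ha, hx⟩
    exact ⟨0, ⟨0, rfl, a, ha, by simpa using hx⟩, trivial⟩
  · rintro ⟨z, ⟨w, hw, a, ha, hx⟩, -⟩
    have hw' : w = 0 := congrArg Prod.snd hw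
    refine ⟨a, ha, ?_⟩
    rw [hw'] at hx
    simpa using hx

theorem Good.ind_left (h : Good A 𝓡) {x y x' y' : ZMod n} (hi : ind 𝓡 (x, y) (x', y')) :
    ∃ a ∈ A, x' = (a : ZMod n) * x :=
  hi _ (h.left_mem x) ⟨1, A.one_mem, by simp⟩

theorem Good.ind_right (h : Good A 𝓡) {x y x' y' : ZMod n} (hi : ind 𝓡 (x, y) (x', y')) :
    ∃ a ∈ A, y' = (a : ZMod n) * y :=
  h.ind_left (h.closed.ind_conv hi)

/-- rescaling a good family by a unit -/
def rescale (u : (ZMod n)ˣ) (𝓡 : Set (Set (ZMod n × ZMod n))) : Set (Set (ZMod n × ZMod n)) :=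
  {R | {p : ZMod n × ZMod n | (((u⁻¹ : (ZMod n)ˣ) : ZMod n) * p.1,
    ((u⁻¹ : (ZMod n)ˣ) : ZMod n) * p.2) ∈ R} ∈ 𝓡}

theorem Good.rescale (h : Good A 𝓡) (u : (ZMod n)ˣ) : Good A (rescale u 𝓡) := by
  refine ⟨⟨?_, ?_, ?_, ?_, ?_⟩, ?_, ?_, ?_⟩
  · have := h.closed.diag
    change _ ∈ 𝓡
    convert this using 1
    ext p
    exact Units.mul_right_inj _
  · intro R hR
    exact h.closed.compl _ hR
  · intro R hR S hS
    exact h.closed.inter _ hR _ hS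
  · intro R hR
    exact h.closed.conv _ hR
  · intro R hR S hS k
    have := h.closed.count _ hR _ hS k
    change _ ∈ 𝓡
    convert this using 1
    ext p
    simp only [Set.mem_ofPred_eq]
    have : cnum R S (((u⁻¹ : (ZMod n)ˣ) : ZMod n) * p.1, ((u⁻¹ : (ZMod n)ˣ) : ZMod n) * p.2) =
      cnum {p : ZMod n × ZMod n | (((u⁻¹ : (ZMod n)ˣ) : ZMod n) * p.1,
        ((u⁻¹ : (ZMod n)ˣ) : ZMod n) * p.2) ∈ R} {p : ZMod n × ZMod n |
        (((u⁻¹ : (ZMod n)ˣ) : ZMod n) * p.1, ((u⁻¹ : (ZMod n)ˣ) : ZMod n) * p.2) ∈ S} p := by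
      unfold cnum
      symm
      apply Set.ncard_congr (fun z _ => ((u⁻¹ : (ZMod n)ˣ) : ZMod n) * z)
      · intro z hz; exact hz
      · intro z w _ _ hzw; exact (Units.mul_right_inj _).mp hzw
      · intro w hw
        refine ⟨(u : ZMod n) * w, ?_, by rw [← mul_assoc]; simp⟩
        have e : ((u⁻¹ : (ZMod n)ˣ) : ZMod n) * ((u : ZMod n) * w) = w := by
          rw [← mul_assoc]; simp
        constructor
        · change (_, _) ∈ R
          simp only [e]; exact hw.1
        · change (_, _) ∈ S
          simp only [e]; exact hw.2
    rw [this]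
  · intro d
    have := h.orb ((u : ZMod n) * d)
    change _ ∈ 𝓡
    convert this using 1
    ext p
    constructor
    · rintro ⟨a, ha, hp⟩
      refine ⟨a, ha, ?_⟩
      simp only at hp
      rw [← mul_sub, Units.inv_mul_eq_iff_eq_mul] at hp
      rw [hp]; ring
    · rintro ⟨a, ha, hp⟩
      refine ⟨a, ha, ?_⟩
      simp only
      rw [← mul_sub, Units.inv_mul_eq_iff_eq_mul, hp]; ring
  · have := h.zero
    change _ ∈ 𝓡
    convert this using 1
    ext ⟨x, y⟩
    simp
  · intro R hR a ha x y hxy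
    have h1 := h.inv _ hR a ha ((u : ZMod n) * x) ((u : ZMod n) * y) (by
      change (_, _) ∈ R
      simpa [← mul_assoc] using hxy)
    have h2 : (((u⁻¹ : (ZMod n)ˣ) : ZMod n) * ((a : ZMod n) * ((u : ZMod n) * x)),
      ((u⁻¹ : (ZMod n)ˣ) : ZMod n) * ((a : ZMod n) * ((u : ZMod n) * y))) ∈ R := h1
    convert h2 using 2
    · rw [mul_left_comm, Units.inv_mul_cancel_left]
    · rw [mul_left_comm, Units.inv_mul_cancel_left]

theorem ind_rescale (u : (ZMod n)ˣ) {x y x' y' : ZMod n}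
    (hi : ind 𝓡 ((u : ZMod n) * x, (u : ZMod n) * y) ((u : ZMod n) * x', (u : ZMod n) * y')) :
    ind (rescale u 𝓡) (x, y) (x', y') := by
  intro R hR hxy
  have := hi _ hR (by
    change (_, _) ∈ R
    simpa [← mul_assoc] using hxy)
  have h2 : (((u⁻¹ : (ZMod n)ˣ) : ZMod n) * ((u : ZMod n) * x'),
    ((u⁻¹ : (ZMod n)ˣ) : ZMod n) * ((u : ZMod n) * y')) ∈ R := this
  simpa [← mul_assoc] using h2

/-- `y` is determined over `1` by every good family -/
def Fix (A : Subgroup (ZMod n)ˣ) (y : ZMod n) : Prop :=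
  ∀ 𝓡, Good A 𝓡 → ∀ y', ind 𝓡 (1, y) (1, y') → y' = y

theorem Fix.unit {y : ZMod n} (hf : ∀ 𝓡, Good A 𝓡 → ∀ y', ind 𝓡 (1, y) (1, y') → y' = y)
    (u : (ZMod n)ˣ) (h : Good A 𝓡) {z : ZMod n}
    (hi : ind 𝓡 ((u : ZMod n), (u : ZMod n) * y) ((u : ZMod n), z)) : z = (u : ZMod n) * y := by
  have h1 := hf _ (h.rescale u) (((u⁻¹ : (ZMod n)ˣ) : ZMod n) * z) (ind_rescale u (by
    simpa [← mul_assoc] using hi))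
  rw [← h1, ← mul_assoc]; simp

end good

section step1
variable {n : ℕ} [NeZero n] {A : Subgroup (ZMod n)ˣ} {𝓡 : Set (Set (ZMod n × ZMod n))}

theorem step1_two (h : Good A 𝓡) {m : ℕ} (hn : n = 2 * m) {y y' : ZMod n}
    (hy : 2 * y = 0) (hi : ind 𝓡 (1, y) (1, y')) : y' = y := by
  obtain ⟨a, ha, hay⟩ := h.ind_right hi
  have hn' : n = m * 2 := by rw [hn, mul_comm]
  have h2 : 2 ∣ n := ⟨m, hn⟩
  have red2 : red m ⟨2, hn'⟩ y = 0 := by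
    rw [← mul_eq_zero_iff_red hn]; exact_mod_cast hy
  rw [red_eq_zero_iff] at red2
  obtain ⟨t, ht⟩ := red2
  rw [hay, ht, ← mul_assoc, mul_comm (a : ZMod n), mul_assoc, mul_eq_iff_red hn', map_mul]
  have : red 2 h2 (a : ZMod n) = 1 := by
    have hu : IsUnit (red 2 h2 (a : ZMod n)) := a.isUnit.map _
    revert hu
    generalize red 2 h2 (a : ZMod n) = s
    revert s; decide
  rw [this, one_mul]

theorem step1_sq (hN : NormA A) (h : Good A 𝓡) {p m : ℕ} (hp : p.Prime) (hp2 : p ≠ 2)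
    (hn : n = p * m) (hpm : p ∣ m) {y y' : ZMod n}
    (hy : p * y = 0) (hy' : p * y' = 0) (hi : ind 𝓡 (1, y) (1, y')) : y' = y := by
  obtain ⟨a, ha, hay⟩ := h.ind_diff hi
  have := N1 hN hp hp2 hn hpm a ha (by
    linear_combination (p : ZMod n) * hay - hy' + (a : ZMod n) * hy)
  rw [this] at hay
  simpa using hay

theorem step1_three (h : Good A 𝓡) {m : ℕ}
    (hn : n = 3 * m) (hco : Nat.Coprime 3 m) {y y' : ZMod n}
    (hy : ((3 : ℕ) : ZMod n) * y = 0) (hy' : ((3 : ℕ) : ZMod n) * y' = 0)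
    (hi : ind 𝓡 (1, y) (1, y')) : y' = y := by
  obtain ⟨a, ha, hay⟩ := h.ind_diff hi
  obtain ⟨b, hb, hby⟩ := h.ind_right hi
  rw [mul_eq_zero_iff_red hn] at hy hy'
  apply crt_inj hn hco
  · have e1 := congrArg (red 3 ⟨m, hn⟩) hay
    have e2 := congrArg (red 3 ⟨m, hn⟩) hby
    have hu : IsUnit (red 3 ⟨m, hn⟩ (a : ZMod n)) := a.isUnit.map _
    have hu2 : IsUnit (red 3 ⟨m, hn⟩ (b : ZMod n)) := b.isUnit.map _
    rw [map_sub, map_mul, map_sub, map_one] at e1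
    rw [map_mul] at e2
    revert e1 e2 hu hu2
    generalize red 3 ⟨m, hn⟩ (a : ZMod n) = a'
    generalize red 3 ⟨m, hn⟩ (b : ZMod n) = b'
    generalize red 3 ⟨m, hn⟩ y = s
    generalize red 3 ⟨m, hn⟩ y' = s'
    revert a' b' s s'; decide
  · rw [hy, hy']

open Classical in
theorem step1_poly (hN : NormA A) (h : Good A 𝓡) {p m : ℕ} (hp : p.Prime) (hp5 : 5 ≤ p)
    (hn : n = p * m) (hco : Nat.Coprime p m) {y y' : ZMod n}
    (hy : (p : ZMod n) * y = 0) (hy' : (p : ZMod n) * y' = 0)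
    (hi : ind 𝓡 (1, y) (1, y')) : y' = y := by
  have : Fact p.Prime := ⟨hp⟩
  have hmn : m ∣ n := ⟨p, by rw [hn, mul_comm]⟩
  set cp : ZMod n →+* ZMod p := red p ⟨m, hn⟩ with hcp
  set cm : ZMod n →+* ZMod m := red m hmn with hcm
  have inj : ∀ {x y : ZMod n}, cp x = cp y → cm x = cm y → x = y := fun h1 h2 =>
    crt_inj hn hco h1 h2
  -- the subgroup B
  let B0 : Subgroup (ZMod n)ˣ := A ⊓ (Units.map (cm : ZMod n →* ZMod m)).ker
  let B : Subgroup (ZMod p)ˣ := B0.map (Units.map (cp : ZMod n →* ZMod p))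
  have memB0 : ∀ a : (ZMod n)ˣ, a ∈ B0 ↔ a ∈ A ∧ cm a = 1 := by
    intro a
    simp only [B0, Subgroup.mem_inf, MonoidHom.mem_ker]
    constructor
    · rintro ⟨h1, h2⟩; exact ⟨h1, by simpa using congrArg Units.val h2⟩
    · rintro ⟨h1, h2⟩; exact ⟨h1, Units.ext (by simpa using h2)⟩
  set k := Nat.card B with hk
  have hkp : k < p - 1 := by
    have hle : k ≤ p - 1 := by
      rw [hk, ← ZMod.card_units p, ← Nat.card_eq_fintype_card]
      exact Subgroup.card_le_card_group B
    refine lt_of_le_of_ne hle fun heq => ?_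
    have htop : B = ⊤ := by
      apply Subgroup.eq_top_of_card_eq
      rw [← hk, heq, Nat.card_eq_fintype_card, ZMod.card_units p]
    apply N2 hN hp hp5 hn hco
    intro s hs
    have : Units.mk0 s hs ∈ B := htop ▸ Subgroup.mem_top _
    obtain ⟨a, ha, hea⟩ := this
    rw [SetLike.mem_coe, memB0] at ha
    exact ⟨a, ha.1, congrArg Units.val hea, ha.2⟩
  have indm : ∀ {x y x' y' : ZMod n}, ind 𝓡 (x, y) (x', y') → cm y = 0 → cm y' = 0 := by
    intro x y x' y' hi hy
    obtain ⟨b, _, hby⟩ := h.ind_right hi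
    rw [hby, map_mul, hy, mul_zero]
  -- the algebra
  let V : Subalgebra (ZMod p) (ZMod p → ZMod p) :=
    { carrier := {v | ∀ y y', cm y = 0 → cm y' = 0 → ind 𝓡 (1, y) (1, y') → v (cp y) = v (cp y')}
      mul_mem' := by
        intro a b ha hb y y' h1 h2 hi
        simp only [Pi.mul_apply]
        rw [ha y y' h1 h2 hi, hb y y' h1 h2 hi]
      add_mem' := by
        intro a b ha hb y y' h1 h2 hi
        simp only [Pi.add_apply]
        rw [ha y y' h1 h2 hi, hb y y' h1 h2 hi]
      algebraMap_mem' := by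
        intro r y y' h1 h2 hi
        rfl }
  have memV : ∀ v, v ∈ V ↔ ∀ y y', cm y = 0 → cm y' = 0 → ind 𝓡 (1, y) (1, y') →
    v (cp y) = v (cp y') := fun v => Iff.rfl
  -- matrices attached to elements of V
  let mat : (ZMod p → ZMod p) → ZMod n × ZMod n → ZMod p := fun v q =>
    if (∃ a ∈ A, (a : ZMod n) = q.1) ∧ cm q.2 = 0 then v (cp (q.1⁻¹ * q.2)) else 0
  have memA : ∀ {x y x' y' : ZMod n}, ind 𝓡 (x, y) (x', y') →
      (∃ a ∈ A, (a : ZMod n) = x) → ∃ a ∈ A, (a : ZMod n) = x' := by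
    rintro x y x' y' hi ⟨a, ha, rfl⟩
    obtain ⟨b, hb, hbx⟩ := h.ind_left hi
    exact ⟨b * a, A.mul_mem hb ha, by rw [hbx]; simp⟩
  have matinv : ∀ v ∈ V, ∀ q r, ind 𝓡 q r → mat v q = mat v r := by
    rintro v hv ⟨x, y⟩ ⟨x', y'⟩ hi
    have hs := h.closed.ind_symm hi
    by_cases hc : (∃ a ∈ A, (a : ZMod n) = x) ∧ cm y = 0
    · have hc' : (∃ a ∈ A, (a : ZMod n) = x') ∧ cm y' = 0 := ⟨memA hi hc.1, indm hi hc.2⟩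
      simp only [mat]
      rw [if_pos hc, if_pos hc']
      obtain ⟨⟨a, ha, rfl⟩, hcy⟩ := hc
      obtain ⟨⟨a', ha', rfl⟩, hcy'⟩ := hc'
      rw [ZMod.inv_coe_unit, ZMod.inv_coe_unit]
      apply hv
      · rw [map_mul, hcy, mul_zero]
      · rw [map_mul, hcy', mul_zero]
      · have h1 := h.ind_mul (A.inv_mem ha) (a : ZMod n) y
        have h2 := h.ind_mul (A.inv_mem ha') (a' : ZMod n) y'
        rw [Units.inv_mul] at h1 h2
        exact ind_trans (h.closed.ind_symm h1) (ind_trans hi h2)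
    · have hc' : ¬ ((∃ a ∈ A, (a : ZMod n) = x') ∧ cm y' = 0) := fun hc' =>
        hc ⟨memA hs hc'.1, indm hs hc'.2⟩
      simp only [mat]
      rw [if_neg hc, if_neg hc']
  have sumD : ∀ f : ZMod p → ZMod p, (∑ z : ZMod n, if cm z = 0 then f (cp z) else 0) =
      ∑ x, f x := by
    intro f
    rw [← Finset.sum_filter]
    apply Finset.sum_bij (fun z _ => cp z)
    · intro a _; exact Finset.mem_univ _
    · intro a ha b hb hab
      rw [Finset.mem_filter] at ha hb
      exact inj hab (ha.2.trans hb.2.symm)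
    · intro s _
      obtain ⟨z, hz1, hz2⟩ := crt_surj hn hco s 0
      exact ⟨z, Finset.mem_filter.mpr ⟨Finset.mem_univ _, hz2⟩, hz1⟩
    · intro a _; rfl
  have hVid : (fun s : ZMod p => s) ∈ V := by
    apply poly_lemma B k hk.symm hkp V
    · intro y y' h1 h2 hi
      obtain ⟨a, ha, hay⟩ := h.ind_diff hi
      have hma : cm (a : ZMod n) = 1 := by
        have := congrArg cm hay
        rw [map_sub, map_mul, map_sub, h1, h2, map_one] at this
        linear_combination this
      have haB : Units.map (cp : ZMod n →* ZMod p) a ∈ B :=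
        Subgroup.mem_map_of_mem _ ((memB0 a).mpr ⟨ha, hma⟩)
      have hpow : (cp (a : ZMod n)) ^ k = 1 := by
        have h3 : (⟨_, haB⟩ : B) ^ k = 1 := by rw [hk]; exact pow_card_eq_one'
        have h4 := congrArg (fun x : B => ((x : (ZMod p)ˣ) : ZMod p)) h3
        simpa using h4
      have := congrArg cp hay
      rw [map_sub, map_mul, map_sub, map_one] at this
      simp only
      rw [show 1 - cp y' = cp a * (1 - cp y) by linear_combination -this, mul_pow, hpow, one_mul]
    · intro y y' h1 h2 hi
      obtain ⟨b, hb, hby⟩ := h.ind_right hi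
      have hu : cp (b : ZMod n) ≠ 0 := (b.isUnit.map cp).ne_zero
      simp only
      rw [hby, map_mul, mul_pow, ZMod.pow_card_sub_one_eq_one hu, one_mul]
    · intro v hv w hw z hz
      let Km : ZMod n × ZMod n → ZMod p := fun q =>
        (if (∃ a ∈ A, (a : ZMod n) = q.2) ∧ cm (q.2 - q.1) = 0 then 1 else 0) *
        ∑ t, mat v (q.1, t) * (fun r : ZMod n × ZMod n => mat w (r.2, r.1)) (t, q.2)
      have Kminv : ∀ q r, ind 𝓡 q r → Km q = Km r := by
        rintro ⟨x, y⟩ ⟨x', y'⟩ hi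
        have h1 := h.closed.matmul (matinv v hv)
          (H := fun r : ZMod n × ZMod n => mat w (r.2, r.1))
          (fun q r hqr => matinv w hw _ _ (h.closed.ind_conv hqr)) hi
        simp only [Km]
        simp only at h1
        rw [h1]
        congr 1
        have stab : ∀ {x y x' y' : ZMod n}, ind 𝓡 (x, y) (x', y') →
            ((∃ a ∈ A, (a : ZMod n) = y) ∧ cm (y - x) = 0) →
            ((∃ a ∈ A, (a : ZMod n) = y') ∧ cm (y' - x') = 0) := by
          rintro x y x' y' hi ⟨h1, h2⟩
          refine ⟨memA (h.closed.ind_conv hi) h1, ?_⟩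
          obtain ⟨a, _, ha⟩ := h.ind_diff hi
          rw [ha, map_mul, h2, mul_zero]
        exact if_congr ⟨stab hi, stab (h.closed.ind_symm hi)⟩ rfl rfl
      have T := fun {q r} => h.closed.matmul Kminv (matinv z hz) (p := q) (q := r)
      -- evaluate
      have hone : ∃ a ∈ A, (a : ZMod n) = 1 := ⟨1, A.one_mem, rfl⟩
      have key : ∀ y, cm y = 0 → ∑ t, Km (1, t) * mat z (t, y) =
          ∑ b : B, (∑ x, v x * w (x * ((b : (ZMod p)ˣ) : ZMod p))) *
            z (cp y * ((b : (ZMod p)ˣ) : ZMod p)) := by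
        intro y hcy
        have hKm : ∀ a ∈ A, Km (1, (a : ZMod n)) = if cm (a : ZMod n) = 1 then
            ∑ x, v x * w (x * cp ((a⁻¹ : (ZMod n)ˣ) : ZMod n)) else 0 := by
          intro a ha
          simp only [Km]
          have e1 : ((∃ a' ∈ A, (a' : ZMod n) = (a : ZMod n)) ∧ cm ((a : ZMod n) - 1) = 0) ↔
              cm (a : ZMod n) = 1 := by
            rw [map_sub, map_one, sub_eq_zero]
            exact ⟨fun h => h.2, fun h => ⟨⟨a, ha, rfl⟩, h⟩⟩
          rw [if_congr e1 rfl rfl, ite_mul, one_mul, zero_mul]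
          congr 1
          rw [← sumD (fun x => v x * w (x * cp ((a⁻¹ : (ZMod n)ˣ) : ZMod n)))]
          apply Finset.sum_congr rfl
          intro t _
          simp only [mat]
          by_cases ht : cm t = 0
          · rw [if_pos ⟨hone, ht⟩, if_pos ⟨⟨a, ha, rfl⟩, ht⟩, if_pos ht, ZMod.inv_coe_unit,
              ← map_mul, mul_comm t, ← Units.val_one, ZMod.inv_coe_unit]
            simp
          · rw [if_neg (fun h => ht h.2), if_neg ht, zero_mul]
        symm
        have e2 : ∀ t : ZMod n, Km (1, t) * mat z (t, y) = if (∃ a ∈ B0, (a : ZMod n) = t) then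
            Km (1, t) * mat z (t, y) else 0 := by
          intro t
          split_ifs with ht
          · rfl
          · by_cases hA : ∃ a ∈ A, (a : ZMod n) = t
            · obtain ⟨a, ha, rfl⟩ := hA
              rw [hKm a ha, if_neg, zero_mul]
              intro hc
              exact ht ⟨a, (memB0 a).mpr ⟨ha, hc⟩, rfl⟩
            · simp only [mat]
              rw [if_neg (c := (∃ a ∈ A, (a : ZMod n) = t) ∧ cm y = 0) (fun hc => hA hc.1), mul_zero]
        rw [Finset.sum_congr rfl fun t _ => e2 t, ← Finset.sum_filter]
        symm
        have hb0 : ∀ t, (∃ a ∈ B0, (a : ZMod n) = t) → (∃ b : B, ((b : (ZMod p)ˣ) : ZMod p) =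
            cp (t⁻¹)) := by
          rintro t ⟨a, ha, rfl⟩
          exact ⟨⟨_, Subgroup.mem_map_of_mem _ (B0.inv_mem ha)⟩, by
            rw [ZMod.inv_coe_unit]; rfl⟩
        apply Finset.sum_bij (fun t ht => Classical.choose (hb0 t (Finset.mem_filter.mp ht).2))
        · intro t ht; exact Finset.mem_univ _
        · intro t1 ht1 t2 ht2 heq
          have s1 := Classical.choose_spec (hb0 t1 (Finset.mem_filter.mp ht1).2)
          have s2 := Classical.choose_spec (hb0 t2 (Finset.mem_filter.mp ht2).2)
          rw [heq] at s1
          have s3 := s1.symm.trans s2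
          obtain ⟨a1, ha1, rfl⟩ := (Finset.mem_filter.mp ht1).2
          obtain ⟨a2, ha2, rfl⟩ := (Finset.mem_filter.mp ht2).2
          rw [ZMod.inv_coe_unit, ZMod.inv_coe_unit] at s3
          have s4 := inj s3 (((memB0 _).mp (B0.inv_mem ha1)).2.trans
            ((memB0 _).mp (B0.inv_mem ha2)).2.symm)
          rw [inv_injective (Units.ext s4)]
        · rintro ⟨b, ⟨a, ha, hab⟩⟩ _
          refine ⟨((a⁻¹ : (ZMod n)ˣ) : ZMod n), Finset.mem_filter.mpr ⟨Finset.mem_univ _,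
            a⁻¹, B0.inv_mem ha, rfl⟩, ?_⟩
          apply Subtype.ext
          apply Units.ext
          have s1 := Classical.choose_spec (hb0 ((a⁻¹ : (ZMod n)ˣ) : ZMod n)
            ⟨a⁻¹, B0.inv_mem ha, rfl⟩)
          rw [s1, ZMod.inv_coe_unit, inv_inv]
          exact congrArg Units.val hab
        · intro t ht
          have s1 := Classical.choose_spec (hb0 t (Finset.mem_filter.mp ht).2)
          rw [s1]
          obtain ⟨a, ha, rfl⟩ := (Finset.mem_filter.mp ht).2
          have ha' := (memB0 a).mp ha
          rw [hKm a ha'.1, if_pos ha'.2, ZMod.inv_coe_unit]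
          congr 1
          simp only [mat]
          rw [if_pos ⟨⟨a, ha'.1, rfl⟩, hcy⟩, ZMod.inv_coe_unit, ← map_mul, mul_comm y]
      intro y y' hy hy' hi
      have := T hi
      simp only at this
      rw [key y hy, key y' hy'] at this
      exact this
  rw [mul_eq_zero_iff_red hn] at hy hy'
  exact inj (hVid y y' hy hy' hi).symm (hy'.trans hy.symm)

/-- Step 1 -/
theorem step1 (hN : NormA A) (h : Good A 𝓡) {p : ℕ} (hp : p.Prime) (hpn : p ∣ n)
    {y y' : ZMod n} (hy : (p : ZMod n) * y = 0) (hi : ind 𝓡 (1, y) (1, y')) : y' = y := by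
  obtain ⟨m, hn⟩ := hpn
  have hy' : (p : ZMod n) * y' = 0 := by
    obtain ⟨b, _, hby⟩ := h.ind_right hi
    rw [hby, mul_left_comm, hy, mul_zero]
  by_cases hp2 : p = 2
  · subst hp2
    exact step1_two h hn (by exact_mod_cast hy) hi
  by_cases hpm : p ∣ m
  · exact step1_sq hN h hp hp2 hn hpm hy hy' hi
  have hco : Nat.Coprime p m := (Nat.Prime.coprime_iff_not_dvd hp).mpr hpm
  by_cases hp3 : p = 3
  · subst hp3
    exact step1_three h hn hco hy hy' hi
  have hp5 : 5 ≤ p := by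
    have := hp.two_le
    have h4 : p ≠ 4 := fun h => by rw [h] at hp; exact absurd hp (by norm_num)
    omega
  exact step1_poly hN h hp hp5 hn hco hy hy' hi

end step1
end Circ

set_option linter.unusedSectionVars false
namespace Circ
open CohCfg

theorem lte_dvd {q W r : ℕ} (hq : Odd q) (hr : r ≠ 0) (hW : 1 ≤ W) (hd : q ∣ W ^ r - 1)
    (hp : ∀ p, p.Prime → p ∣ q → p ∣ W - 1) : q ∣ r * (W - 1) := by
  rcases Nat.eq_or_lt_of_le hW with h1 | h1
  · rw [← h1]; simp
  have hq0 : q ≠ 0 := by rintro rfl; simp at hq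
  have hne : r * (W - 1) ≠ 0 := Nat.mul_ne_zero hr (by omega)
  rw [← Nat.factorization_le_iff_dvd hq0 hne]
  intro p
  by_cases hpp : p.Prime
  swap
  · rw [Nat.factorization_eq_zero_of_not_prime _ hpp]; exact Nat.zero_le _
  by_cases hpq : p ∣ q
  swap
  · rw [Nat.factorization_eq_zero_of_not_dvd hpq]; exact Nat.zero_le _
  have : Fact p.Prime := ⟨hpp⟩
  have hpW := hp p hpp hpq
  have hodd : Odd p := hq.of_dvd_nat hpq
  have hpW' : ¬ p ∣ W := fun h => by
    have := (Nat.dvd_sub_iff_right hW h).mp hpW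
    exact hpp.one_lt.ne' (Nat.dvd_one.mp this)
  have key := padicValNat.pow_sub_pow (p := p) (x := W) (y := 1) hodd h1 (by simpa using hpW) hpW' hr
  have hW0 : W ^ r - 1 ≠ 0 := by
    have : 1 < W ^ r := Nat.one_lt_pow hr h1
    omega
  have h2 := (Nat.factorization_le_iff_dvd hq0 hW0).mpr hd p
  rw [one_pow] at key
  rw [Nat.factorization_def _ hpp] at h2 ⊢
  rw [Nat.factorization_def _ hpp] at h2 ⊢
  rw [key] at h2
  rw [padicValNat.mul hr (by omega)]
  omega

section two
variable {n : ℕ} [NeZero n] {A : Subgroup (ZMod n)ˣ}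

theorem red_one_iff {d : ℕ} (hd : d ∣ n) (x : ZMod n) (hx : x ≠ 0) : red d hd x = 1 ↔ d ∣ x.val - 1 := by
  have h1 : x = ((x.val : ℕ) : ZMod n) := (ZMod.natCast_zmod_val x).symm
  have h0 : x.val ≠ 0 := by rwa [Ne, ZMod.val_eq_zero]
  conv_lhs => rw [h1, red_natCast]
  have e : ((x.val : ℕ) : ZMod d) = ((x.val - 1 : ℕ) : ZMod d) + 1 := by
    rw [← Nat.cast_one (R := ZMod d), ← Nat.cast_add]; congr 1; omega
  rw [e, ← ZMod.natCast_eq_zero_iff]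
  constructor
  · intro h; simpa using h
  · intro h; rw [h, zero_add]

theorem pow_c2 {k : ℕ} (x : (ZMod (2 ^ k))ˣ) : x ^ (2 ^ k) = 1 := by
  have : NeZero (2 ^ k) := ⟨by positivity⟩
  have h := ZMod.pow_totient x
  have hd : Nat.totient (2 ^ k) ∣ 2 ^ k := by
    rcases Nat.eq_zero_or_pos k with h0 | h0
    · subst h0; simp
    · rw [Nat.totient_prime_pow Nat.prime_two h0]
      simpa using pow_dvd_pow 2 (Nat.sub_le k 1)
  obtain ⟨t, ht⟩ := hd
  calc x ^ (2 ^ k) = x ^ (Nat.totient (2 ^ k) * t) := congrArg (x ^ ·) ht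
    _ = 1 := by rw [pow_mul, h, one_pow]

theorem rad_lemma (hN : NormA A) {k q : ℕ} (hn : n = 2 ^ k * q) (hq : Odd q) {a : (ZMod n)ˣ}
    (ha : a ∈ A) (h1 : ∀ p (hp : p.Prime) (hpq : p ∣ q), red p (hpq.trans ⟨2 ^ k, by rw [hn, mul_comm]⟩)
      (a : ZMod n) = 1) : red q ⟨2 ^ k, by rw [hn, mul_comm]⟩ (a : ZMod n) = 1 := by
  have hn0 : n ≠ 0 := NeZero.ne n
  by_cases hn1 : n = 1
  · have : q = 1 := by
      rw [hn1] at hn; exact Nat.eq_one_of_mul_eq_one_left hn.symm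
    subst this; exact Subsingleton.elim _ _
  have : Fact (1 < n) := ⟨by omega⟩
  have hqn : q ∣ n := ⟨2 ^ k, by rw [hn, mul_comm]⟩
  have hco : Nat.Coprime (2 ^ k) q := (Nat.Coprime.pow_left k (Nat.coprime_two_left.mpr hq))
  have c1 : ∀ j, ∀ p (hp : p.Prime) (hpq : p ∣ q), p ∣ ((a ^ j : (ZMod n)ˣ) : ZMod n).val - 1 := by
    intro j p hp hpq
    rw [← red_one_iff (hpq.trans hqn) _ (Units.ne_zero _), Units.val_pow_eq_pow_val, map_pow, h1 p hp hpq, one_pow]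
  -- c = a ^ 2 ^ k is trivial
  have hc : a ^ (2 ^ k) = 1 := by
    by_contra hc
    obtain ⟨r, hr, hrd⟩ := Nat.exists_prime_and_dvd (n := orderOf (a ^ (2 ^ k)))
      (by rwa [Ne, orderOf_eq_one_iff])
    obtain ⟨j, hj⟩ := hrd
    set w := (a ^ (2 ^ k)) ^ j with hw
    have hj0 : 0 < j := by
      rcases Nat.eq_zero_or_pos j with h | h
      · rw [h, mul_zero] at hj
        exact absurd hj (orderOf_pos _).ne'
      · exact h
    have hwr : w ^ r = 1 := by rw [hw, ← pow_mul, mul_comm, ← hj, pow_orderOf_eq_one]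
    have hw1 : w ≠ 1 := by
      intro h
      have := orderOf_dvd_of_pow_eq_one (hw ▸ h)
      have := Nat.le_of_dvd hj0 this
      rw [hj] at this
      have := hr.two_le
      nlinarith
    have hwA : w ∈ A := A.pow_mem (A.pow_mem ha _) _
    have hw0 : (w : ZMod n) ≠ 0 := Units.ne_zero _
    have hwp : ∀ p, p.Prime → p ∣ q → p ∣ (w : ZMod n).val - 1 := by
      intro p hp hpq
      have := c1 (2 ^ k * j) p hp hpq
      rwa [pow_mul] at this
    have hW : 1 ≤ (w : ZMod n).val := Nat.one_le_iff_ne_zero.mpr (by rwa [Ne, ZMod.val_eq_zero])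
    have hw2 : 2 ^ k ∣ (w : ZMod n).val - 1 := by
      rw [← red_one_iff ⟨q, hn⟩ _ hw0]
      have := pow_c2 (Units.map (red (2 ^ k) ⟨q, hn⟩ : ZMod n →* ZMod (2 ^ k)) a)
      have h3 := congrArg Units.val this
      simp only [Units.val_pow_eq_pow_val, Units.coe_map, Units.val_one, MonoidHom.coe_coe] at h3
      rw [hw]; simp only [Units.val_pow_eq_pow_val, map_pow]
      rw [h3, one_pow]
    have hqd : ∀ m, m ∣ q → m ∣ r * ((w : ZMod n).val - 1) := by
      intro m hm
      refine hm.trans (lte_dvd hq hr.ne_zero hW ?_ hwp)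
      refine hqn.trans ?_
      rw [← ZMod.natCast_eq_zero_iff, Nat.cast_sub (Nat.one_le_pow _ _ hW)]
      have : (w : ZMod n) ^ r = 1 := by rw [← Units.val_pow_eq_pow_val, hwr]; rfl
      push_cast
      rw [ZMod.natCast_zmod_val, this, sub_self]
    have contra : ¬ (q ∣ (w : ZMod n).val - 1) := by
      intro h
      apply hw1
      have : n ∣ (w : ZMod n).val - 1 := by
        exact (dvd_of_eq hn).trans (Nat.Coprime.mul_dvd_of_dvd_of_dvd hco hw2 h)
      rw [← ZMod.natCast_eq_zero_iff, Nat.cast_sub hW, ZMod.natCast_zmod_val, Nat.cast_one, sub_eq_zero] at this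
      exact Units.ext this
    have hrq : r ∣ q := by
      by_contra h
      apply contra
      exact (Nat.Coprime.dvd_of_dvd_mul_left ((Nat.Prime.coprime_iff_not_dvd hr).mpr h).symm (hqd q dvd_rfl))
    have hr2 : r ≠ 2 := by
      rintro rfl
      exact (Nat.not_even_iff_odd.mpr hq) (even_iff_two_dvd.mpr hrq)
    obtain ⟨q', hq'⟩ := hrq
    have hrq' : r ∣ q' := by
      by_contra h
      apply contra
      have co : Nat.Coprime r q' := (Nat.Prime.coprime_iff_not_dvd hr).mpr h
      rw [hq']
      apply Nat.Coprime.mul_dvd_of_dvd_of_dvd co (hwp r hr ⟨q', hq'⟩)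
      exact Nat.Coprime.dvd_of_dvd_mul_left co.symm (hqd q' ⟨r, by rw [hq', mul_comm]⟩)
    apply hw1
    refine N1 hN hr hr2 (m := 2 ^ k * q') (by rw [hn, hq']; ring) (hrq'.mul_left _) w hwA ?_
    have h5 : n ∣ r * ((w : ZMod n).val - 1) := by
      exact (dvd_of_eq hn).trans (Nat.Coprime.mul_dvd_of_dvd_of_dvd hco (hw2.mul_left _) (hqd q dvd_rfl))
    rw [← ZMod.natCast_eq_zero_iff, Nat.cast_mul, Nat.cast_sub hW, ZMod.natCast_zmod_val, Nat.cast_one] at h5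
    exact h5
  have ha0 : (a : ZMod n) ≠ 0 := Units.ne_zero _
  have hW : 1 ≤ (a : ZMod n).val := Nat.one_le_iff_ne_zero.mpr (by rwa [Ne, ZMod.val_eq_zero])
  rw [red_one_iff _ _ ha0]
  have h6 : q ∣ 2 ^ k * ((a : ZMod n).val - 1) := by
    refine lte_dvd hq (by positivity) hW ?_ (by simpa using c1 1)
    refine hqn.trans ?_
    rw [← ZMod.natCast_eq_zero_iff, Nat.cast_sub (Nat.one_le_pow _ _ hW)]
    have : (a : ZMod n) ^ 2 ^ k = 1 := by rw [← Units.val_pow_eq_pow_val, hc]; rfl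
    push_cast
    rw [ZMod.natCast_zmod_val, this, sub_self]
  exact Nat.Coprime.dvd_of_dvd_mul_left hco.symm h6

end two
end Circ

set_option linter.unusedSectionVars false
namespace Circ
open CohCfg

section two
variable {n : ℕ} [NeZero n] {A : Subgroup (ZMod n)ˣ}

theorem even_or_odd' (h2 : 2 ∣ n) (x : ZMod n) : (∃ s, x = 2 * s) ∨ (∃ s, x = 1 + 2 * s) := by
  have h : red 2 h2 x = 0 ∨ red 2 h2 (x - 1) = 0 := by
    rw [map_sub, map_one]
    generalize red 2 h2 x = y
    revert y; decide
  rcases h with h | h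
  · obtain ⟨t, ht⟩ := (red_eq_zero_iff h2 x).mp h
    exact Or.inl ⟨t, by rw [ht]; simp⟩
  · obtain ⟨t, ht⟩ := (red_eq_zero_iff h2 _).mp h
    exact Or.inr ⟨t, by rw [← sub_eq_iff_eq_add', ht]; simp⟩

theorem unit_odd (h2 : 2 ∣ n) (x : ZMod n) (hx : IsUnit x) : ∃ s, x = 1 + 2 * s := by
  rcases even_or_odd' h2 x with ⟨s, hs⟩ | h
  · exfalso
    have := hx.map (red 2 h2)
    rw [hs, map_mul] at this
    have e : red 2 h2 (2 : ZMod n) = 0 := by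
      have := red_natCast h2 2
      push_cast at this
      rw [this]; decide
    rw [e, zero_mul] at this
    exact absurd this (by decide)
  · exact h

theorem mod4 (h4 : 4 ∣ n) (x : ZMod n) : ∃ s, x = 4 * s ∨ x = 1 + 4 * s ∨ x = 2 + 4 * s ∨ x = 3 + 4 * s := by
  have h : red 4 h4 x = 0 ∨ red 4 h4 (x - 1) = 0 ∨ red 4 h4 (x - 2) = 0 ∨ red 4 h4 (x - 3) = 0 := by
    simp only [map_sub, map_one, map_ofNat]
    generalize red 4 h4 x = y
    revert y; decide
  have key : ∀ z : ZMod n, red 4 h4 z = 0 → ∃ s, z = 4 * s := by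
    intro z hz
    obtain ⟨t, ht⟩ := (red_eq_zero_iff h4 z).mp hz
    exact ⟨t, by rw [ht]; simp⟩
  rcases h with h | h | h | h
  · obtain ⟨s, hs⟩ := key _ h; exact ⟨s, Or.inl hs⟩
  · obtain ⟨s, hs⟩ := key _ h; exact ⟨s, Or.inr (Or.inl (by linear_combination hs))⟩
  · obtain ⟨s, hs⟩ := key _ h; exact ⟨s, Or.inr (Or.inr (Or.inl (by linear_combination hs)))⟩
  · obtain ⟨s, hs⟩ := key _ h; exact ⟨s, Or.inr (Or.inr (Or.inr (by linear_combination hs)))⟩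

theorem unit_mod4 (h4 : 4 ∣ n) (x : ZMod n) (hx : IsUnit x) : ∃ s, x = 1 + 4 * s ∨ x = 3 + 4 * s := by
  obtain ⟨s, hs⟩ := mod4 h4 x
  have e : red 4 h4 (4 : ZMod n) = 0 := by
    rw [map_ofNat]; decide
  have hu := hx.map (red 4 h4)
  rcases hs with hs | hs | hs | hs
  · exfalso
    rw [hs, map_mul, e, zero_mul] at hu
    exact absurd hu (by decide)
  · exact ⟨s, Or.inl hs⟩
  · exfalso
    rw [hs, map_add, map_mul, e, zero_mul, map_ofNat] at hu
    exact absurd hu (by decide)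
  · exact ⟨s, Or.inr hs⟩

variable {m : ℕ} 

theorem two_hh (hn : n = 2 * (2 * m)) : (2 : ZMod n) * ((2 * m : ℕ) : ZMod n) = 0 := by
  have : ((2 * (2 * m) : ℕ) : ZMod n) = 0 := by rw [ZMod.natCast_eq_zero_iff, hn]
  rw [Nat.cast_mul] at this
  exact_mod_cast this

theorem hh_odd (hn : n = 2 * (2 * m)) (s : ZMod n) :
    ((2 * m : ℕ) : ZMod n) * (1 + 2 * s) = ((2 * m : ℕ) : ZMod n) := by
  linear_combination s * two_hh hn

theorem hh_unit (hn : n = 2 * (2 * m)) {x : ZMod n} (hx : IsUnit x) :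
    ((2 * m : ℕ) : ZMod n) * x = ((2 * m : ℕ) : ZMod n) := by
  obtain ⟨s, rfl⟩ := unit_odd ⟨_, hn⟩ x hx
  exact hh_odd hn s

theorem two_tors (hn : n = 2 * (2 * m)) {z : ZMod n} (hz : 2 * z = 0) :
    z = 0 ∨ z = ((2 * m : ℕ) : ZMod n) := by
  have h1 : ((2 : ℕ) : ZMod n) * z = 0 := by exact_mod_cast hz
  rw [mul_eq_zero_iff_red hn, red_eq_zero_iff] at h1
  obtain ⟨t, ht⟩ := h1
  rcases even_or_odd' ⟨_, hn⟩ t with ⟨s, hs⟩ | ⟨s, hs⟩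
  · left; rw [ht, hs]; linear_combination s * two_hh hn
  · right; rw [ht, hs]; exact hh_odd hn s

theorem odd_cancel {k : ℕ} {d s : ZMod n} (h : d * (1 + 2 * s) = 0) (h2 : (2 : ZMod n) ^ k * d = 0) : d = 0 := by
  have h1 : d = (-2 * s) * d := by linear_combination h
  have h3 : ∀ j, d = (-2 * s) ^ j * d := by
    intro j
    induction j with
    | zero => simp
    | succ j ih => rw [pow_succ, mul_assoc, ← h1]; exact ih
  rw [h3 k, mul_pow, neg_pow]
  linear_combination (-1) ^ k * s ^ k * h2

theorem two_aux (hN : NormA A) {k : ℕ} (hn : n = 2 * (2 * m)) (j : ℕ) : ∀ x : (ZMod n)ˣ, x ∈ A →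
    (2 : ZMod n) ^ k * ((x : ZMod n) - 1) = 0 → (∃ s, (x : ZMod n) = 1 + 4 * s) → x ^ (2 ^ j) = 1 →
    (x : ZMod n) = 1 ∨ (x : ZMod n) = 1 + ((2 * m : ℕ) : ZMod n) := by
  induction j with
  | zero => intro x _ _ _ h; left; rw [pow_zero, pow_one] at h; rw [h]; rfl
  | succ j ih =>
    rintro x hx hk ⟨s, hs⟩ hp
    have h1 := ih (x ^ 2) (A.pow_mem hx 2) (by
      rw [Units.val_pow_eq_pow_val]; linear_combination ((x : ZMod n) + 1) * hk)
      ⟨2 * s + 4 * s ^ 2, by rw [Units.val_pow_eq_pow_val, hs]; ring⟩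
      (by rw [← pow_mul, ← pow_succ']; exact hp)
    rw [Units.val_pow_eq_pow_val] at h1
    have h2 : 2 * ((x : ZMod n) ^ 2 - 1) = 0 := by
      rcases h1 with h1 | h1
      · rw [h1]; ring
      · rw [h1]; linear_combination two_hh hn
    have h3 : 4 * ((x : ZMod n) - 1) = 0 := by
      apply odd_cancel (s := s) (k := k)
      · linear_combination h2 - 2 * ((x : ZMod n) - 1) * hs
      · linear_combination 4 * hk
    rcases two_tors hn (z := 2 * ((x : ZMod n) - 1)) (by linear_combination h3) with h4 | h4
    · rcases two_tors hn h4 with h5 | h5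
      · left; linear_combination h5
      · right; linear_combination h5
    · exfalso
      refine N3 hN hn (x ^ 2) (A.pow_mem hx 2) ?_ x hx h4
      rw [Units.val_pow_eq_pow_val]
      linear_combination ((x : ZMod n) - 1) * hs + (1 + 2 * s) * h4 + hh_odd hn s

theorem two_lemma (hN : NormA A) {k q : ℕ} (hn : n = 2 ^ k * q) (hq : Odd q)  (hm : n = 2 * (2 * m))
    {x : (ZMod n)ˣ} (hx : x ∈ A) (h1 : red q ⟨2 ^ k, by rw [hn, mul_comm]⟩ (x : ZMod n) = 1)
    (h4 : ∃ s, (x : ZMod n) = 1 + 4 * s) : 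
    (x : ZMod n) = 1 ∨ (x : ZMod n) = 1 + ((2 * m : ℕ) : ZMod n) := by
  have hco : Nat.Coprime (2 ^ k) q := (Nat.Coprime.pow_left k (Nat.coprime_two_left.mpr hq))
  refine two_aux hN (k := k) hm k x hx ?_ h4 ?_
  · have := (mul_eq_zero_iff_red hn ((x : ZMod n) - 1)).mpr (by rw [map_sub, h1, map_one, sub_self])
    exact_mod_cast this
  · apply Units.ext
    apply crt_inj hn hco
    · have := pow_c2 (Units.map (red (2 ^ k) ⟨q, hn⟩ : ZMod n →* ZMod (2 ^ k)) x)
      have h3 := congrArg Units.val this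
      simp only [Units.val_pow_eq_pow_val, Units.coe_map, Units.val_one, MonoidHom.coe_coe] at h3
      simp only [Units.val_pow_eq_pow_val, map_pow, Units.val_one, map_one]
      exact h3
    · rw [Units.val_pow_eq_pow_val, map_pow, h1, Units.val_one, map_one, one_pow]

theorem N3' (hN : NormA A) (hn : n = 2 * (2 * m))
    (b : (ZMod n)ˣ) (hb : b ∈ A) (hb1 : (b : ZMod n) = 1 + (2 * m : ℕ))
    (a : (ZMod n)ˣ) (ha : a ∈ A) (w : ZMod n) (hw : IsUnit w)
    (h : ((a : ZMod n) - 1) * (2 * w) = (2 * m : ℕ)) : False := by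
  refine N3 hN hn b hb hb1 a ha ?_
  apply hw.mul_right_cancel
  rw [hh_unit hn hw]
  linear_combination h

end two
end Circ

set_option linter.unusedSectionVars false
namespace Circ
open CohCfg

section steps
variable {n : ℕ} [NeZero n] {A : Subgroup (ZMod n)ˣ} {𝓡 : Set (Set (ZMod n × ZMod n))}

theorem Fix.trans {z : ZMod n} (hz : Fix A z) (h : Good A 𝓡) {y y' : ZMod n}
    (hi : ind 𝓡 (1, y) (1, y')) : ind 𝓡 (z, y) (z, y') := by
  obtain ⟨z', h1, h2⟩ := h.closed.transport hi z
  rw [hz 𝓡 h z' h1] at h2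
  exact h2

theorem Fix.diff {z : ZMod n} (hz : Fix A z) (h : Good A 𝓡) {y y' : ZMod n}
    (hi : ind 𝓡 (1, y) (1, y')) : ∃ a ∈ A, y' - z = (a : ZMod n) * (y - z) :=
  h.ind_diff (hz.trans h hi)

/-- Step 2 -/
theorem step2 (hN : NormA A) (h : Good A 𝓡) {k q : ℕ} (hn : n = 2 ^ k * q) (hq : Odd q) {y y' : ZMod n}
    (hy : IsUnit y) (hi : ind 𝓡 (1, y) (1, y')) :
    ∃ a ∈ A, y' = (a : ZMod n) * y ∧ red q ⟨2 ^ k, by rw [hn, mul_comm]⟩ (a : ZMod n) = 1 := by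
  obtain ⟨a, ha, hay⟩ := h.ind_right hi
  refine ⟨a, ha, hay, ?_⟩
  apply rad_lemma hN hn hq ha
  intro p hp hpq
  have hpn : p ∣ n := hpq.trans ⟨2 ^ k, by rw [hn, mul_comm]⟩
  obtain ⟨m, hm⟩ := hpn
  have hm' : n = m * p := by rw [hm, mul_comm]
  obtain ⟨u, rfl⟩ := hy
  have hpm : (p : ZMod n) * (m : ZMod n) = 0 := by
    rw [← Nat.cast_mul, ← hm, ZMod.natCast_self]
  have hf : ∀ z : ZMod n, (p : ZMod n) * z = 0 → Fix A z := fun z hz 𝓡 h y' hi =>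
    step1 hN h hp ⟨m, hm⟩ hz hi
  have i1 := (hf (m : ZMod n) hpm).trans h hi
  have i2 := h.closed.ind_conv i1
  rw [hay] at i2
  have i3 := h.ind_mul (A.inv_mem ha) ((a : ZMod n) * u) (m : ZMod n)
  rw [Units.inv_mul_cancel_left] at i3
  have i4 := ind_trans i2 i3
  have e : (m : ZMod n) = u * (((u⁻¹ : (ZMod n)ˣ) : ZMod n) * m) := by simp
  have i5 := Fix.unit (y := ((u⁻¹ : (ZMod n)ˣ) : ZMod n) * m) (A := A)
    (fun 𝓡 h y' hi => hf _ (by rw [mul_left_comm, hpm, mul_zero]) 𝓡 h y' hi) u h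
    (z := ((a⁻¹ : (ZMod n)ˣ) : ZMod n) * m) (by rw [← e]; exact i4)
  rw [← e, Units.inv_mul_eq_iff_eq_mul] at i5
  have i6 : (m : ZMod n) * (a : ZMod n) = m * 1 := by rw [mul_one, mul_comm]; exact i5.symm
  rw [mul_eq_iff_red hm', map_one] at i6
  exact i6

theorem two_isUnit_q {q : ℕ} (hq : Odd q) : IsUnit (2 : ZMod q) := by
  have := (ZMod.isUnit_iff_coprime 2 q).mpr (Nat.coprime_two_left.mpr hq)
  exact_mod_cast this

theorem odd_isUnit_two {k : ℕ} (s : ZMod (2 ^ k)) : IsUnit (1 + 2 * s) := by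
  have h : IsNilpotent (2 * s) := ⟨k, by
    have : (2 : ZMod (2 ^ k)) ^ k = 0 := by
      have := ZMod.natCast_self (2 ^ k)
      exact_mod_cast this
    rw [mul_pow, this, zero_mul]⟩
  exact h.isUnit_one_add

theorem exists_m4 {k q : ℕ} (hk : 2 ≤ k) (hn : n = 2 ^ k * q) : ∃ m, n = 2 * (2 * m) := by
  obtain ⟨j, rfl⟩ : ∃ j, k = j + 2 := ⟨k - 2, by omega⟩
  exact ⟨2 ^ j * q, by rw [hn]; ring⟩

theorem red2_eq {k q : ℕ} (hn : n = 2 ^ k * q) {x y : ZMod n} {c : ZMod n}  (hk : 2 ≤ k)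
    (h : red (2 ^ k) ⟨q, hn⟩ x = red (2 ^ k) ⟨q, hn⟩ y) (hy : ∃ s, y = c + 4 * s) : ∃ s, x = c + 4 * s := by
  rw [← sub_eq_zero, ← map_sub, red_eq_zero_iff] at h
  obtain ⟨t, ht⟩ := h
  obtain ⟨s, hs⟩ := hy
  obtain ⟨j, rfl⟩ : ∃ j, k = j + 2 := ⟨k - 2, by omega⟩
  refine ⟨s + 2 ^ j * t, ?_⟩
  push_cast at ht
  linear_combination ht + hs

theorem step3a (hN : NormA A) {k q : ℕ} (hn : n = 2 ^ k * q) (hq : Odd q) (hk : 2 ≤ k)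
    {u : ZMod n} (h3 : ∃ s, u = 3 + 4 * s) (hu : red q ⟨2 ^ k, by rw [hn, mul_comm]⟩ u = -1) : Fix A u := by
  have hco : Nat.Coprime (2 ^ k) q := (Nat.Coprime.pow_left k (Nat.coprime_two_left.mpr hq))
  obtain ⟨m, hm⟩ := exists_m4 hk hn
  have h4 : 4 ∣ n := ⟨m, by rw [hm]; ring⟩
  obtain ⟨s, hs⟩ := h3
  have hw : IsUnit (1 + 2 * s) := by
    apply isUnit_crt hn hco
    · have := odd_isUnit_two (k := k) (red (2 ^ k) ⟨q, hn⟩ s)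
      simpa only [map_add, map_mul, map_one, map_ofNat] using this
    · have h2 := two_isUnit_q hq
      rw [hs] at hu
      simp only [map_add, map_mul, map_one, map_ofNat] at hu ⊢
      have : (2 : ZMod q) * (1 + 2 * red q ⟨2 ^ k, by rw [hn, mul_comm]⟩ s) = 2 * (-1) := by
        linear_combination hu
      rw [h2.mul_left_cancel this]
      exact isUnit_one.neg
  have huu : IsUnit u := by
    apply isUnit_crt hn hco
    · have := odd_isUnit_two (k := k) (red (2 ^ k) ⟨q, hn⟩ (1 + 2 * s))
      rw [hs]
      convert this using 1
      simp only [map_add, map_mul, map_one, map_ofNat]; ring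
    · rw [hu]; exact isUnit_one.neg
  intro 𝓡 h u' hi
  obtain ⟨a, ha, hau, hqa⟩ := step2 hN h hn hq huu hi
  obtain ⟨b, hb, hbu⟩ := h.ind_diff hi
  have hqb : red q ⟨2 ^ k, by rw [hn, mul_comm]⟩ (b : ZMod n) = 1 := by
    have := congrArg (red q ⟨2 ^ k, by rw [hn, mul_comm]⟩) hbu
    rw [hau, map_sub, map_mul, map_mul, map_sub, hqa, hu, map_one] at this
    apply (two_isUnit_q hq).mul_left_cancel
    linear_combination this
  have heven : ((2 * m : ℕ) : ZMod n) * (u - 1) = 0 := by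
    rw [hs]; linear_combination (1 + 2 * s) * two_hh hm
  have hhu : ((2 * m : ℕ) : ZMod n) * u = ((2 * m : ℕ) : ZMod n) := hh_unit hm huu
  have fin : ((a : ZMod n) = 1 ∨ (a : ZMod n) = 1 + ((2 * m : ℕ) : ZMod n)) → u' = u := by
    rintro (h1 | h1)
    · rw [hau, h1, one_mul]
    · exfalso
      refine N3' hN hm a ha h1 b hb (1 + 2 * s) hw ?_
      rw [hau, h1] at hbu
      linear_combination -hbu + hhu - ((b : ZMod n) - 1) * hs
  obtain ⟨t, ht⟩ := unit_mod4 h4 (b : ZMod n) b.isUnit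
  rcases ht with ht | ht
  · rcases two_lemma hN hn hq hm hb hqb ⟨t, ht⟩ with h1 | h1
    · rw [h1] at hbu; linear_combination hbu
    · rw [h1] at hbu; linear_combination hbu + heven
  obtain ⟨r, hr⟩ := unit_mod4 h4 (a : ZMod n) a.isUnit
  rcases hr with hr | hr
  · exact fin (two_lemma hN hn hq hm ha hqa ⟨r, hr⟩)
  · apply fin
    have e1 := two_lemma hN hn hq hm (A.mul_mem ha hb) (by rw [Units.val_mul, map_mul, hqa, hqb, mul_one])
      ⟨2 + 3 * t + 3 * r + 4 * r * t, by rw [Units.val_mul, hr, ht]; ring⟩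
    have e2 := two_lemma hN hn hq hm (A.mul_mem ha ha) (by rw [Units.val_mul, map_mul, hqa, mul_one])
      ⟨2 + 6 * r + 4 * r * r, by rw [Units.val_mul, hr]; ring⟩
    rw [Units.val_mul] at e1 e2
    have e3 : (a : ZMod n) * (u' - 1) = u - 1 := by
      rw [hbu]
      rcases e1 with e1 | e1
      · linear_combination (u - 1) * e1
      · linear_combination (u - 1) * e1 + heven
    rw [hau] at e3
    rcases e2 with e2 | e2
    · left; linear_combination -e3 + u * e2
    · right; linear_combination -e3 + u * e2 + hhu

theorem step3 (hN : NormA A) {k q : ℕ} (hn : n = 2 ^ k * q) (hq : Odd q)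
    {y : ZMod n} (hy : IsUnit y) : Fix A y := by
  have hco : Nat.Coprime (2 ^ k) q := (Nat.Coprime.pow_left k (Nat.coprime_two_left.mpr hq))
  by_cases hk : 2 ≤ k
  swap
  · intro 𝓡 h y' hi
    obtain ⟨a, ha, hay, hqa⟩ := step2 hN h hn hq hy hi
    rw [hay]
    apply crt_inj hn hco
    · rw [map_mul]
      have hu : IsUnit (red (2 ^ k) ⟨q, hn⟩ (a : ZMod n)) := a.isUnit.map _
      have : red (2 ^ k) ⟨q, hn⟩ (a : ZMod n) = 1 := by
        revert hu
        generalize red (2 ^ k) ⟨q, hn⟩ (a : ZMod n) = s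
        have : k = 0 ∨ k = 1 := by omega
        rcases this with rfl | rfl
        · revert s; decide
        · revert s; decide
      rw [this, one_mul]
    · rw [map_mul, hqa, one_mul]
  obtain ⟨m, hm⟩ := exists_m4 hk hn
  have h4 : 4 ∣ n := ⟨m, by rw [hm]; ring⟩
  have b : ∀ y : ZMod n, IsUnit y → (∃ s, y = 3 + 4 * s) → Fix A y := by
    intro y hy h3 𝓡 h y' hi
    obtain ⟨a, ha, hay, hqa⟩ := step2 hN h hn hq hy hi
    obtain ⟨u, hu1, hu2⟩ := crt_surj hn hco (red (2 ^ k) ⟨q, hn⟩ y) (-1)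
    obtain ⟨c, hc, hcy⟩ := (step3a hN hn hq hk (red2_eq hn hk hu1 h3) hu2).diff h hi
    apply crt_inj hn hco
    · have := congrArg (red (2 ^ k) ⟨q, hn⟩) hcy
      rw [map_sub, map_mul, map_sub, hu1] at this
      linear_combination this
    · rw [hay, map_mul, hqa, one_mul]
  obtain ⟨s, hs⟩ := unit_mod4 h4 y hy
  rcases hs with hs | hs
  · intro 𝓡 h y' hi
    have i1 := (b (-1) isUnit_one.neg ⟨-1, by ring⟩).trans h hi
    have := Fix.unit (y := -y) (A := A) (b (-y) hy.neg ⟨-1 - s, by rw [hs]; ring⟩) (-1) h (z := y')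
      (by simpa using i1)
    simpa using this
  · exact b y hy ⟨s, hs⟩

theorem exists_unit_sub {q : ℕ} (hq : Odd q) (y : ZMod q) : ∃ u : ZMod q, IsUnit u ∧ IsUnit (y - u) := by
  have hq0 : q ≠ 0 := by rintro rfl; simp at hq
  have : NeZero q := ⟨hq0⟩
  set Y := y.val with hY
  have hy : ((Y : ℕ) : ZMod q) = y := ZMod.natCast_zmod_val y
  set g := ∏ p ∈ q.primeFactors.filter (fun p => ¬ p ∣ Y), p with hg
  have hg1 : ∀ p, p.Prime → p ∣ q → p ∣ Y → ¬ p ∣ g := by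
    intro p hp hpq hpY hpg
    obtain ⟨r, hr, hpr⟩ := (Prime.dvd_finsetProd_iff hp.prime _).mp hpg
    rw [Finset.mem_filter] at hr
    have hrp := Nat.prime_of_mem_primeFactors hr.1
    have := (Nat.prime_dvd_prime_iff_eq hp hrp).mp hpr
    exact hr.2 (this ▸ hpY)
  have hg2 : ∀ p, p.Prime → p ∣ q → ¬ p ∣ Y → p ∣ g := by
    intro p hp hpq hpY
    exact Finset.dvd_prod_of_mem _ (Finset.mem_filter.mpr ⟨Nat.mem_primeFactors.mpr ⟨hp, hpq, hq0⟩, hpY⟩)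
  have c1 : Nat.Coprime (2 * Y + g) q := by
    apply Nat.coprime_of_dvd
    intro p hp h1 h2
    by_cases hpY : p ∣ Y
    · exact hg1 p hp h2 hpY ((Nat.dvd_add_right (hpY.mul_left 2)).mp h1)
    · have := (Nat.dvd_add_left (hg2 p hp h2 hpY)).mp h1
      rcases (Nat.Prime.dvd_mul hp).mp this with h | h
      · have : p = 2 := (Nat.prime_dvd_prime_iff_eq hp Nat.prime_two).mp h
        subst this
        exact (Nat.not_even_iff_odd.mpr hq) (even_iff_two_dvd.mpr h2)
      · exact hpY h
  have c2 : Nat.Coprime (Y + g) q := by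
    apply Nat.coprime_of_dvd
    intro p hp h1 h2
    by_cases hpY : p ∣ Y
    · exact hg1 p hp h2 hpY ((Nat.dvd_add_right hpY).mp h1)
    · exact hpY ((Nat.dvd_add_left (hg2 p hp h2 hpY)).mp h1)
  refine ⟨((2 * Y + g : ℕ) : ZMod q), (ZMod.isUnit_iff_coprime _ _).mpr c1, ?_⟩
  have e : y - ((2 * Y + g : ℕ) : ZMod q) = -((Y + g : ℕ) : ZMod q) := by
    push_cast; rw [hy]; ring
  rw [e]
  exact ((ZMod.isUnit_iff_coprime _ _).mpr c2).neg

theorem step4a (hN : NormA A) {k q : ℕ} (hn : n = 2 ^ k * q) (hq : Odd q) (h : Good A 𝓡)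
    {y y' : ZMod n} (hi : ind 𝓡 (1, y) (1, y')) {u a : (ZMod n)ˣ} (ha : a ∈ A)
    (hau : y' - u = a * (y - u)) (hyu : IsUnit (red q ⟨2 ^ k, by rw [hn, mul_comm]⟩ (y - (u : ZMod n)))) :
    red q ⟨2 ^ k, by rw [hn, mul_comm]⟩ (a : ZMod n) = 1 := by
  have hqn : q ∣ n := ⟨2 ^ k, by rw [hn, mul_comm]⟩
  have hp : ∀ p (hp : p.Prime) (hpq : p ∣ q), red p (hpq.trans hqn) y' = red p (hpq.trans hqn) y := by
    intro p hp hpq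
    have : Fact p.Prime := ⟨hp⟩
    obtain ⟨b, hb, hby⟩ := h.ind_right hi
    by_cases h0 : red p (hpq.trans hqn) y = 0
    · rw [hby, map_mul, h0, mul_zero]
    · obtain ⟨v, hv⟩ := ZMod.unitsMap_surjective (hpq.trans hqn) (Units.mk0 _ h0)
      have hv' : red p (hpq.trans hqn) (v : ZMod n) = red p (hpq.trans hqn) y := congrArg Units.val hv
      obtain ⟨c, hc, hcy⟩ := (step3 hN hn hq v.isUnit).diff h hi
      have := congrArg (red p (hpq.trans hqn)) hcy
      rw [map_sub, map_mul, map_sub, hv'] at this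
      linear_combination this
  apply rad_lemma hN hn hq ha
  intro p hpp hpq
  have e := congrArg (red p (hpq.trans hqn)) hau
  rw [map_sub, map_mul, hp p hpp hpq, ← map_sub] at e
  have hu : IsUnit (red p (hpq.trans hqn) (y - u)) := by
    have := hyu.map (ZMod.castHom hpq (ZMod p))
    have e2 : ZMod.castHom hpq (ZMod p) (red q hqn (y - u)) = red p (hpq.trans hqn) (y - u) := by
      rw [← RingHom.comp_apply]
      congr 1
      exact Subsingleton.elim _ _
    rwa [e2] at this
  apply hu.mul_right_cancel
  rw [one_mul]; exact e.symm

theorem step4 (hN : NormA A) {k q : ℕ} (hn : n = 2 ^ k * q) (hq : Odd q) (y : ZMod n) : Fix A y := by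
  have hco : Nat.Coprime (2 ^ k) q := (Nat.Coprime.pow_left k (Nat.coprime_two_left.mpr hq))
  have hqn : q ∣ n := ⟨2 ^ k, by rw [hn, mul_comm]⟩
  have unit := fun u : (ZMod n)ˣ => step3 hN hn hq u.isUnit
  have a : ∀ 𝓡, Good A 𝓡 → ∀ y y', ind 𝓡 (1, y) (1, y') → red q hqn y' = red q hqn y := by
    intro 𝓡 h y y' hi
    obtain ⟨v, hv1, hv2⟩ := exists_unit_sub hq (red q hqn y)
    obtain ⟨u, hu⟩ := ZMod.unitsMap_surjective hqn hv1.unit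
    have hu' : red q hqn (u : ZMod n) = v := congrArg Units.val hu
    obtain ⟨c, hc, hcy⟩ := (unit u).diff h hi
    have := step4a hN hn hq h hi hc hcy (by rw [map_sub, hu']; exact hv2)
    have e := congrArg (red q hqn) hcy
    rw [map_sub, map_mul, this, map_sub] at e
    linear_combination e
  -- transport via something fixed with the same 2-part
  have tr : ∀ 𝓡, Good A 𝓡 → ∀ y y' w, ind 𝓡 (1, y) (1, y') → Fix A w →
      red (2 ^ k) ⟨q, hn⟩ w = red (2 ^ k) ⟨q, hn⟩ y → y' = y := by
    intro 𝓡 h y y' w hi hw hwy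
    obtain ⟨c, hc, hcy⟩ := hw.diff h hi
    apply crt_inj hn hco
    · have := congrArg (red (2 ^ k) ⟨q, hn⟩) hcy
      rw [map_sub, map_mul, map_sub, hwy] at this
      linear_combination this
    · exact a 𝓡 h y y' hi
  have oddcase : ∀ y : ZMod n, IsUnit (red (2 ^ k) ⟨q, hn⟩ y) → Fix A y := by
    intro y hy 𝓡 h y' hi
    obtain ⟨u, hu1, hu2⟩ := crt_surj hn hco (red (2 ^ k) ⟨q, hn⟩ y) 1
    have hu : IsUnit u := isUnit_crt hn hco (by rw [hu1]; exact hy) (by rw [hu2]; exact isUnit_one)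
    exact tr 𝓡 h y y' u hi (step3 hN hn hq hu) hu1
  by_cases hk : 2 ≤ k
  swap
  · have : k = 0 ∨ k = 1 := by omega
    rcases this with rfl | rfl
    · apply oddcase
      generalize red (2 ^ 0) ⟨q, hn⟩ y = s
      revert s; decide
    · by_cases hy : red (2 ^ 1) ⟨q, hn⟩ y = 0
      · intro 𝓡 h y' hi
        apply crt_inj hn hco
        · obtain ⟨b, hb, hby⟩ := h.ind_right hi
          rw [hby, map_mul, hy, mul_zero]
        · exact a 𝓡 h y y' hi
      · apply oddcase
        revert hy
        generalize red (2 ^ 1) ⟨q, hn⟩ y = s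
        revert s; decide
  obtain ⟨m, hm⟩ := exists_m4 hk hn
  have h4 : 4 ∣ n := ⟨m, by rw [hm]; ring⟩
  have r4 : red 4 h4 (4 : ZMod n) = 0 := by rw [map_ofNat]; decide
  -- even case
  have evencase : ∀ 𝓡, Good A 𝓡 → ∀ y y', ind 𝓡 (1, y) (1, y') → (∃ t, y = 2 * t) →
      y' = y ∨ (y' = y + ((2 * m : ℕ) : ZMod n) ∧
        ∃ b ∈ A, (b : ZMod n) = 1 + ((2 * m : ℕ) : ZMod n)) := by
    rintro 𝓡 h y y' hi ⟨t, ht⟩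
    obtain ⟨v, hv1, hv2⟩ := exists_unit_sub hq (red q hqn y)
    obtain ⟨u, hu1, hu2⟩ := crt_surj hn hco 1 v
    have hu : IsUnit u := isUnit_crt hn hco (by rw [hu1]; exact isUnit_one) (by rw [hu2]; exact hv1)
    have hyu : IsUnit (y - u) := by
      apply isUnit_crt hn hco
      · rw [map_sub, hu1, ht, map_mul]
        have := (odd_isUnit_two (k := k) (- red (2 ^ k) ⟨q, hn⟩ t)).neg
        convert this using 1
        rw [map_ofNat]; ring
      · rw [map_sub, hu2]; exact hv2
    obtain ⟨u, rfl⟩ := hu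
    obtain ⟨c, hc, hcy⟩ := (unit u).diff h hi
    have hqc := step4a hN hn hq h hi hc hcy (hyu.map _)
    obtain ⟨b, hb, hby⟩ := h.ind_right hi
    have hc4 : ∃ s, (c : ZMod n) = 1 + 4 * s := by
      have e1 : red 4 h4 y' = red 4 h4 y := by
        rw [hby, ht]
        simp only [map_mul, map_ofNat]
        have := b.isUnit.map (red 4 h4)
        revert this
        generalize red 4 h4 (b : ZMod n) = b'
        generalize red 4 h4 t = t'
        revert b' t'; decide
      have e2 := congrArg (red 4 h4) hcy
      rw [map_sub, e1, ← map_sub, map_mul] at e2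
      have e3 : red 4 h4 ((c : ZMod n) - 1) = 0 := by
        rw [map_sub, map_one, sub_eq_zero]
        apply (hyu.map (red 4 h4)).mul_right_cancel
        rw [one_mul]; exact e2.symm
      obtain ⟨s, hs⟩ := (red_eq_zero_iff h4 _).mp e3
      push_cast at hs
      exact ⟨s, by linear_combination hs⟩
    rcases two_lemma hN hn hq hm hc hqc hc4 with h1 | h1
    · left; rw [h1] at hcy; linear_combination hcy
    · right
      refine ⟨?_, c, hc, h1⟩
      rw [h1] at hcy; linear_combination hcy + hh_unit hm hyu
  have half : ∀ y : ZMod n, (∃ s, y = 2 + 4 * s) → IsUnit (red q hqn y) → ∃ w, y = 2 * w ∧ IsUnit w := by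
    rintro y ⟨s, hs⟩ hy
    refine ⟨1 + 2 * s, by rw [hs]; ring, isUnit_crt hn hco ?_ ?_⟩
    · have := odd_isUnit_two (k := k) (red (2 ^ k) ⟨q, hn⟩ s)
      simpa only [map_add, map_mul, map_one, map_ofNat] using this
    · have e : red q hqn y = 2 * red q hqn (1 + 2 * s) := by
        rw [hs]; simp only [map_add, map_mul, map_one, map_ofNat]; ring
      rw [e] at hy
      exact isUnit_of_mul_isUnit_right hy
  have d : ∀ y : ZMod n, (∃ s, y = 2 + 4 * s) → IsUnit (red q hqn y) → Fix A y := by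
    rintro y hs hy 𝓡 h y' hi
    obtain ⟨w, hw, hwu⟩ := half y hs hy
    rcases evencase 𝓡 h y y' hi ⟨w, hw⟩ with h1 | ⟨h1, b, hb, hb1⟩
    · exact h1
    · exfalso
      obtain ⟨c, hc, hcy⟩ := h.ind_right hi
      refine N3' hN hm b hb hb1 c hc w hwu ?_
      rw [← hw]
      linear_combination h1 - hcy
  obtain ⟨s, hs⟩ := mod4 h4 y
  have odd1 : ∀ t, y = 1 + 2 * t → Fix A y := by
    intro t ht
    apply oddcase
    rw [ht]
    have := odd_isUnit_two (k := k) (red (2 ^ k) ⟨q, hn⟩ t)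
    simpa only [map_add, map_mul, map_one, map_ofNat] using this
  rcases hs with hs | hs | hs | hs
  · intro 𝓡 h y' hi
    obtain ⟨v, hv1, hv2⟩ := exists_unit_sub hq (red q hqn y)
    obtain ⟨w, hw1, hw2⟩ := crt_surj hn hco (red (2 ^ k) ⟨q, hn⟩ 2) v
    have hw4 : ∃ s, w = 2 + 4 * s := red2_eq hn hk hw1 ⟨0, by ring⟩
    have hwf : Fix A w := d w hw4 (by rw [hw2]; exact hv1)
    rcases evencase 𝓡 h y y' hi ⟨2 * s, by rw [hs]; ring⟩ with h1 | ⟨h1, b, hb, hb1⟩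
    · exact h1
    · exfalso
      obtain ⟨c, hc, hcy⟩ := hwf.diff h hi
      obtain ⟨r, hr⟩ := hw4
      obtain ⟨x, hx, hxu⟩ := half (y - w) ⟨s - r - 1, by rw [hs, hr]; ring⟩ (by rw [map_sub, hw2]; exact hv2)
      refine N3' hN hm b hb hb1 c hc x hxu ?_
      rw [← hx]
      linear_combination h1 - hcy
  · exact odd1 (2 * s) (by rw [hs]; ring)
  · intro 𝓡 h y' hi
    obtain ⟨w, hw1, hw2⟩ := crt_surj hn hco (red (2 ^ k) ⟨q, hn⟩ y) 1
    exact tr 𝓡 h y y' w hi (d w (red2_eq hn hk hw1 ⟨s, hs⟩) (by rw [hw2]; exact isUnit_one)) hw1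
  · exact odd1 (1 + 2 * s) (by rw [hs]; ring)

theorem fix_all (hN : NormA A) (y : ZMod n) : Fix A y := by
  obtain ⟨k, q, hq, hn⟩ := Nat.exists_eq_two_pow_mul_odd (NeZero.ne n)
  exact step4 hN hn hq y

theorem orb_inv (u : (ZMod n)ˣ) (R S : Set (ZMod n × ZMod n))
    (hR : ∀ x y, ((u : ZMod n) * x, (u : ZMod n) * y) ∈ R ↔ (x, y) ∈ R)
    (hS : ∀ x y, ((u : ZMod n) * x, (u : ZMod n) * y) ∈ S ↔ (x, y) ∈ S) (x y : ZMod n) :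
    cnum R S ((u : ZMod n) * x, (u : ZMod n) * y) = cnum R S (x, y) := by
  unfold cnum
  symm
  apply Set.ncard_congr (fun z _ => (u : ZMod n) * z)
  · intro z hz; exact ⟨(hR _ _).mpr hz.1, (hS _ _).mpr hz.2⟩
  · intro z w _ _ hzw; exact (Units.mul_right_inj _).mp hzw
  · intro w hw
    refine ⟨((u⁻¹ : (ZMod n)ˣ) : ZMod n) * w, ?_, by simp⟩
    have e : w = (u : ZMod n) * (((u⁻¹ : (ZMod n)ˣ) : ZMod n) * w) := by simp
    rw [e] at hw
    exact ⟨(hR _ _).mp hw.1, (hS _ _).mp hw.2⟩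

/-- Lemma N: the point extension of a normal circulant configuration
contains the multiplication relations. -/
theorem lemmaN (hN : NormA A) (hcl : Closed 𝓡) (horb : ∀ d, orb A d ∈ 𝓡)
    (hz : {((0 : ZMod n), (0 : ZMod n))} ∈ 𝓡) (k : ZMod n) :
    {p : ZMod n × ZMod n | ∃ a ∈ A, p.1 = (a : ZMod n) ∧ p.2 = (a : ZMod n) * k} ∈ 𝓡 := by
  let 𝓠 : Set (Set (ZMod n × ZMod n)) := {R | R ∈ 𝓡 ∧ ∀ a ∈ A, ∀ x y : ZMod n,
    ((a : ZMod n) * x, (a : ZMod n) * y) ∈ R ↔ (x, y) ∈ R}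
  have hG : Good A 𝓠 := by
    refine ⟨⟨?_, ?_, ?_, ?_, ?_⟩, ?_, ?_, ?_⟩
    · exact ⟨hcl.diag, fun a _ x y => by
        change (a : ZMod n) * x = (a : ZMod n) * y ↔ x = y
        exact Units.mul_right_inj _⟩
    · rintro R ⟨h1, h2⟩
      exact ⟨hcl.compl _ h1, fun a ha x y => not_congr (h2 a ha x y)⟩
    · rintro R ⟨h1, h2⟩ S ⟨h3, h4⟩
      exact ⟨hcl.inter _ h1 _ h3, fun a ha x y => and_congr (h2 a ha x y) (h4 a ha x y)⟩
    · rintro R ⟨h1, h2⟩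
      exact ⟨hcl.conv _ h1, fun a ha x y => h2 a ha y x⟩
    · rintro R ⟨h1, h2⟩ S ⟨h3, h4⟩ j
      refine ⟨hcl.count _ h1 _ h3 j, fun a ha x y => ?_⟩
      simp only [Set.mem_ofPred_eq]
      rw [orb_inv a R S (h2 a ha) (h4 a ha)]
    · intro d
      refine ⟨horb d, fun a ha x y => ?_⟩
      constructor
      · rintro ⟨b, hb, hbd⟩
        refine ⟨a⁻¹ * b, A.mul_mem (A.inv_mem ha) hb, ?_⟩
        simp only at hbd ⊢
        rw [Units.val_mul, mul_assoc, ← hbd, ← mul_sub, Units.inv_mul_cancel_left]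
      · rintro ⟨b, hb, hbd⟩
        refine ⟨a * b, A.mul_mem ha hb, ?_⟩
        simp only at hbd ⊢
        rw [Units.val_mul, mul_assoc, ← hbd, ← mul_sub]
    · refine ⟨hz, fun a ha x y => by simp⟩
    · rintro R ⟨h1, h2⟩ a ha x y hxy
      exact (h2 a ha x y).mpr hxy
  have : {p : ZMod n × ZMod n | ∃ a ∈ A, p.1 = (a : ZMod n) ∧ p.2 = (a : ZMod n) * k} ∈ 𝓠 := by
    apply hG.closed.mem_of_sat
    rintro ⟨x, y⟩ ⟨x', y'⟩ hi ⟨a, ha, h1, h2⟩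
    simp only at h1 h2
    subst h1 h2
    obtain ⟨b, hb, hbx⟩ := hG.ind_left hi
    refine ⟨b * a, A.mul_mem hb ha, by simpa using hbx, ?_⟩
    have i1 := hG.ind_mul (A.inv_mem ha) (a : ZMod n) ((a : ZMod n) * k)
    rw [Units.inv_mul, Units.inv_mul_cancel_left] at i1
    have i2 := hG.ind_mul (A.inv_mem (A.mul_mem hb ha)) x' y'
    have e : (((b * a)⁻¹ : (ZMod n)ˣ) : ZMod n) * x' = 1 := by
      rw [hbx, ← Units.val_mul, ← Units.val_mul, inv_mul_cancel]; rfl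
    rw [e] at i2
    have := fix_all hN k 𝓠 hG _ (ind_trans (hG.closed.ind_symm i1) (ind_trans hi i2))
    rw [Units.inv_mul_eq_iff_eq_mul] at this
    exact this
  exact this.1

end steps
end Circ

set_option linter.unusedSectionVars false
namespace Circ
open CohCfg

universe v w

/-- families of pairs of relations closed under the coherent operations -/
structure Bi {Ω : Type u} {Ω' : Type v} (P : Set (Ω × Ω) → Set (Ω' × Ω') → Prop) : Prop where
  diag : P {p | p.1 = p.2} {p | p.1 = p.2}
  compl : ∀ R R', P R R' → P Rᶜ R'ᶜ
  inter : ∀ R R' S S', P R R' → P S S' → P (R ∩ S) (R' ∩ S')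
  conv : ∀ R R', P R R' → P {p | (p.2, p.1) ∈ R} {p | (p.2, p.1) ∈ R'}
  count : ∀ R R' S S', P R R' → P S S' → ∀ k, P {p | cnum R S p = k} {p | cnum R' S' p = k}

def Faithful {Ω : Type u} {Ω' : Type v} (P : Set (Ω × Ω) → Set (Ω' × Ω') → Prop) : Prop :=
  ∀ R R', P R R' → (R = ∅ ↔ R' = ∅)

section bi
variable {Ω : Type u} {Ω' : Type v} {P : Set (Ω × Ω) → Set (Ω' × Ω') → Prop}

theorem Bi.univ (h : Bi P) : P Set.univ Set.univ := by
  have h2 := h.compl _ _ (h.inter _ _ _ _ h.diag (h.compl _ _ h.diag))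
  simpa using h2

theorem Bi.empty (h : Bi P) : P ∅ ∅ := by
  simpa using h.compl _ _ h.univ

theorem Bi.union (h : Bi P) {R R' S S'} (hR : P R R') (hS : P S S') : P (R ∪ S) (R' ∪ S') := by
  have := h.compl _ _ (h.inter _ _ _ _ (h.compl _ _ hR) (h.compl _ _ hS))
  simpa [Set.compl_inter] using this

theorem Bi.comp [Finite Ω] [Finite Ω'] (h : Bi P) {R R' S S'} (hR : P R R') (hS : P S S') :
    P {p | ∃ z, (p.1, z) ∈ R ∧ (z, p.2) ∈ S} {p | ∃ z, (p.1, z) ∈ R' ∧ (z, p.2) ∈ S'} := by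
  have := h.compl _ _ (h.count _ _ _ _ hR hS 0)
  convert this using 1
  · ext p
    simp only [Set.mem_ofPred_eq, Set.mem_compl_iff]
    exact cnum_pos.symm
  · ext p
    simp only [Set.mem_ofPred_eq, Set.mem_compl_iff]
    exact cnum_pos.symm

theorem Bi.iUnion (h : Bi P) {ι : Type w} [Finite ι] {f : ι → Set (Ω × Ω)} {g : ι → Set (Ω' × Ω')}
    (hfg : ∀ i, P (f i) (g i)) : P (⋃ i, f i) (⋃ i, g i) := by
  classical
  have : Fintype ι := Fintype.ofFinite ι
  have key : ∀ s : Finset ι, P (⋃ i ∈ s, f i) (⋃ i ∈ s, g i) := by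
    intro s
    induction s using Finset.induction_on with
    | empty => simpa using h.empty
    | insert a s _ ih =>
      rw [Finset.set_biUnion_insert, Finset.set_biUnion_insert]
      exact h.union (hfg a) ih
  simpa using key Finset.univ

theorem Bi.left (h : Bi P) : Closed {R | ∃ R', P R R'} := by
  refine ⟨⟨_, h.diag⟩, ?_, ?_, ?_, ?_⟩
  · rintro R ⟨R', hR⟩; exact ⟨_, h.compl _ _ hR⟩
  · rintro R ⟨R', hR⟩ S ⟨S', hS⟩; exact ⟨_, h.inter _ _ _ _ hR hS⟩
  · rintro R ⟨R', hR⟩; exact ⟨_, h.conv _ _ hR⟩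
  · rintro R ⟨R', hR⟩ S ⟨S', hS⟩ k; exact ⟨_, h.count _ _ _ _ hR hS k⟩

theorem Bi.right (h : Bi P) : Closed {R' | ∃ R, P R R'} := by
  refine ⟨⟨_, h.diag⟩, ?_, ?_, ?_, ?_⟩
  · rintro R ⟨R', hR⟩; exact ⟨_, h.compl _ _ hR⟩
  · rintro R ⟨R', hR⟩ S ⟨S', hS⟩; exact ⟨_, h.inter _ _ _ _ hR hS⟩
  · rintro R ⟨R', hR⟩; exact ⟨_, h.conv _ _ hR⟩
  · rintro R ⟨R', hR⟩ S ⟨S', hS⟩ k; exact ⟨_, h.count _ _ _ _ hR hS k⟩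

theorem Bi.same {P : Set (Ω × Ω) → Set (Ω × Ω) → Prop} (h : Bi P) : Closed {R | P R R} :=
  ⟨h.diag, fun R hR => h.compl _ _ hR, fun R hR S hS => h.inter _ _ _ _ hR hS,
    fun R hR => h.conv _ _ hR, fun R hR S hS k => h.count _ _ _ _ hR hS k⟩

theorem Bi.subset_iff (h : Bi P) (hf : Faithful P) {R R' S S'} (hR : P R R') (hS : P S S') :
    R ⊆ S ↔ R' ⊆ S' := by
  have := hf _ _ (h.inter _ _ _ _ hR (h.compl _ _ hS))
  rw [← Set.sdiff_eq, ← Set.sdiff_eq, Set.sdiff_eq_empty, Set.sdiff_eq_empty] at this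
  exact this

theorem Bi.unique (h : Bi P) (hf : Faithful P) {R R' S'} (hR : P R R') (hS : P R S') : R' = S' :=
  Set.Subset.antisymm ((h.subset_iff hf hR hS).mp subset_rfl) ((h.subset_iff hf hS hR).mp subset_rfl)

theorem Bi.unique' (h : Bi P) (hf : Faithful P) {R S R'} (hR : P R R') (hS : P S R') : R = S :=
  Set.Subset.antisymm ((h.subset_iff hf hR hS).mpr subset_rfl) ((h.subset_iff hf hS hR).mpr subset_rfl)

end bi

section alg
variable {Ω : Type u} {Ω' : Type v}

theorem cls_unique (X : CohCfg Ω) {s t : Set (Ω × Ω)} (hs : s ∈ X.S) (ht : t ∈ X.S) {p} (h1 : p ∈ s)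
    (h2 : p ∈ t) : s = t := by
  by_contra h
  have := X.disj s hs t ht h
  exact absurd (this ▸ (⟨h1, h2⟩ : p ∈ s ∩ t)) (Set.notMem_empty p)

end alg

section alg
variable {Ω : Type u} {Ω' : Type u}

/-- pairs matched by `φ` -/
def algM (X : CohCfg Ω) (φ : Set (Ω × Ω) → Set (Ω' × Ω')) (p : Ω × Ω) (q : Ω' × Ω') : Prop :=
  ∃ t ∈ X.S, p ∈ t ∧ q ∈ φ t

def algP (X : CohCfg Ω) (φ : Set (Ω × Ω) → Set (Ω' × Ω')) (R : Set (Ω × Ω)) (R' : Set (Ω' × Ω')) : Prop :=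
  ∀ p q, algM X φ p q → (p ∈ R ↔ q ∈ R')

variable {X : CohCfg Ω} {X' : CohCfg Ω'} {φ : Set (Ω × Ω) → Set (Ω' × Ω')}

theorem _root_.CohCfg.IsAlgIso.right (h : IsAlgIso X X' φ) (q : Ω' × Ω') : ∃ t ∈ X.S, q ∈ φ t := by
  obtain ⟨s, hs, hq⟩ := X'.cover q
  obtain ⟨t, ht, rfl⟩ := h.bijOn.surjOn hs
  exact ⟨t, ht, hq⟩

theorem _root_.CohCfg.IsAlgIso.uniq (h : IsAlgIso X X' φ) {s t} (hs : s ∈ X.S) (ht : t ∈ X.S) {q} (h1 : q ∈ φ s)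
    (h2 : q ∈ φ t) : s = t :=
  h.bijOn.injOn hs ht (cls_unique X' (h.bijOn.mapsTo hs) (h.bijOn.mapsTo ht) h1 h2)

theorem _root_.CohCfg.IsAlgIso.exr (h : IsAlgIso X X' φ) (p : Ω × Ω) : ∃ q, algM X φ p q := by
  obtain ⟨t, ht, hp⟩ := X.cover p
  obtain ⟨q, hq⟩ := X'.nonemp _ (h.bijOn.mapsTo ht)
  exact ⟨q, t, ht, hp, hq⟩

theorem _root_.CohCfg.IsAlgIso.exl (h : IsAlgIso X X' φ) (q : Ω' × Ω') : ∃ p, algM X φ p q := by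
  obtain ⟨t, ht, hq⟩ := h.right q
  obtain ⟨p, hp⟩ := X.nonemp _ ht
  exact ⟨p, t, ht, hp, hq⟩

theorem _root_.CohCfg.IsAlgIso.exists_mid (h : IsAlgIso X X' φ) {p q} (hm : algM X φ p q) {r s} (hr : r ∈ X.S)
    (hs : s ∈ X.S) : (∃ z, (p.1, z) ∈ r ∧ (z, p.2) ∈ s) ↔ ∃ z, (q.1, z) ∈ φ r ∧ (z, q.2) ∈ φ s := by
  have := X.finite
  have := X'.finite
  obtain ⟨t, ht, hp, hq⟩ := hm
  rw [← cnum_pos, ← cnum_pos, h.cnum_eq r hr s hs t ht p hp q hq]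

theorem _root_.CohCfg.IsAlgIso.diag1 (h : IsAlgIso X X' φ) {x : Ω} {q : Ω' × Ω'} (hm : algM X φ (x, x) q) : q.1 = q.2 := by
  obtain ⟨t, ht, hp, hq⟩ := hm
  obtain ⟨r, hr, hr'⟩ := h.right (q.1, q.1)
  obtain ⟨z, hz1, hz2⟩ := (h.exists_mid ⟨t, ht, hp, hq⟩ hr ht).mpr ⟨q.1, hr', hq⟩
  have hzx : z = x := X.diag t ht ⟨_, hp, rfl⟩ _ hz2
  subst hzx
  have := cls_unique X hr ht hz1 hp
  subst this
  exact X'.diag _ (h.bijOn.mapsTo ht) ⟨_, hr', rfl⟩ _ hq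

theorem _root_.CohCfg.IsAlgIso.diag2 (h : IsAlgIso X X' φ) {p : Ω × Ω} {x : Ω'} (hm : algM X φ p (x, x)) : p.1 = p.2 := by
  obtain ⟨t, ht, hp, hq⟩ := hm
  obtain ⟨r, hr, hr'⟩ := X.cover (p.1, p.1)
  obtain ⟨z, hz1, hz2⟩ := (h.exists_mid ⟨t, ht, hp, hq⟩ hr ht).mp ⟨p.1, hr', hp⟩
  have hzx : z = x := X'.diag _ (h.bijOn.mapsTo ht) ⟨_, hq, rfl⟩ _ hz2
  subst hzx
  have := h.uniq hr ht hz1 hq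
  subst this
  exact X.diag _ ht ⟨_, hr', rfl⟩ _ hp

theorem _root_.CohCfg.IsAlgIso.conv (h : IsAlgIso X X' φ) {x y : Ω} {x' y' : Ω'} (hm : algM X φ (x, y) (x', y')) :
    algM X φ (y, x) (y', x') := by
  obtain ⟨t, ht, hp, hq⟩ := hm
  obtain ⟨r, hr, hr'⟩ := h.right (y', x')
  obtain ⟨⟨w, w'⟩, hw⟩ := h.exl (x', x')
  have e := h.diag2 hw
  simp only at e
  subst e
  obtain ⟨z, hz1, hz2⟩ := (h.exists_mid hw ht hr).mpr ⟨y', hq, hr'⟩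
  have := cls_unique X hr (X.conv t ht) hz2 hz1
  subst this
  exact ⟨_, hr, hp, hr'⟩

theorem _root_.CohCfg.IsAlgIso.equiv (h : IsAlgIso X X' φ) {x y : Ω} {x' y' : Ω'} (hm : algM X φ (x, y) (x', y')) :
    ∃ e : Ω ≃ Ω', ∀ z, algM X φ (x, z) (x', e z) ∧ algM X φ (z, y) (e z, y') := by
  have := X.finite
  have := X'.finite
  choose c hc1 hc2 using X.cover
  choose c' hc1' hc2' using h.right
  let f : Ω → Set (Ω × Ω) × Set (Ω × Ω) := fun z => (c (x, z), c (z, y))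
  let g : Ω' → Set (Ω × Ω) × Set (Ω × Ω) := fun z => (c' (x', z), c' (z, y'))
  have card : ∀ a, Nonempty ({z // f z = a} ≃ {z // g z = a}) := by
    rintro ⟨r, s⟩
    by_cases hrs : r ∈ X.S ∧ s ∈ X.S
    · obtain ⟨hr, hs⟩ := hrs
      obtain ⟨t, ht, hp, hq⟩ := hm
      have e := h.cnum_eq r hr s hs t ht _ hp _ hq
      unfold cnum at e
      apply Finite.card_eq.mp
      have e1 : {z | (x, z) ∈ r ∧ (z, y) ∈ s} = {z | f z = (r, s)} := by
        ext z
        simp only [Set.mem_ofPred_eq, f, Prod.mk.injEq]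
        constructor
        · rintro ⟨h1, h2⟩
          exact ⟨cls_unique X (hc1 _) hr (hc2 _) h1, cls_unique X (hc1 _) hs (hc2 _) h2⟩
        · rintro ⟨h1, h2⟩
          exact ⟨h1 ▸ hc2 _, h2 ▸ hc2 _⟩
      have e2 : {z | (x', z) ∈ φ r ∧ (z, y') ∈ φ s} = {z | g z = (r, s)} := by
        ext z
        simp only [Set.mem_ofPred_eq, g, Prod.mk.injEq]
        constructor
        · rintro ⟨h1, h2⟩
          exact ⟨h.uniq (hc1' _) hr (hc2' _) h1, h.uniq (hc1' _) hs (hc2' _) h2⟩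
        · rintro ⟨h1, h2⟩
          exact ⟨h1 ▸ hc2' _, h2 ▸ hc2' _⟩
      simp only [e1, e2] at e
      exact e
    · have : IsEmpty {z // f z = (r, s)} := ⟨fun ⟨z, hz⟩ => hrs (by
        simp only [f, Prod.mk.injEq] at hz
        exact ⟨hz.1 ▸ hc1 _, hz.2 ▸ hc1 _⟩)⟩
      have : IsEmpty {z // g z = (r, s)} := ⟨fun ⟨z, hz⟩ => hrs (by
        simp only [g, Prod.mk.injEq] at hz
        exact ⟨hz.1 ▸ hc1' _, hz.2 ▸ hc1' _⟩)⟩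
      exact ⟨Equiv.equivOfIsEmpty _ _⟩
  refine ⟨Equiv.ofFiberEquiv (f := f) (g := g) fun a => (card a).some, fun z => ?_⟩
  have hz := Equiv.ofFiberEquiv_map (f := f) (g := g) (fun a => (card a).some) z
  generalize Equiv.ofFiberEquiv (f := f) (g := g) (fun a => (card a).some) = e at hz
  simp only [f, g, Prod.mk.injEq] at hz
  refine ⟨⟨c (x, z), hc1 _, hc2 _, ?_⟩, ⟨c (z, y), hc1 _, hc2 _, ?_⟩⟩
  · rw [← hz.1]; exact hc2' _
  · rw [← hz.2]; exact hc2' _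

theorem _root_.CohCfg.IsAlgIso.bi (h : IsAlgIso X X' φ) : Bi (algP X φ) := by
  refine ⟨?_, ?_, ?_, ?_, ?_⟩
  · rintro ⟨x, y⟩ ⟨x', y'⟩ hm
    constructor
    · intro (e : x = y); subst e; exact h.diag1 hm
    · intro (e : x' = y'); subst e; exact h.diag2 hm
  · intro R R' hR p q hm
    exact not_congr (hR p q hm)
  · intro R R' S S' hR hS p q hm
    exact and_congr (hR p q hm) (hS p q hm)
  · rintro R R' hR ⟨x, y⟩ ⟨x', y'⟩ hm
    exact hR _ _ (h.conv hm)
  · rintro R R' S S' hR hS k ⟨x, y⟩ ⟨x', y'⟩ hm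
    obtain ⟨e, he⟩ := h.equiv hm
    have : cnum R S (x, y) = cnum R' S' (x', y') := by
      unfold cnum
      apply Set.ncard_congr (fun z _ => e z)
      · intro z hz
        exact ⟨(hR _ _ (he z).1).mp hz.1, (hS _ _ (he z).2).mp hz.2⟩
      · intro z w _ _ hzw; exact e.injective hzw
      · intro w hw
        refine ⟨e.symm w, ⟨(hR _ _ (he _).1).mpr ?_, (hS _ _ (he _).2).mpr ?_⟩, by simp⟩
        · simpa using hw.1
        · simpa using hw.2
    simp only [Set.mem_ofPred_eq, this]

theorem _root_.CohCfg.IsAlgIso.faithful (h : IsAlgIso X X' φ) : Faithful (algP X φ) := by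
  intro R R' hR
  simp only [Set.eq_empty_iff_forall_notMem]
  constructor
  · intro h1 q hq
    obtain ⟨p, hp⟩ := h.exl q
    exact h1 p ((hR p q hp).mpr hq)
  · intro h1 p hp
    obtain ⟨q, hq⟩ := h.exr p
    exact h1 q ((hR p q hq).mp hp)

theorem _root_.CohCfg.IsAlgIso.algP_algImage (h : IsAlgIso X X' φ) {R} (hR : IsRelationOf X R) :
    algP X φ R (algImage X φ R) := by
  rintro p q ⟨t, ht, hp, hq⟩
  constructor
  · intro hpR
    exact ⟨φ t, ⟨t, ⟨ht, hR t ht ⟨p, hp, hpR⟩⟩, rfl⟩, hq⟩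
  · rintro ⟨_, ⟨t', ⟨ht', hs⟩, rfl⟩, hq'⟩
    have := h.uniq ht ht' hq hq'
    subst this
    exact hs hp

theorem isRel_basic (X : CohCfg Ω) {s} (hs : s ∈ X.S) : IsRelationOf X s := by
  rintro t ht ⟨p, hp, hp'⟩
  rw [cls_unique X ht hs hp hp']

theorem _root_.CohCfg.IsAlgIso.algP_basic (h : IsAlgIso X X' φ) {s} (hs : s ∈ X.S) : algP X φ s (φ s) := by
  rintro p q ⟨t, ht, hp, hq⟩
  constructor
  · intro hps
    rw [← cls_unique X ht hs hp hps]; exact hq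
  · intro hqs
    rw [← h.uniq ht hs hq hqs]; exact hp

/-- a relation transported by `φ` is a relation -/
theorem _root_.CohCfg.IsAlgIso.rel_of_algP (h : IsAlgIso X X' φ) {R R'} (hR : algP X φ R R') : IsRelationOf X R := by
  rintro t ht ⟨p, hp, hpR⟩ p' hp'
  obtain ⟨q, hq⟩ := X'.nonemp _ (h.bijOn.mapsTo ht)
  exact (hR _ _ ⟨t, ht, hp', hq⟩).mpr ((hR _ _ ⟨t, ht, hp, hq⟩).mp hpR)

theorem _root_.CohCfg.IsAlgIso.rel_of_algP' (h : IsAlgIso X X' φ) {R R'} (hR : algP X φ R R') : IsRelationOf X' R' := by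
  rintro t' ht' ⟨q, hq, hqR⟩ q' hq'
  obtain ⟨t, ht, rfl⟩ := h.bijOn.surjOn ht'
  obtain ⟨p, hp⟩ := X.nonemp _ ht
  exact (hR _ _ ⟨t, ht, hp, hq'⟩).mp ((hR _ _ ⟨t, ht, hp, hq⟩).mpr hqR)

theorem isAlgIso_id (X : CohCfg Ω) : IsAlgIso X X id :=
  ⟨Set.bijOn_id _, fun r hr s hs t ht p hp q hq => X.inum r hr s hs t ht p hp q hq⟩

theorem rel_closed (X : CohCfg Ω) : Closed {R | IsRelationOf X R} := by
  have h := (isAlgIso_id X).bi.same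
  have e : {R | IsRelationOf X R} = {R | algP X id R R} := by
    ext R
    constructor
    · intro hR
      rintro p q ⟨t, ht, hp, hq⟩
      exact ⟨fun h => hR t ht ⟨p, hp, h⟩ hq, fun h => hR t ht ⟨q, hq, h⟩ hp⟩
    · intro hR
      exact (isAlgIso_id X).rel_of_algP hR
  rw [e]; exact h

end alg
end Circ

namespace Circ
open CohCfg

universe v w

/-- atoms of a family of relations -/
def Atom {Ω : Type u} (𝓡 : Set (Set (Ω × Ω))) (T : Set (Ω × Ω)) : Prop :=
  T ∈ 𝓡 ∧ T.Nonempty ∧ ∀ R ∈ 𝓡, (T ∩ R).Nonempty → T ⊆ R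

section atoms
variable {Ω : Type u} {𝓡 : Set (Set (Ω × Ω))}

theorem Closed.atom_cover [Finite Ω] (h : Closed 𝓡) (p : Ω × Ω) : ∃ T, Atom 𝓡 T ∧ p ∈ T := by
  refine ⟨_, ⟨h.atom_mem p, ⟨p, ind_refl p⟩, ?_⟩, ind_refl p⟩
  rintro R hR ⟨q, hq, hqR⟩ q' hq'
  exact hq' R hR (h.ind_symm hq R hR hqR)

/-- the coherent configuration of atoms -/
def Closed.cfg [Finite Ω] (h : Closed 𝓡) : CohCfg Ω where
  S := {T | Atom 𝓡 T}
  finite := inferInstance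
  cover p := h.atom_cover p
  disj s hs t ht hst := by
    by_contra hne
    rw [← ne_eq, ← Set.nonempty_iff_ne_empty] at hne
    apply hst
    exact Set.Subset.antisymm (hs.2.2 t ht.1 hne) (ht.2.2 s hs.1 (by rwa [Set.inter_comm]))
  nonemp s hs := hs.2.1
  diag s hs hp := hs.2.2 _ h.diag (by obtain ⟨p, h1, h2⟩ := hp; exact ⟨p, h1, h2⟩)
  conv s hs := by
    refine ⟨h.conv _ hs.1, ?_, ?_⟩
    · obtain ⟨⟨x, y⟩, hp⟩ := hs.2.1
      exact ⟨(y, x), hp⟩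
    · rintro R hR ⟨⟨x, y⟩, hp, hpR⟩ ⟨x', y'⟩ hq
      exact hs.2.2 _ (h.conv R hR) ⟨(y, x), hp, hpR⟩ hq
  inum r hr s hs t ht p hp q hq := by
    have := ht.2.2 _ (h.count r hr.1 s hs.1 (cnum r s p)) ⟨p, hp, rfl⟩ hq
    exact this.symm

theorem Closed.cfg_rel [Finite Ω] (h : Closed 𝓡) {R} : IsRelationOf h.cfg R ↔ R ∈ 𝓡 := by
  constructor
  · intro hR
    apply h.mem_of_sat
    intro p q hpq hp
    obtain ⟨T, hT, hpT⟩ := h.atom_cover p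
    exact hR T hT ⟨p, hpT, hp⟩ (hpq T hT.1 hpT)
  · intro hR T hT hne
    exact hT.2.2 R hR hne

theorem cfg_ext {X Y : CohCfg Ω} (h : X.S = Y.S) : X = Y := by
  cases X; cases Y; simp only at h; subst h; rfl

end atoms

section bi
variable {Ω : Type u} {Ω' : Type v} {P : Set (Ω × Ω) → Set (Ω' × Ω') → Prop}

theorem Bi.atom_right (h : Bi P) (hf : Faithful P) {R R'} (hR : P R R')
    (ha : Atom {R | ∃ R', P R R'} R) : Atom {R' | ∃ R, P R R'} R' := by
  refine ⟨⟨_, hR⟩, ?_, ?_⟩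
  · rw [Set.nonempty_iff_ne_empty, ne_eq, ← hf _ _ hR, ← ne_eq, ← Set.nonempty_iff_ne_empty]
    exact ha.2.1
  · rintro T' ⟨T, hT⟩ hne
    rw [Set.nonempty_iff_ne_empty, ne_eq, ← hf _ _ (h.inter _ _ _ _ hR hT), ← ne_eq,
      ← Set.nonempty_iff_ne_empty] at hne
    exact (h.subset_iff hf hR hT).mp (ha.2.2 T ⟨_, hT⟩ hne)

theorem Bi.atom_left (h : Bi P) (hf : Faithful P) {R R'} (hR : P R R')
    (ha : Atom {R' | ∃ R, P R R'} R') : Atom {R | ∃ R', P R R'} R := by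
  refine ⟨⟨_, hR⟩, ?_, ?_⟩
  · rw [Set.nonempty_iff_ne_empty, ne_eq, hf _ _ hR, ← ne_eq, ← Set.nonempty_iff_ne_empty]
    exact ha.2.1
  · rintro T ⟨T', hT⟩ hne
    rw [Set.nonempty_iff_ne_empty, ne_eq, hf _ _ (h.inter _ _ _ _ hR hT), ← ne_eq,
      ← Set.nonempty_iff_ne_empty] at hne
    exact (h.subset_iff hf hR hT).mpr (ha.2.2 T' ⟨_, hT⟩ hne)

open Classical in
/-- a chosen partner -/
noncomputable def partner (P : Set (Ω × Ω) → Set (Ω' × Ω') → Prop) (R : Set (Ω × Ω)) : Set (Ω' × Ω') :=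
  if h : ∃ R', P R R' then h.choose else ∅

theorem partner_spec {R} (h : ∃ R', P R R') : P R (partner P R) := by
  unfold partner
  rw [dif_pos h]
  exact h.choose_spec

end bi

section bi
variable {Ω : Type u} {Ω' : Type u} {P : Set (Ω × Ω) → Set (Ω' × Ω') → Prop}

theorem Bi.isAlgIso [Finite Ω] [Finite Ω'] (h : Bi P) (hf : Faithful P) :
    IsAlgIso h.left.cfg h.right.cfg (partner P) := by
  refine ⟨⟨?_, ?_, ?_⟩, ?_⟩
  · intro T hT
    exact h.atom_right hf (partner_spec hT.1) hT
  · intro T hT S hS e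
    have h1 := partner_spec (P := P) hT.1
    rw [e] at h1
    exact h.unique' hf h1 (partner_spec hS.1)
  · intro T' hT'
    obtain ⟨T, hT⟩ := hT'.1
    exact ⟨T, h.atom_left hf hT hT', h.unique hf (partner_spec ⟨_, hT⟩) hT⟩
  · intro r hr s hs t ht p hp q hq
    have h1 := h.count _ _ _ _ (partner_spec hr.1) (partner_spec hs.1) (cnum r s p)
    have h2 := ht.2.2 _ ⟨_, h1⟩ ⟨p, hp, rfl⟩
    have h3 := (h.subset_iff hf (partner_spec ht.1) h1).mp h2 hq
    exact h3.symm

theorem Bi.to_algP [Finite Ω] [Finite Ω'] (h : Bi P) (hf : Faithful P) {R R'} (hR : P R R') :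
    algP h.left.cfg (partner P) R R' := by
  rintro p q ⟨T, hT, hp, hq⟩
  have hT' := h.atom_right hf (partner_spec hT.1) hT
  have e := h.subset_iff hf (partner_spec hT.1) hR
  constructor
  · intro hpR
    exact e.mp (hT.2.2 R ⟨_, hR⟩ ⟨p, hp, hpR⟩) hq
  · intro hqR
    exact e.mpr (hT'.2.2 R' ⟨_, hR⟩ ⟨q, hq, hqR⟩) hp

variable {X : CohCfg Ω} {X' : CohCfg Ω'} {φ : Set (Ω × Ω) → Set (Ω' × Ω')}

structure Ext (X : CohCfg Ω) (φ : Set (Ω × Ω) → Set (Ω' × Ω')) (α : Ω) (α' : Ω')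
    (P : Set (Ω × Ω) → Set (Ω' × Ω') → Prop) : Prop where
  bi : Bi P
  faithful : Faithful P
  basic : ∀ s ∈ X.S, P s (φ s)
  pt : P {(α, α)} {(α', α')}

theorem ext_of_hasExtension {α α'} (h : HasExtension X X' φ α α') : ∃ P, Ext X φ α α' P := by
  obtain ⟨Y, Y', ψ, h1, h2, h3, h4, h5⟩ := h
  refine ⟨algP Y ψ, h3.bi, h3.faithful, ?_, ?_⟩
  · intro s hs
    rw [← h4 s hs]
    exact h3.algP_algImage (h1.1 s hs)
  · rw [← h5]
    exact h3.algP_basic h1.2.1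

/-- the family generated by `φ` and the points -/
inductive PGen (X : CohCfg Ω) (φ : Set (Ω × Ω) → Set (Ω' × Ω')) (α : Ω) (α' : Ω') :
    Set (Ω × Ω) → Set (Ω' × Ω') → Prop
  | basic (s) (hs : s ∈ X.S) : PGen X φ α α' s (φ s)
  | pt : PGen X φ α α' {(α, α)} {(α', α')}
  | diag : PGen X φ α α' {p | p.1 = p.2} {p | p.1 = p.2}
  | compl (R R') (h : PGen X φ α α' R R') : PGen X φ α α' Rᶜ R'ᶜ
  | inter (R R' S S') (h : PGen X φ α α' R R') (h' : PGen X φ α α' S S') :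
      PGen X φ α α' (R ∩ S) (R' ∩ S')
  | conv (R R') (h : PGen X φ α α' R R') :
      PGen X φ α α' {p | (p.2, p.1) ∈ R} {p | (p.2, p.1) ∈ R'}
  | count (R R' S S') (h : PGen X φ α α' R R') (h' : PGen X φ α α' S S') (k : ℕ) :
      PGen X φ α α' {p | cnum R S p = k} {p | cnum R' S' p = k}

theorem pgen_bi (X : CohCfg Ω) (φ : Set (Ω × Ω) → Set (Ω' × Ω')) (α : Ω) (α' : Ω') :
    Bi (PGen X φ α α') :=
  ⟨.diag, .compl, .inter, .conv, fun R R' S S' h h' k => .count R R' S S' h h' k⟩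

theorem Ext.of_pgen {α α'} (hE : Ext X φ α α' P) {R R'} (h : PGen X φ α α' R R') : P R R' := by
  induction h with
  | basic s hs => exact hE.basic s hs
  | pt => exact hE.pt
  | diag => exact hE.bi.diag
  | compl _ _ _ ih => exact hE.bi.compl _ _ ih
  | inter _ _ _ _ _ _ ih ih' => exact hE.bi.inter _ _ _ _ ih ih'
  | conv _ _ _ ih => exact hE.bi.conv _ _ ih
  | count _ _ _ _ _ _ k ih ih' => exact hE.bi.count _ _ _ _ ih ih' k

theorem atom_singleton {𝓡 : Set (Set (Ω × Ω))} {p : Ω × Ω} (h : {p} ∈ 𝓡) : Atom 𝓡 {p} := by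
  refine ⟨h, ⟨p, rfl⟩, ?_⟩
  rintro R _ ⟨q, hq, hqR⟩ q' hq'
  rw [Set.mem_singleton_iff] at hq hq'
  subst hq hq'
  exact hqR

theorem Ext.hasExtension {α α'} (hE : Ext X φ α α' P) (hφ : IsAlgIso X X' φ) : HasExtension X X' φ α α' := by
  have := X.finite
  have := X'.finite
  have hB := pgen_bi X φ α α'
  have hF : Faithful (PGen X φ α α') := fun R R' h => hE.faithful R R' (hE.of_pgen h)
  have hI := hB.isAlgIso hF
  refine ⟨hB.left.cfg, hB.right.cfg, partner (PGen X φ α α'), ⟨?_, ?_, ?_⟩, ⟨?_, ?_, ?_⟩, hI, ?_, ?_⟩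
  · intro s hs
    exact hB.left.cfg_rel.mpr ⟨_, .basic s hs⟩
  · exact atom_singleton ⟨_, .pt⟩
  · intro Z hZ1 hZ2
    have key : ∀ R R', PGen X φ α α' R R' → R ∈ {R | IsRelationOf Z R} := by
      have hZ := rel_closed Z
      intro R R' h
      induction h with
      | basic s hs => exact hZ1 s hs
      | pt => exact isRel_basic Z hZ2
      | diag => exact hZ.diag
      | compl _ _ _ ih => exact hZ.compl _ ih
      | inter _ _ _ _ _ _ ih ih' => exact hZ.inter _ ih _ ih'
      | conv _ _ _ ih => exact hZ.conv _ ih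
      | count _ _ _ _ _ _ k ih ih' => exact hZ.count _ ih _ ih' k
    intro T hT
    obtain ⟨T', hT'⟩ := hT.1
    exact key T T' hT'
  · intro s' hs'
    obtain ⟨s, hs, rfl⟩ := hφ.bijOn.surjOn hs'
    exact hB.right.cfg_rel.mpr ⟨_, .basic s hs⟩
  · exact atom_singleton ⟨_, .pt⟩
  · intro Z hZ1 hZ2
    have key : ∀ R R', PGen X φ α α' R R' → R' ∈ {R | IsRelationOf Z R} := by
      have hZ := rel_closed Z
      intro R R' h
      induction h with
      | basic s hs => exact hZ1 _ (hφ.bijOn.mapsTo hs)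
      | pt => exact isRel_basic Z hZ2
      | diag => exact hZ.diag
      | compl _ _ _ ih => exact hZ.compl _ ih
      | inter _ _ _ _ _ _ ih ih' => exact hZ.inter _ ih _ ih'
      | conv _ _ _ ih => exact hZ.conv _ ih
      | count _ _ _ _ _ _ k ih ih' => exact hZ.count _ ih _ ih' k
    intro T hT
    obtain ⟨T', hT'⟩ := hT.1
    exact key T' T hT'
  · intro s hs
    have h1 := hB.to_algP hF (.basic s hs)
    exact hI.bi.unique hI.faithful (hI.algP_algImage (hI.rel_of_algP h1)) h1
  · exact hB.unique hF (partner_spec ⟨_, .pt⟩) .pt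

/-- everything in `algP X φ` belongs to every family extending `φ` -/
theorem bi_of_algP (hφ : IsAlgIso X X' φ) (hB : Bi P) (hb : ∀ s ∈ X.S, P s (φ s)) {R R'}
    (hR : algP X φ R R') : P R R' := by
  have := X.finite
  have h1 : R = ⋃ t : {t // t ∈ X.S ∧ t ⊆ R}, t.1 := by
    ext p
    simp only [Set.mem_iUnion]
    constructor
    · intro hp
      obtain ⟨t, ht, hpt⟩ := X.cover p
      exact ⟨⟨t, ht, hφ.rel_of_algP hR t ht ⟨p, hpt, hp⟩⟩, hpt⟩
    · rintro ⟨t, hp⟩; exact t.2.2 hp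
  have h2 : R' = ⋃ t : {t // t ∈ X.S ∧ t ⊆ R}, φ t.1 := by
    ext q
    simp only [Set.mem_iUnion]
    constructor
    · intro hq
      obtain ⟨t, ht, hqt⟩ := hφ.right q
      obtain ⟨p, hp⟩ := X.nonemp t ht
      exact ⟨⟨t, ht, hφ.rel_of_algP hR t ht ⟨p, hp, (hR _ _ ⟨t, ht, hp, hqt⟩).mpr hq⟩⟩, hqt⟩
    · rintro ⟨t, hq⟩
      obtain ⟨p, hp⟩ := X.nonemp t t.2.1
      exact (hR p q ⟨t, t.2.1, hp, hq⟩).mp (t.2.2 hp)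
  rw [h1, h2]
  exact hB.iUnion fun t => hb t.1 t.2.1

end bi
end Circ

namespace Circ
open CohCfg

universe v w z

/-- push a family of pairs of relations forward along partial maps -/
def push {Ω : Type u} {Ω' : Type v} {Q : Type w} {Q' : Type z}
    (P : Set (Ω × Ω) → Set (Ω' × Ω') → Prop) (Δ : Set Ω) (Δ' : Set Ω') (π : Ω → Q) (π' : Ω' → Q')
    (R : Set (Q × Q)) (R' : Set (Q' × Q')) : Prop :=
  ∃ ρ ρ', P ρ ρ' ∧ (∀ x ∈ Δ, ∀ y ∈ Δ, (π x, π y) ∈ R ↔ (x, y) ∈ ρ) ∧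
    (∀ x ∈ Δ', ∀ y ∈ Δ', (π' x, π' y) ∈ R' ↔ (x, y) ∈ ρ')

structure Fib {Ω : Type u} {Q : Type w} (Δ : Set Ω) (d e : Set (Ω × Ω)) (π : Ω → Q) (c : ℕ) : Prop where
  cls : ∀ x ∈ Δ, ∀ y, (x, y) ∈ d ↔ y ∈ Δ
  ker : ∀ x ∈ Δ, ∀ y ∈ Δ, π x = π y ↔ (x, y) ∈ e
  sub : e ⊆ d
  surj : ∀ q, ∃ x ∈ Δ, π x = q
  card : ∀ q, {x | x ∈ Δ ∧ π x = q}.ncard = c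

def pushRel {Ω : Type u} {Q : Type w} (Δ : Set Ω) (π : Ω → Q) (ρ : Set (Ω × Ω)) : Set (Q × Q) :=
  {p | ∃ x ∈ Δ, ∃ y ∈ Δ, π x = p.1 ∧ π y = p.2 ∧ (x, y) ∈ ρ}

section one
variable {Ω : Type u} {Q : Type w} {Δ : Set Ω} {d e : Set (Ω × Ω)} {π : Ω → Q} {c : ℕ}

theorem Fib.ncard_preimage [Finite Ω] (h : Fib Δ d e π c) (W : Set Q) :
    {x | x ∈ Δ ∧ π x ∈ W}.ncard = c * W.ncard := by
  have hQ : Finite Q := Finite.of_surjective π fun q => by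
    obtain ⟨x, _, hx⟩ := h.surj q; exact ⟨x, hx⟩
  induction W, Set.toFinite W using Set.Finite.induction_on with
  | empty => simp
  | @insert a W ha hf ih =>
    have e1 : {x | x ∈ Δ ∧ π x ∈ insert a W} = {x | x ∈ Δ ∧ π x = a} ∪ {x | x ∈ Δ ∧ π x ∈ W} := by
      ext x
      simp only [Set.mem_insert_iff, Set.mem_ofPred_eq, Set.mem_union]
      tauto
    rw [e1, Set.ncard_union_eq, ih, h.card, Set.ncard_insert_of_notMem ha hf]
    · ring
    · rw [Set.disjoint_left]
      rintro x ⟨_, hx⟩ ⟨_, hx'⟩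
      rw [hx] at hx'
      exact ha hx'

theorem Fib.cnum_eq [Finite Ω] (h : Fib Δ d e π c) {R S : Set (Q × Q)} {ρ σ : Set (Ω × Ω)}
    (hR : ∀ x ∈ Δ, ∀ y ∈ Δ, (π x, π y) ∈ R ↔ (x, y) ∈ ρ)
    (hS : ∀ x ∈ Δ, ∀ y ∈ Δ, (π x, π y) ∈ S ↔ (x, y) ∈ σ) {x y} (hx : x ∈ Δ) (hy : y ∈ Δ) :
    cnum (ρ ∩ d) (σ ∩ d) (x, y) = c * cnum R S (π x, π y) := by
  unfold cnum
  rw [← h.ncard_preimage]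
  congr 1
  ext w
  simp only [Set.mem_inter_iff, Set.mem_ofPred_eq]
  constructor
  · rintro ⟨⟨h1, h2⟩, h3, h4⟩
    have hw := (h.cls x hx w).mp h2
    exact ⟨hw, (hR x hx w hw).mpr h1, (hS w hw y hy).mpr h3⟩
  · rintro ⟨hw, h1, h2⟩
    exact ⟨⟨(hR x hx w hw).mp h1, (h.cls x hx w).mpr hw⟩, (hS w hw y hy).mp h2, (h.cls w hw y).mpr hy⟩

theorem Fib.pushRel_iff (h : Fib Δ d e π c) {ρ : Set (Ω × Ω)} {x y} (hx : x ∈ Δ) (hy : y ∈ Δ) :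
    (π x, π y) ∈ pushRel Δ π ρ ↔
      (x, y) ∈ {p : Ω × Ω | ∃ w, (p.1, w) ∈ {p : Ω × Ω | ∃ w, (p.1, w) ∈ e ∧ (w, p.2) ∈ ρ ∩ d} ∧ (w, p.2) ∈ e} := by
  simp only [pushRel, Set.mem_ofPred_eq]
  constructor
  · rintro ⟨x1, hx1, y1, hy1, h1, h2, h3⟩
    exact ⟨y1, ⟨x1, (h.ker x hx x1 hx1).mp h1.symm, h3, (h.cls x1 hx1 y1).mpr hy1⟩,
      (h.ker y1 hy1 y hy).mp h2⟩
  · rintro ⟨y1, ⟨x1, h1, h3, h4⟩, h2⟩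
    have hx1 := (h.cls x hx x1).mp (h.sub h1)
    have hy1 := (h.cls x1 hx1 y1).mp h4
    exact ⟨x1, hx1, y1, hy1, ((h.ker x hx x1 hx1).mpr h1).symm, (h.ker y1 hy1 y hy).mpr h2, h3⟩

end one

section two
variable {Ω : Type u} {Ω' : Type v} {Q : Type w} {Q' : Type z}
  {P : Set (Ω × Ω) → Set (Ω' × Ω') → Prop} {Δ : Set Ω} {Δ' : Set Ω'} {π : Ω → Q} {π' : Ω' → Q'}
  {d e : Set (Ω × Ω)} {d' e' : Set (Ω' × Ω')} {c : ℕ}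

theorem push_bi [Finite Ω] [Finite Ω'] (hP : Bi P) (hF : Fib Δ d e π c) (hF' : Fib Δ' d' e' π' c) (hc : 0 < c)
    (hd : P d d') (he : P e e') : Bi (push P Δ Δ' π π') := by
  refine ⟨⟨e, e', he, hF.ker, hF'.ker⟩, ?_, ?_, ?_, ?_⟩
  · rintro R R' ⟨ρ, ρ', h1, h2, h3⟩
    exact ⟨_, _, hP.compl _ _ h1, fun x hx y hy => not_congr (h2 x hx y hy),
      fun x hx y hy => not_congr (h3 x hx y hy)⟩
  · rintro R R' S S' ⟨ρ, ρ', h1, h2, h3⟩ ⟨σ, σ', h4, h5, h6⟩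
    exact ⟨_, _, hP.inter _ _ _ _ h1 h4, fun x hx y hy => and_congr (h2 x hx y hy) (h5 x hx y hy),
      fun x hx y hy => and_congr (h3 x hx y hy) (h6 x hx y hy)⟩
  · rintro R R' ⟨ρ, ρ', h1, h2, h3⟩
    exact ⟨_, _, hP.conv _ _ h1, fun x hx y hy => h2 y hy x hx, fun x hx y hy => h3 y hy x hx⟩
  · rintro R R' S S' ⟨ρ, ρ', h1, h2, h3⟩ ⟨σ, σ', h4, h5, h6⟩ k
    refine ⟨_, _, hP.count _ _ _ _ (hP.inter _ _ _ _ h1 hd) (hP.inter _ _ _ _ h4 hd) (c * k), ?_, ?_⟩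
    · intro x hx y hy
      simp only [Set.mem_ofPred_eq]
      rw [hF.cnum_eq h2 h5 hx hy, Nat.mul_right_inj hc.ne']
    · intro x hx y hy
      simp only [Set.mem_ofPred_eq]
      rw [hF'.cnum_eq h3 h6 hx hy, Nat.mul_right_inj hc.ne']

theorem push_mono {P' : Set (Ω × Ω) → Set (Ω' × Ω') → Prop} (h : ∀ R R', P R R' → P' R R') {R R'}
    (hR : push P Δ Δ' π π' R R') : push P' Δ Δ' π π' R R' := by
  obtain ⟨ρ, ρ', h1, h2⟩ := hR
  exact ⟨ρ, ρ', h _ _ h1, h2⟩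

theorem push_faithful (hP : Bi P) (hf : Faithful P) (hF : Fib Δ d e π c) (hF' : Fib Δ' d' e' π' c)
    (hΔ : P (Δ ×ˢ Δ) (Δ' ×ˢ Δ')) : Faithful (push P Δ Δ' π π') := by
  rintro R R' ⟨ρ, ρ', h1, h2, h3⟩
  have h4 := hf _ _ (hP.inter _ _ _ _ h1 hΔ)
  have e1 : R = ∅ ↔ ρ ∩ Δ ×ˢ Δ = ∅ := by
    simp only [Set.eq_empty_iff_forall_notMem]
    constructor
    · rintro h ⟨x, y⟩ ⟨hxy, hx, hy⟩
      exact h _ ((h2 x hx y hy).mpr hxy)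
    · rintro h ⟨a, b⟩ hab
      obtain ⟨x, hx, rfl⟩ := hF.surj a
      obtain ⟨y, hy, rfl⟩ := hF.surj b
      exact h (x, y) ⟨(h2 x hx y hy).mp hab, hx, hy⟩
  have e2 : R' = ∅ ↔ ρ' ∩ Δ' ×ˢ Δ' = ∅ := by
    simp only [Set.eq_empty_iff_forall_notMem]
    constructor
    · rintro h ⟨x, y⟩ ⟨hxy, hx, hy⟩
      exact h _ ((h3 x hx y hy).mpr hxy)
    · rintro h ⟨a, b⟩ hab
      obtain ⟨x, hx, rfl⟩ := hF'.surj a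
      obtain ⟨y, hy, rfl⟩ := hF'.surj b
      exact h (x, y) ⟨(h3 x hx y hy).mp hab, hx, hy⟩
  rw [e1, e2, h4]

theorem push_pushRel [Finite Ω] [Finite Ω'] (hP : Bi P) (hF : Fib Δ d e π c) (hF' : Fib Δ' d' e' π' c)
    (hd : P d d') (he : P e e') {ρ ρ'} (hρ : P ρ ρ') :
    push P Δ Δ' π π' (pushRel Δ π ρ) (pushRel Δ' π' ρ') :=
  ⟨_, _, hP.comp (hP.comp he (hP.inter _ _ _ _ hρ hd)) he, fun _ hx _ hy => hF.pushRel_iff hx hy,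
    fun _ hx _ hy => hF'.pushRel_iff hx hy⟩

theorem rel_prod {α : Ω} {A B : Set (Ω × Ω)} :
    {p : Ω × Ω | ∃ w, (p.1, w) ∈ {p : Ω × Ω | ∃ w, (p.1, w) ∈ A ∧ (w, p.2) ∈ ({(α, α)} : Set (Ω × Ω))} ∧ (w, p.2) ∈ B} =
      {p | (p.1, α) ∈ A ∧ (α, p.2) ∈ B} := by
  ext ⟨x, y⟩
  simp only [Set.mem_singleton_iff, Prod.mk.injEq, Set.mem_ofPred_eq]
  constructor
  · rintro ⟨w, ⟨w1, h1, rfl, rfl⟩, h2⟩; exact ⟨h1, h2⟩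
  · rintro ⟨h1, h2⟩; exact ⟨α, ⟨α, h1, rfl, rfl⟩, h2⟩

/-- `A α ∪ α B` type relations -/
theorem Bi.prod [Finite Ω] [Finite Ω'] (hP : Bi P) {α α'} (hpt : P {(α, α)} {(α', α')}) {A A' B B'}
    (hA : P A A') (hB : P B B') : P {p | (p.1, α) ∈ A ∧ (α, p.2) ∈ B} {p | (p.1, α') ∈ A' ∧ (α', p.2) ∈ B'} := by
  have := hP.comp (hP.comp hA hpt) hB
  rwa [rel_prod, rel_prod] at this

theorem Bi.prodΔ [Finite Ω] [Finite Ω'] (hP : Bi P) {α α'} (hpt : P {(α, α)} {(α', α')})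
    (hF : Fib Δ d e π c) (hF' : Fib Δ' d' e' π' c) (hd : P d d') (hα : α ∈ Δ) (hα' : α' ∈ Δ') :
    P (Δ ×ˢ Δ) (Δ' ×ˢ Δ') := by
  have h := hP.prod hpt (hP.conv _ _ hd) hd
  convert h using 1
  · ext ⟨x, y⟩
    simp only [Set.mem_prod, Set.mem_ofPred_eq, hF.cls α hα]
  · ext ⟨x, y⟩
    simp only [Set.mem_prod, Set.mem_ofPred_eq, hF'.cls α' hα']

theorem push_pt [Finite Ω] [Finite Ω'] (hP : Bi P) {α α'} (hpt : P {(α, α)} {(α', α')})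
    (hF : Fib Δ d e π c) (hF' : Fib Δ' d' e' π' c) (he : P e e') (hα : α ∈ Δ) (hα' : α' ∈ Δ') :
    push P Δ Δ' π π' {(π α, π α)} {(π' α', π' α')} := by
  refine ⟨_, _, hP.prod hpt (hP.conv _ _ he) he, ?_, ?_⟩
  · intro x hx y hy
    simp only [Set.mem_singleton_iff, Prod.mk.injEq, Set.mem_ofPred_eq]
    rw [← hF.ker α hα y hy, ← hF.ker α hα x hx, eq_comm, eq_comm (a := π y)]
  · intro x hx y hy
    simp only [Set.mem_singleton_iff, Prod.mk.injEq, Set.mem_ofPred_eq]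
    rw [← hF'.ker α' hα' y hy, ← hF'.ker α' hα' x hx, eq_comm, eq_comm (a := π' y)]

end two

section sec
variable {Ω Ω' Q Q' : Type u} {X : CohCfg Ω} {X' : CohCfg Ω'} {φ : Set (Ω × Ω) → Set (Ω' × Ω')}
  {Δ : Set Ω} {Δ' : Set Ω'} {π : Ω → Q} {π' : Ω' → Q'}
  {d e : Set (Ω × Ω)} {d' e' : Set (Ω' × Ω')} {c : ℕ}

theorem sec_sesqui (hφ : IsAlgIso X X' φ) (hext : ∀ α ∈ Δ, ∀ α' ∈ Δ', HasExtension X X' φ α α')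
    (hF : Fib Δ d e π c) (hF' : Fib Δ' d' e' π' c) (hc : 0 < c) (hΔ : Δ.Nonempty) (hΔ' : Δ'.Nonempty)
    (hd : algP X φ d d') (he : algP X φ e e') :
    ∃ (Y : CohCfg Q) (Y' : CohCfg Q') (ψ : Set (Q × Q) → Set (Q' × Q')),
      Y.S = {t | ∃ s ∈ X.S, t = pushRel Δ π s ∧ t.Nonempty} ∧ SesquiclosedIso Y Y' ψ ∧
      ∀ s ∈ X.S, ψ (pushRel Δ π s) = pushRel Δ' π' (φ s) := by
  have := X.finite
  have := X'.finite
  have : Finite Q := Finite.of_surjective π fun q => by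
    obtain ⟨x, _, hx⟩ := hF.surj q; exact ⟨x, hx⟩
  have : Finite Q' := Finite.of_surjective π' fun q => by
    obtain ⟨x, _, hx⟩ := hF'.surj q; exact ⟨x, hx⟩
  have hB := push_bi hφ.bi hF hF' hc hd he
  have hE : ∀ α ∈ Δ, ∀ α' ∈ Δ', ∃ P, Ext X φ α α' P ∧ (∀ R R', algP X φ R R' → P R R') ∧
      Bi (push P Δ Δ' π π') ∧ Faithful (push P Δ Δ' π π') := by
    intro α hα α' hα'
    obtain ⟨P, hP⟩ := ext_of_hasExtension (hext α hα α' hα')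
    have hm : ∀ R R', algP X φ R R' → P R R' := fun R R' h => bi_of_algP hφ hP.bi hP.basic h
    exact ⟨P, hP, hm, push_bi hP.bi hF hF' hc (hm _ _ hd) (hm _ _ he),
      push_faithful hP.bi hP.faithful hF hF' (hP.bi.prodΔ hP.pt hF hF' (hm _ _ hd) hα hα')⟩
  have hf : Faithful (push (algP X φ) Δ Δ' π π') := by
    obtain ⟨α, hα⟩ := hΔ
    obtain ⟨α', hα'⟩ := hΔ'
    obtain ⟨P, hP, hm, _, h4⟩ := hE α hα α' hα'
    exact fun R R' h => h4 R R' (push_mono hm h)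
  have hI := hB.isAlgIso hf
  have hps : ∀ s ∈ X.S, push (algP X φ) Δ Δ' π π' (pushRel Δ π s) (pushRel Δ' π' (φ s)) :=
    fun s hs => push_pushRel hφ.bi hF hF' hd he (hφ.algP_basic hs)
  have hat : ∀ s ∈ X.S, (pushRel Δ π s).Nonempty → pushRel Δ π s ∈ hB.left.cfg.S := by
    intro s hs hne
    refine ⟨⟨_, hps s hs⟩, hne, ?_⟩
    rintro R ⟨R', ρ, ρ', h1, h2, h3⟩ ⟨p, ⟨x, hx, y, hy, hx1, hy1, hxy⟩, hp⟩
    have hp' : (π x, π y) ∈ R := by rw [hx1, hy1]; exact hp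
    have hsρ := hφ.rel_of_algP h1 s hs ⟨_, hxy, (h2 x hx y hy).mp hp'⟩
    rintro ⟨a, b⟩ ⟨x2, hx2, y2, hy2, rfl, rfl, h⟩
    exact (h2 _ hx2 _ hy2).mpr (hsρ h)
  refine ⟨hB.left.cfg, hB.right.cfg, partner _, ?_, ⟨hI, ?_⟩, ?_⟩
  · ext T
    constructor
    · intro hT
      obtain ⟨⟨a, b⟩, hab⟩ := hB.left.cfg.nonemp T hT
      obtain ⟨x, hx, rfl⟩ := hF.surj a
      obtain ⟨y, hy, rfl⟩ := hF.surj b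
      obtain ⟨s, hs, hxy⟩ := X.cover (x, y)
      have h1 : (π x, π y) ∈ pushRel Δ π s := ⟨x, hx, y, hy, rfl, rfl, hxy⟩
      exact ⟨s, hs, cls_unique _ hT (hat s hs ⟨_, h1⟩) hab h1, ⟨_, hab⟩⟩
    · rintro ⟨s, hs, rfl, hne⟩
      exact hat s hs hne
  · intro Δ0 _ α0 _ α0' _
    obtain ⟨α, hα, rfl⟩ := hF.surj α0
    obtain ⟨α', hα', rfl⟩ := hF'.surj α0'
    obtain ⟨P, hP, hm, h3, h4⟩ := hE α hα α' hα'
    have : Ext hB.left.cfg (partner (push (algP X φ) Δ Δ' π π')) (π α) (π' α') (push P Δ Δ' π π') :=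
      ⟨h3, h4, fun s hs => push_mono hm (partner_spec hs.1),
        push_pt hP.bi hP.pt hF hF' (hm _ _ he) hα hα'⟩
    exact this.hasExtension hI
  · intro s hs
    exact hB.unique hf (partner_spec ⟨_, hps s hs⟩) (hps s hs)

theorem sec_iso {Y : CohCfg Q} {Y' : CohCfg Q'} {ψ : Set (Q × Q) → Set (Q' × Q')}
    (hY : Y.S = {t | ∃ s ∈ X.S, t = pushRel Δ π s ∧ t.Nonempty})
    (hψ : SesquiclosedIso Y Y' ψ) (hψ' : ∀ s ∈ X.S, ψ (pushRel Δ π s) = pushRel Δ' π' (φ s))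
    (hsep : Sesquiseparable Y) :
    ∃ f : Q → Q', Function.Bijective f ∧ ∀ s ∈ X.S, ∀ x ∈ Δ, ∀ y ∈ Δ, (x, y) ∈ s →
      ∃ x' ∈ Δ', ∃ y' ∈ Δ', π' x' = f (π x) ∧ π' y' = f (π y) ∧ (x', y') ∈ φ s := by
  obtain ⟨f, hf, h⟩ := hsep Q' Y' ψ hψ
  refine ⟨f, hf, ?_⟩
  intro s hs x hx y hy hxy
  have h1 : (π x, π y) ∈ pushRel Δ π s := ⟨x, hx, y, hy, rfl, rfl, hxy⟩
  have h2 := h (pushRel Δ π s) (by rw [hY]; exact ⟨s, hs, rfl, ⟨_, h1⟩⟩)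
  rw [hψ' s hs] at h2
  have h3 : (f (π x), f (π y)) ∈ pushRel Δ' π' (φ s) := by
    rw [h2]; exact ⟨_, h1, rfl⟩
  obtain ⟨x', hx', y', hy', e1, e2, h4⟩ := h3
  exact ⟨x', hx', y', hy', e1, e2, h4⟩

end sec
end Circ

namespace Circ
open CohCfg

universe v w z

/-- equivalence relations as sets of pairs -/
structure Eqv {Ω : Type u} (e : Set (Ω × Ω)) : Prop where
  refl : ∀ a, (a, a) ∈ e
  symm : ∀ a b, (a, b) ∈ e → (b, a) ∈ e
  trans : ∀ a b c, (a, b) ∈ e → (b, c) ∈ e → (a, c) ∈ e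

section eqv
variable {Ω : Type u} {Q : Type w} {Δ : Set Ω} {d e : Set (Ω × Ω)} {π : Ω → Q} {c : ℕ}

theorem Eqv.eClass_eq (he : Eqv e) {x y : Ω} : eClass e x = eClass e y ↔ (x, y) ∈ e := by
  constructor
  · intro h
    have : y ∈ eClass e y := he.refl y
    rw [← h] at this
    exact this
  · intro h
    ext w
    exact ⟨fun h1 => he.trans _ _ _ (he.symm _ _ h) h1, fun h1 => he.trans _ _ _ h h1⟩

theorem fib_mk (cls : ∀ x ∈ Δ, ∀ y, (x, y) ∈ d ↔ y ∈ Δ) (ker : ∀ x ∈ Δ, ∀ y ∈ Δ, π x = π y ↔ (x, y) ∈ e)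
    (sub : e ⊆ d) (surj : ∀ q, ∃ x ∈ Δ, π x = q) (card : ∀ x ∈ Δ, (eClass e x).ncard = c) : Fib Δ d e π c := by
  refine ⟨cls, ker, sub, surj, ?_⟩
  intro q
  obtain ⟨x, hx, rfl⟩ := surj q
  rw [← card x hx]
  congr 1
  ext y
  constructor
  · rintro ⟨hy, h⟩; exact (ker x hx y hy).mp h.symm
  · intro h
    have hy := (cls x hx y).mp (sub h)
    exact ⟨hy, ((ker x hx y hy).mpr h).symm⟩

open Classical in
noncomputable def secπ (Δ : Set Ω) (e : Set (Ω × Ω)) (a : Ω) (ha : a ∈ Δ) (x : Ω) : Sec Δ e :=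
  if h : x ∈ Δ then ⟨eClass e x, x, h, rfl⟩ else ⟨eClass e a, a, ha, rfl⟩

theorem secπ_val {a : Ω} {ha : a ∈ Δ} {x : Ω} (hx : x ∈ Δ) : (secπ Δ e a ha x).1 = eClass e x := by
  unfold secπ; rw [dif_pos hx]

theorem fib_sec (he : Eqv e) (cls : ∀ x ∈ Δ, ∀ y, (x, y) ∈ d ↔ y ∈ Δ) (sub : e ⊆ d)
    (card : ∀ x ∈ Δ, (eClass e x).ncard = c) (a : Ω) (ha : a ∈ Δ) : Fib Δ d e (secπ Δ e a ha) c := by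
  refine fib_mk cls ?_ sub ?_ card
  · intro x hx y hy
    rw [Subtype.ext_iff, secπ_val hx, secπ_val hy, he.eClass_eq]
  · rintro ⟨_, x, hx, rfl⟩
    exact ⟨x, hx, Subtype.ext (secπ_val hx)⟩

theorem secRel_eq (he : Eqv e) (cls : ∀ x ∈ Δ, ∀ y, (x, y) ∈ d ↔ y ∈ Δ) (sub : e ⊆ d)
    (a : Ω) (ha : a ∈ Δ) (s : Set (Ω × Ω)) : secRel Δ e s = pushRel Δ (secπ Δ e a ha) s := by
  ext ⟨⟨_, x, hx, rfl⟩, ⟨_, y, hy, rfl⟩⟩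
  constructor
  · rintro ⟨b, hb, b', hb', h⟩
    have h1 := (cls x hx b).mp (sub hb)
    have h2 := (cls y hy b').mp (sub hb')
    refine ⟨b, h1, b', h2, ?_, ?_, h⟩
    · apply Subtype.ext; rw [secπ_val h1]; exact he.eClass_eq.mpr (he.symm _ _ hb)
    · apply Subtype.ext; rw [secπ_val h2]; exact he.eClass_eq.mpr (he.symm _ _ hb')
  · rintro ⟨b, hb, b', hb', h1, h2, h⟩
    have h1 := congrArg Subtype.val h1
    have h2 := congrArg Subtype.val h2
    rw [secπ_val hb] at h1
    rw [secπ_val hb'] at h2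
    refine ⟨b, ?_, b', ?_, h⟩
    · show b ∈ eClass e x
      exact he.symm _ _ (he.eClass_eq.mp h1)
    · show b' ∈ eClass e y
      exact he.symm _ _ (he.eClass_eq.mp h2)

open Classical in
noncomputable def restπ (Δ : Set Ω) (a : Ω) (ha : a ∈ Δ) (x : Ω) : ↥Δ :=
  if h : x ∈ Δ then ⟨x, h⟩ else ⟨a, ha⟩

theorem restπ_val {a : Ω} {ha : a ∈ Δ} {x : Ω} (hx : x ∈ Δ) : (restπ Δ a ha x).1 = x := by
  unfold restπ; rw [dif_pos hx]

theorem fib_rest (cls : ∀ x ∈ Δ, ∀ y, (x, y) ∈ d ↔ y ∈ Δ) (hd : ∀ x, (x, x) ∈ d) (a : Ω) (ha : a ∈ Δ) :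
    Fib Δ d {p | p.1 = p.2} (restπ Δ a ha) 1 := by
  refine fib_mk cls ?_ ?_ ?_ ?_
  · intro x hx y hy
    rw [Subtype.ext_iff, restπ_val hx, restπ_val hy]
    rfl
  · rintro ⟨x, y⟩ (h : x = y)
    subst h; exact hd x
  · rintro ⟨x, hx⟩
    exact ⟨x, hx, Subtype.ext (restπ_val hx)⟩
  · intro x _
    have : eClass {p : Ω × Ω | p.1 = p.2} x = {x} := by
      ext y; exact eq_comm
    rw [this, Set.ncard_singleton]

theorem restRel_eq (a : Ω) (ha : a ∈ Δ) (s : Set (Ω × Ω)) : restRel Δ s = pushRel Δ (restπ Δ a ha) s := by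
  ext ⟨⟨x, hx⟩, ⟨y, hy⟩⟩
  constructor
  · intro h
    exact ⟨x, hx, y, hy, Subtype.ext (restπ_val hx), Subtype.ext (restπ_val hy), h⟩
  · rintro ⟨b, hb, b', hb', h1, h2, h⟩
    have e1 : b = x := by
      have := congrArg Subtype.val h1
      rwa [restπ_val hb] at this
    have e2 : b' = y := by
      have := congrArg Subtype.val h2
      rwa [restπ_val hb'] at this
    rw [e1, e2] at h
    exact h

end eqv

section transport
variable {Ω : Type u} {Ω' : Type v} {P : Set (Ω × Ω) → Set (Ω' × Ω') → Prop}
  {e : Set (Ω × Ω)} {e' : Set (Ω' × Ω')}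

theorem Bi.eqv [Finite Ω] [Finite Ω'] (hP : Bi P) (hf : Faithful P) (h : P e e') (he : Eqv e) : Eqv e' := by
  refine ⟨?_, ?_, ?_⟩
  · have := (hP.subset_iff hf hP.diag h).mp (by rintro ⟨x, y⟩ (h : x = y); subst h; exact he.refl x)
    intro a
    exact this rfl
  · have := (hP.subset_iff hf h (hP.conv _ _ h)).mp (by rintro ⟨x, y⟩ h; exact he.symm _ _ h)
    intro a b hab
    exact this hab
  · have := (hP.subset_iff hf (hP.comp h h) h).mp (by
      rintro ⟨x, y⟩ ⟨w, h1, h2⟩; exact he.trans _ _ _ h1 h2)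
    intro a b c h1 h2
    exact this ⟨b, h1, h2⟩

theorem Eqv.cnum_eq {Ω : Type u} {e : Set (Ω × Ω)} (he : Eqv e) {x y} (h : (x, y) ∈ e) :
    cnum e e (x, y) = (eClass e x).ncard := by
  unfold cnum
  congr 1
  ext w
  exact ⟨fun h => h.1, fun h1 => ⟨h1, he.trans _ _ _ (he.symm _ _ h1) h⟩⟩

theorem Bi.card_class [Finite Ω] [Finite Ω'] (hP : Bi P) (hf : Faithful P) (h : P e e') (he : Eqv e) {c : ℕ}
    (hc : ∀ x, (eClass e x).ncard = c) (x' : Ω') : (eClass e' x').ncard = c := by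
  have he' := hP.eqv hf h he
  have := (hP.subset_iff hf h (hP.count _ _ _ _ h h c)).mp (by
    rintro ⟨x, y⟩ hxy
    show cnum e e (x, y) = c
    rw [he.cnum_eq hxy, hc])
  rw [← he'.cnum_eq (he'.refl x')]
  exact this (he'.refl x')

end transport

section scheme
variable {Ω Ω' : Type u} {X : CohCfg Ω} {X' : CohCfg Ω'} {φ : Set (Ω × Ω) → Set (Ω' × Ω')}

theorem _root_.CohCfg.SesquiclosedIso.ext_all (h : SesquiclosedIso X X' φ) (hs : IsScheme X) (α : Ω) (α' : Ω') :
    HasExtension X X' φ α α' := by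
  have e : diagRel (Set.univ : Set Ω) = {p : Ω × Ω | p.1 = p.2} := by
    ext p; simp [diagRel]
  refine h.2 Set.univ (by unfold IsFiber; rw [e]; exact hs) α trivial α' ?_
  show (α', α') ∈ φ (diagRel Set.univ)
  rw [e, h.1.bi.unique h.1.faithful (h.1.algP_basic hs) h.1.bi.diag]
  rfl

end scheme

section group
variable {G : Type u} [CommGroup G] {X : CohCfg G}

theorem eqv_eRelSet (H : Subgroup G) : Eqv (eRelSet H) := by
  refine ⟨?_, ?_, ?_⟩
  · intro a; simp [eRelSet, H.one_mem]
  · intro a b (h : a⁻¹ * b ∈ H)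
    show b⁻¹ * a ∈ H
    have := H.inv_mem h
    simpa using this
  · intro a b c (h : a⁻¹ * b ∈ H) (h' : b⁻¹ * c ∈ H)
    show a⁻¹ * c ∈ H
    have := H.mul_mem h h'
    simpa [mul_assoc] using this

theorem card_eRelSet (H : Subgroup G) (x : G) : (eClass (eRelSet H) x).ncard = Nat.card H := by
  have : eClass (eRelSet H) x = (fun y => x * y) '' (H : Set G) := by
    ext y
    constructor
    · intro h
      exact ⟨x⁻¹ * y, h, by simp⟩
    · rintro ⟨h, hh, rfl⟩
      show x⁻¹ * (x * h) ∈ H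
      simpa using hh
  rw [this, Set.ncard_image_of_injective _ (mul_right_injective x)]
  rfl

theorem cls_eRelSet (H : Subgroup G) : ∀ x ∈ (H : Set G), ∀ y, (x, y) ∈ eRelSet H ↔ y ∈ (H : Set G) := by
  intro x hx y
  show x⁻¹ * y ∈ H ↔ y ∈ H
  exact Subgroup.mul_mem_cancel_left H (H.inv_mem hx)

theorem eRelSet_mono {H K : Subgroup G} (h : H ≤ K) : eRelSet H ⊆ eRelSet K := fun _ hp => h hp

theorem trans_basic (hc : IsCirculant X) {s} (hs : s ∈ X.S) (g x y : G) : (x * g, y * g) ∈ s ↔ (x, y) ∈ s := by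
  constructor
  · intro h
    rw [← hc g⁻¹ s hs]
    exact ⟨_, h, by simp⟩
  · intro h
    rw [← hc g s hs]
    exact ⟨_, h, rfl⟩

theorem trans_rel (hc : IsCirculant X) {ρ} (hρ : IsRelationOf X ρ) (g x y : G) :
    (x * g, y * g) ∈ ρ ↔ (x, y) ∈ ρ := by
  obtain ⟨s, hs, hp⟩ := X.cover (x, y)
  have hp' := (trans_basic hc hs g x y).mpr hp
  exact ⟨fun h => hρ s hs ⟨_, hp', h⟩ hp, fun h => hρ s hs ⟨_, hp, h⟩ hp'⟩

theorem trans_one (hc : IsCirculant X) {ρ} (hρ : IsRelationOf X ρ) (x y : G) :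
    (1, x⁻¹ * y) ∈ ρ ↔ (x, y) ∈ ρ := by
  rw [← trans_rel hc hρ x 1 (x⁻¹ * y)]
  have : x⁻¹ * y * x = y := by rw [mul_comm, mul_inv_cancel_left]
  rw [one_mul, this]

theorem isXGroup_of_rel {H : Subgroup G} (h : IsRelationOf X (eRelSet H)) : IsXGroup X H :=
  ⟨h, (eqv_eRelSet H).refl, fun p hp => (eqv_eRelSet H).symm _ _ hp, (eqv_eRelSet H).trans⟩

theorem sub_isXGroup (hc : IsCirculant X) {U N : Subgroup G} (hU : IsXGroup X U) (h : SubXGroup X U N) :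
    IsRelationOf X (eRelSet N) := by
  rintro s hs ⟨⟨x, y⟩, hp, hpN⟩ ⟨x1, y1⟩ hq
  have hN : x⁻¹ * y ∈ N := hpN
  have h1 : (1, x⁻¹ * y) ∈ s := (trans_one hc (isRel_basic X hs) x y).mpr hp
  have h2 : (1, x1⁻¹ * y1) ∈ s := (trans_one hc (isRel_basic X hs) x1 y1).mpr hq
  have h3 : (x1, y1) ∈ eRelSet U := hU.1 s hs ⟨_, hp, h.1 hN⟩ hq
  have h4 := h.2 s hs ⟨_, h1, U.one_mem, h.1 hN, by simpa using hN⟩ _ h2 U.one_mem h3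
  simpa [eRelSet] using h4

/-- saturation with respect to `e(K)` -/
def Sat (K : Subgroup G) (ρ : Set (G × G)) : Prop :=
  ∀ x y a b, (x, y) ∈ ρ → x⁻¹ * a ∈ K → y⁻¹ * b ∈ K → (a, b) ∈ ρ

theorem Sat.compl {K : Subgroup G} {ρ : Set (G × G)} (h : Sat K ρ) : Sat K ρᶜ := by
  intro x y a b hxy hxa hyb hab
  exact hxy (h a b x y hab ((eqv_eRelSet K).symm _ _ hxa) ((eqv_eRelSet K).symm _ _ hyb))

theorem sat_eRelSet {K H : Subgroup G} (h : K ≤ H) : Sat K (eRelSet H) := by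
  intro x y a b hxy hxa hyb
  exact (eqv_eRelSet H).trans _ _ _ ((eqv_eRelSet H).symm _ _ (h hxa)) ((eqv_eRelSet H).trans _ _ _ hxy (h hyb))

/-- the saturation `e s e` -/
def satn (K : Subgroup G) (ρ : Set (G × G)) : Set (G × G) :=
  {p | ∃ w, (p.1, w) ∈ {p : G × G | ∃ w, (p.1, w) ∈ eRelSet K ∧ (w, p.2) ∈ ρ} ∧ (w, p.2) ∈ eRelSet K}

theorem satn_sat (K : Subgroup G) (ρ : Set (G × G)) : Sat K (satn K ρ) := by
  rintro x y a b ⟨w, ⟨w', h1, h2⟩, h3⟩ hxa hyb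
  exact ⟨w, ⟨w', (eqv_eRelSet K).trans _ _ _ ((eqv_eRelSet K).symm _ _ hxa) h1, h2⟩,
    (eqv_eRelSet K).trans _ _ _ h3 hyb⟩

theorem subset_satn (K : Subgroup G) (ρ : Set (G × G)) : ρ ⊆ satn K ρ := by
  rintro ⟨x, y⟩ h
  exact ⟨y, ⟨x, (eqv_eRelSet K).refl _, h⟩, (eqv_eRelSet K).refl _⟩

theorem satn_rel {K : Subgroup G} (hK : IsRelationOf X (eRelSet K)) {ρ} (hρ : IsRelationOf X ρ) :
    IsRelationOf X (satn K ρ) := by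
  have := X.finite
  have h := rel_closed X
  exact h.comp (h.comp hK hρ) hK

end group
end Circ

namespace Circ
open CohCfg

section aut
variable {Ω Q : Type u} {X : CohCfg Ω} {Δ : Set Ω} {π : Ω → Q}

theorem sec_aut {Y : CohCfg Q}
    (hY : Y.S = {t | ∃ s ∈ X.S, t = pushRel Δ π s ∧ t.Nonempty}) (hsch : Schurian Y)
    {s} (hs : s ∈ X.S) {x y x1 y1 : Ω} (hx : x ∈ Δ) (hy : y ∈ Δ) (hx1 : x1 ∈ Δ) (hy1 : y1 ∈ Δ)
    (h : (x, y) ∈ s) (h1 : (x1, y1) ∈ s) :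
    ∃ f : Q → Q, Function.Bijective f ∧ f (π x) = π x1 ∧ f (π y) = π y1 ∧
     ∀ s ∈ X.S, ∀ x ∈ Δ, ∀ y ∈ Δ, (x, y) ∈ s →
      ∃ x' ∈ Δ, ∃ y' ∈ Δ, π x' = f (π x) ∧ π y' = f (π y) ∧ (x', y') ∈ s := by
  have hm : ∀ s ∈ X.S, ∀ x ∈ Δ, ∀ y ∈ Δ, (x, y) ∈ s → pushRel Δ π s ∈ Y.S ∧ (π x, π y) ∈ pushRel Δ π s := by
    intro s hs x hx y hy h
    have : (π x, π y) ∈ pushRel Δ π s := ⟨x, hx, y, hy, rfl, rfl, h⟩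
    exact ⟨by rw [hY]; exact ⟨s, hs, rfl, ⟨_, this⟩⟩, this⟩
  obtain ⟨h2, h3⟩ := hm s hs x hx y hy h
  obtain ⟨h4, h5⟩ := hm s hs x1 hx1 y1 hy1 h1
  obtain ⟨f, ⟨hf1, hf2⟩, hf3⟩ := hsch _ h2 _ h3 _ h5
  simp only [Prod.mk.injEq] at hf3
  refine ⟨f, hf1, hf3.1, hf3.2, ?_⟩
  intro s hs x hx y hy h
  obtain ⟨h2, h3⟩ := hm s hs x hx y hy h
  have : (f (π x), f (π y)) ∈ pushRel Δ π s := by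
    rw [← hf2 _ h2]
    exact ⟨_, h3, rfl⟩
  obtain ⟨x', hx', y', hy', e1, e2, h4⟩ := this
  exact ⟨x', hx', y', hy', e1, e2, h4⟩

end aut

section group
variable {G : Type u} [CommGroup G] {X : CohCfg G}

/-- maps preserving all `K`-saturated relations on `H` -/
def PA (X : CohCfg G) (H K : Subgroup G) (F : G → G) : Prop :=
  (∀ x ∈ H, F x ∈ H) ∧ ∀ ρ, IsRelationOf X ρ → Sat K ρ → ∀ x ∈ H, ∀ y ∈ H, (x, y) ∈ ρ → (F x, F y) ∈ ρ

def NI (X : CohCfg G) (H K : Subgroup G) : Prop :=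
  ∀ F, PA X H K F → F 1 ∈ K → ∀ x ∈ H, ∀ y ∈ H, (F x * F y)⁻¹ * F (x * y) ∈ K

def SI (X : CohCfg G) (H K : Subgroup G) : Prop :=
  ∀ s ∈ X.S, ∀ x ∈ H, ∀ y ∈ H, (1, x) ∈ s → (1, y) ∈ s → ∃ F, PA X H K F ∧ F 1 ∈ K ∧ y⁻¹ * F x ∈ K

theorem algP_id {ρ : Set (G × G)} (h : IsRelationOf X ρ) : algP X id ρ ρ := by
  have h1 := (isAlgIso_id X).algP_algImage h
  have h2 : algImage X id ρ = ρ := by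
    ext p
    constructor
    · rintro ⟨_, ⟨t, ⟨ht, hs⟩, rfl⟩, hp⟩
      exact hs hp
    · intro hp
      obtain ⟨t, ht, hpt⟩ := X.cover p
      exact ⟨t, ⟨t, ⟨ht, h t ht ⟨p, hpt, hp⟩⟩, rfl⟩, hpt⟩
  rwa [h2] at h1

theorem fib_HK {H K : Subgroup G} (hKH : K ≤ H) :
    Fib (H : Set G) (eRelSet H) (eRelSet K) (secπ (H : Set G) (eRelSet K) 1 H.one_mem) (Nat.card K) :=
  fib_sec (eqv_eRelSet K) (cls_eRelSet H) (eRelSet_mono hKH) (fun x _ => card_eRelSet K x) 1 H.one_mem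

theorem exists_secHK [Finite G] (hs : IsScheme X) (hsq : SesquiclosedIso X X id) {H K : Subgroup G}
    (hH : IsRelationOf X (eRelSet H)) (hK : IsRelationOf X (eRelSet K)) (hKH : K ≤ H) :
    ∃ Y, IsSectionCfg X (H : Set G) (eRelSet K) Y ∧
      Y.S = {t | ∃ s ∈ X.S, t = pushRel (H : Set G) (secπ (H : Set G) (eRelSet K) 1 H.one_mem) s ∧ t.Nonempty} := by
  obtain ⟨Y, Y', ψ, hY, _⟩ := sec_sesqui (isAlgIso_id X) (fun α _ α' _ => hsq.ext_all hs α α')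
    (fib_HK hKH) (fib_HK hKH) Nat.card_pos ⟨1, H.one_mem⟩ ⟨1, H.one_mem⟩ (algP_id hH) (algP_id hK)
  refine ⟨Y, ?_, hY⟩
  unfold IsSectionCfg
  rw [hY]
  simp only [secRel_eq (eqv_eRelSet K) (cls_eRelSet H) (eRelSet_mono hKH) 1 H.one_mem]

theorem ni_of_normal [Finite G] (hs : IsScheme X) (hsq : SesquiclosedIso X X id) {H K : Subgroup G}
    (hH : IsRelationOf X (eRelSet H)) (hK : IsRelationOf X (eRelSet K)) (hKH : K ≤ H)
    (hn : ∀ Y : CohCfg (Sec (H : Set G) (eRelSet K)),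
         IsSectionCfg X (H : Set G) (eRelSet K) Y → IsNormalSec (H : Set G) (eRelSet K) Y) : NI X H K := by
  obtain ⟨Y, hY1, hY⟩ := exists_secHK hs hsq hH hK hKH
  have hn := hn Y hY1
  intro F hF hF1 x hx y hy
  set π := secπ (H : Set G) (eRelSet K) 1 H.one_mem with hπ
  have hfib := fib_HK hKH
  rw [← hπ] at hfib
  choose r hr1 hr2 using hfib.surj
  have hker : ∀ a ∈ H, ∀ b ∈ H, (π a = π b ↔ π (F a) = π (F b)) := by
    intro a ha b hb
    rw [hfib.ker a ha b hb, hfib.ker _ (hF.1 a ha) _ (hF.1 b hb)]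
    constructor
    · exact hF.2 _ hK (sat_eRelSet le_rfl) a ha b hb
    · intro h
      by_contra h'
      exact hF.2 _ ((rel_closed X).compl _ hK) (sat_eRelSet le_rfl).compl a ha b hb h' h
  let E : Sec (H : Set G) (eRelSet K) → Sec (H : Set G) (eRelSet K) := fun q => π (F (r q))
  have hE : ∀ a ∈ H, E (π a) = π (F a) := fun a ha => (hker _ (hr1 _) a ha).mp (hr2 _)
  have hinj : Function.Injective E := by
    intro q q' h
    have := (hker _ (hr1 q) _ (hr1 q')).mpr h
    rwa [hr2, hr2] at this
  have hbij : Function.Bijective E := Finite.injective_iff_bijective.mp hinj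
  have hpres : ∀ t ∈ Y.S, relImage E t = t := by
    intro t ht
    rw [hY] at ht
    obtain ⟨s, hs, rfl, -⟩ := ht
    apply Set.eq_of_subset_of_ncard_le
    · rintro _ ⟨⟨_, _⟩, ⟨a, ha, b, hb, rfl, rfl, hab⟩, rfl⟩
      simp only
      rw [hE a ha, hE b hb]
      obtain ⟨w, ⟨w', h1, h2⟩, h3⟩ := hF.2 _ (satn_rel hK (isRel_basic X hs)) (satn_sat K s) a ha b hb
        (subset_satn K s hab)
      simp only at h1 h2 h3
      have hw' : w' ∈ (H : Set G) := (cls_eRelSet H _ (hF.1 a ha) _).mp (hfib.sub h1)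
      have hw : w ∈ (H : Set G) :=
        (cls_eRelSet H _ (hF.1 b hb) _).mp ((eqv_eRelSet H).symm _ _ (hfib.sub h3))
      exact ⟨w', hw', w, hw, ((hfib.ker _ (hF.1 a ha) _ hw').mpr h1).symm,
        (hfib.ker _ hw _ (hF.1 b hb)).mpr h3, h2⟩
    · unfold relImage
      rw [Set.ncard_image_of_injective]
      rintro ⟨a, b⟩ ⟨a', b'⟩ h
      simp only [Prod.mk.injEq] at h
      rw [hinj h.1, hinj h.2]
    · exact Set.toFinite _
  have hval : ∀ a ∈ H, (π a).1 = eClass (eRelSet K) a := fun a ha => secπ_val ha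
  have := hn E hbij hpres ?_ (π x) (π y) (π (x * y)) ?_
  · rw [hE x hx, hE y hy, hE _ (H.mul_mem hx hy), hval _ (hF.1 _ (H.mul_mem hx hy)), hval _ (hF.1 x hx),
      hval _ (hF.1 y hy)] at this
    have h2 : F x * F y ∈ eClass (eRelSet K) (F (x * y)) := by
      rw [this]
      exact ⟨F x, (eqv_eRelSet K).refl _, F y, (eqv_eRelSet K).refl _, rfl⟩
    exact (eqv_eRelSet K).symm _ _ h2
  · intro q hq
    obtain ⟨a, ha, rfl⟩ := hfib.surj q
    rw [hval a ha] at hq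
    have : π a = π 1 := (hfib.ker a ha 1 H.one_mem).mpr hq
    rw [this, hE 1 H.one_mem]
    exact (hfib.ker _ (hF.1 1 H.one_mem) 1 H.one_mem).mpr (by simpa [eRelSet] using hF1)
  · rw [hval _ hx, hval _ hy, hval _ (H.mul_mem hx hy)]
    ext w
    constructor
    · intro (hw : (x * y)⁻¹ * w ∈ K)
      refine ⟨x, (eqv_eRelSet K).refl _, x⁻¹ * w, ?_, by simp⟩
      show y⁻¹ * (x⁻¹ * w) ∈ K
      rwa [← mul_assoc, mul_comm y⁻¹ x⁻¹, ← mul_inv]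
    · rintro ⟨a, (ha : x⁻¹ * a ∈ K), b, (hb : y⁻¹ * b ∈ K), rfl⟩
      show (x * y)⁻¹ * (a * b) ∈ K
      have := K.mul_mem ha hb
      rwa [mul_mul_mul_comm, ← mul_inv] at this

/-- the section of the whole group -/
theorem fib_univ (L : Subgroup G) :
    Fib (Set.univ : Set G) Set.univ (eRelSet L) (secπ (Set.univ : Set G) (eRelSet L) 1 trivial) (Nat.card L) :=
  fib_sec (eqv_eRelSet L) (fun _ _ _ => by simp) (Set.subset_univ _) (fun x _ => card_eRelSet L x) 1 (Set.mem_univ _)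

theorem isSectionCfg_univ {L : Subgroup G} {Y : CohCfg (Sec (Set.univ : Set G) (eRelSet L))}
    (hY : Y.S = {t | ∃ s ∈ X.S, t = pushRel (Set.univ : Set G) (secπ (Set.univ : Set G) (eRelSet L) 1 trivial) s ∧ t.Nonempty}) :
    IsSectionCfg X Set.univ (eRelSet L) Y := by
  unfold IsSectionCfg
  rw [hY]
  have : ∀ s, secRel (Set.univ : Set G) (eRelSet L) s = pushRel Set.univ (secπ Set.univ (eRelSet L) 1 trivial) s :=
    fun s => secRel_eq (d := Set.univ) (eqv_eRelSet L) (fun _ _ _ => by simp) (Set.subset_univ _) 1 (Set.mem_univ _) s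
  simp only [this]

theorem isRestrictionCfg_U {U : Subgroup G} {Y : CohCfg ↥(U : Set G)}
    (hY : Y.S = {t | ∃ s ∈ X.S, t = pushRel (U : Set G) (restπ (U : Set G) 1 U.one_mem) s ∧ t.Nonempty}) :
    IsRestrictionCfg X (U : Set G) Y := by
  unfold IsRestrictionCfg
  rw [hY]
  simp only [restRel_eq (Δ := (U : Set G)) 1 U.one_mem]

theorem fib_U (U : Subgroup G) :
    Fib (U : Set G) (eRelSet U) {p | p.1 = p.2} (restπ (U : Set G) 1 U.one_mem) 1 :=
  fib_rest (cls_eRelSet U) (eqv_eRelSet U).refl 1 U.one_mem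

/-- automorphisms of `X_U` -/
def Aut1 (X : CohCfg G) (U : Subgroup G) (F : G → G) : Prop :=
  Set.BijOn F U U ∧ ∀ s ∈ X.S, ∀ u ∈ U, ∀ v ∈ U, (u, v) ∈ s → (F u, F v) ∈ s

theorem Aut1.pa {U K : Subgroup G} {F : G → G} (h : Aut1 X U F) : PA X U K F := by
  refine ⟨fun x hx => h.1.mapsTo hx, ?_⟩
  intro ρ hρ _ x hx y hy hxy
  obtain ⟨s, hs, hp⟩ := X.cover (x, y)
  exact hρ s hs ⟨_, hp, hxy⟩ (h.2 s hs x hx y hy hp)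

theorem exists_aut1 [Finite G] (hs : IsScheme X) (hsq : SesquiclosedIso X X id) {U : Subgroup G}
    (hU : IsRelationOf X (eRelSet U))
    (h2b : ∀ X1 : CohCfg ↥(U : Set G), IsRestrictionCfg X (U : Set G) X1 → Schurian X1 ∧ Sesquiseparable X1)
    {s} (hsX : s ∈ X.S) {x y x1 y1 : G} (hx : x ∈ U) (hy : y ∈ U) (hx1 : x1 ∈ U) (hy1 : y1 ∈ U)
    (h : (x, y) ∈ s) (h1 : (x1, y1) ∈ s) : ∃ F, Aut1 X U F ∧ F x = x1 ∧ F y = y1 := by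
  obtain ⟨Y, Y', ψ, hY, _⟩ := sec_sesqui (isAlgIso_id X) (fun α _ α' _ => hsq.ext_all hs α α')
    (fib_U U) (fib_U U) one_pos ⟨1, U.one_mem⟩ ⟨1, U.one_mem⟩ (algP_id hU) (isAlgIso_id X).bi.diag
  obtain ⟨f, hf, e1, e2, h3⟩ := sec_aut hY (h2b Y (isRestrictionCfg_U hY)).1 hsX hx hy hx1 hy1 h h1
  set π := restπ (U : Set G) 1 U.one_mem with hπ
  have hv : ∀ a ∈ U, (π a).1 = a := fun a ha => restπ_val ha
  have hv' : ∀ q, π q.1 = q := fun q => Subtype.ext (hv _ q.2)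
  refine ⟨fun a => (f (π a)).1, ⟨⟨?_, ?_, ?_⟩, ?_⟩, ?_, ?_⟩
  · intro a _; exact (f (π a)).2
  · intro a ha b hb hab
    have := congrArg Subtype.val (hf.1 (Subtype.ext hab))
    rwa [hv a ha, hv b hb] at this
  · intro b hb
    obtain ⟨q, hq⟩ := hf.2 ⟨b, hb⟩
    refine ⟨q.1, q.2, ?_⟩
    simp only [hv', hq]
  · intro s hs u hu v hv2 huv
    obtain ⟨x', hx', y', hy', e1, e2, h4⟩ := h3 s hs u hu v hv2 huv
    simp only
    rw [← e1, ← e2, hv _ hx', hv _ hy']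
    exact h4
  · simp only [e1]; exact hv _ hx1
  · simp only [e2]; exact hv _ hy1

theorem si_U [Finite G] (hs : IsScheme X) (hsq : SesquiclosedIso X X id) {U : Subgroup G}
    (hU : IsRelationOf X (eRelSet U))
    (h2b : ∀ X1 : CohCfg ↥(U : Set G), IsRestrictionCfg X (U : Set G) X1 → Schurian X1 ∧ Sesquiseparable X1)
    (N : Subgroup G) : SI X U N := by
  intro s hsX x hx y hy h h'
  obtain ⟨F, hF, h1, h2⟩ := exists_aut1 hs hsq hU h2b hsX U.one_mem hx U.one_mem hy h h'
  refine ⟨F, hF.pa, ?_, ?_⟩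
  · rw [h1]; exact N.one_mem
  · rw [h2, inv_mul_cancel]; exact N.one_mem

/-- automorphisms of `X_{G/L}` -/
theorem exists_aut0 [Finite G] (hs : IsScheme X) (hsq : SesquiclosedIso X X id) {L : Subgroup G}
    (hL : IsRelationOf X (eRelSet L))
    (h2a : ∀ Y0 : CohCfg (Sec (univ : Set G) (eRelSet L)),
       IsSectionCfg X univ (eRelSet L) Y0 → Schurian Y0 ∧ Sesquiseparable Y0)
    {s} (hsX : s ∈ X.S) {x y x1 y1 : G} (h : (x, y) ∈ s) (h1 : (x1, y1) ∈ s) :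
    ∃ F : G → G, (∀ ρ, IsRelationOf X ρ → Sat L ρ → ∀ x y, (x, y) ∈ ρ → (F x, F y) ∈ ρ) ∧
      x1⁻¹ * F x ∈ L ∧ y1⁻¹ * F y ∈ L := by
  obtain ⟨Y, Y', ψ, hY, _⟩ := sec_sesqui (isAlgIso_id X) (fun α _ α' _ => hsq.ext_all hs α α')
    (fib_univ L) (fib_univ L) Nat.card_pos ⟨1, trivial⟩ ⟨1, trivial⟩ (isAlgIso_id X).bi.univ (algP_id hL)
  obtain ⟨f, hf, e1, e2, h3⟩ := sec_aut hY (h2a Y (isSectionCfg_univ hY)).1 hsX trivial trivial trivial trivial h h1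
  have hfib := fib_univ L
  set π := secπ (Set.univ : Set G) (eRelSet L) 1 trivial with hπ
  choose r hr1 hr2 using hfib.surj
  refine ⟨fun a => r (f (π a)), ?_, ?_, ?_⟩
  · intro ρ hρ hsat x y hxy
    obtain ⟨s, hs, hp⟩ := X.cover (x, y)
    obtain ⟨x', _, y', _, e1, e2, h4⟩ := h3 s hs x trivial y trivial hp
    refine hsat x' y' _ _ (hρ s hs ⟨_, hp, hxy⟩ h4) ?_ ?_
    · exact (hfib.ker _ trivial _ trivial).mp (by rw [hr2, e1])
    · exact (hfib.ker _ trivial _ trivial).mp (by rw [hr2, e2])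
  · exact (hfib.ker _ trivial _ trivial).mp (by rw [hr2, e1])
  · exact (hfib.ker _ trivial _ trivial).mp (by rw [hr2, e2])

theorem si_M [Finite G] (hs : IsScheme X) (hsq : SesquiclosedIso X X id) {M L : Subgroup G}
    (hL : IsRelationOf X (eRelSet L)) (hM : IsRelationOf X (eRelSet M)) (hLM : L ≤ M)
    (h2a : ∀ Y0 : CohCfg (Sec (univ : Set G) (eRelSet L)),
       IsSectionCfg X univ (eRelSet L) Y0 → Schurian Y0 ∧ Sesquiseparable Y0) : SI X M L := by
  intro s hsX x _ y _ h h'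
  obtain ⟨F, hF, h1, h2⟩ := exists_aut0 hs hsq hL h2a hsX h h'
  have h1 : F 1 ∈ L := by simpa using h1
  refine ⟨F, ⟨?_, fun ρ h1 h2 x _ y _ h => hF ρ h1 h2 x y h⟩, h1, h2⟩
  intro a ha
  have := hF _ hM (sat_eRelSet hLM) 1 a (by simpa [eRelSet] using ha)
  exact (cls_eRelSet M _ (hLM h1) _).mp this

end group
end Circ

namespace Circ
open CohCfg

section group
variable {G : Type u} [CommGroup G] {X : CohCfg G}

/-- `π` is a homomorphism of `H` onto `ZMod n` with kernel `K` -/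
structure Pi (H K : Subgroup G) (n : ℕ) (π : G → ZMod n) : Prop where
  add : ∀ x ∈ H, ∀ y ∈ H, π (x * y) = π x + π y
  ker : ∀ x ∈ H, π x = 0 ↔ x ∈ K
  surj : ∀ q, ∃ x ∈ H, π x = q

theorem exists_pi [Finite G] [IsCyclic G] {H K : Subgroup G} :
    ∃ n : ℕ, NeZero n ∧ ∃ π : G → ZMod n, Pi H K n π := by
  classical
  let Q := H ⧸ K.subgroupOf H
  have hQ : IsCyclic Q := isCyclic_of_surjective (QuotientGroup.mk' (K.subgroupOf H))
    (QuotientGroup.mk'_surjective _)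
  let E := (zmodCyclicMulEquiv hQ).symm
  refine ⟨Nat.card Q, ⟨Nat.card_pos.ne'⟩,
    fun x => if h : x ∈ H then Multiplicative.toAdd (E (QuotientGroup.mk ⟨x, h⟩)) else 0, ?_, ?_, ?_⟩
  · intro x hx y hy
    simp only [dif_pos hx, dif_pos hy, dif_pos (H.mul_mem hx hy)]
    rw [← toAdd_mul, ← map_mul]
    rfl
  · intro x hx
    simp only [dif_pos hx]
    rw [toAdd_eq_zero, EmbeddingLike.map_eq_one_iff, QuotientGroup.eq_one_iff]
    rfl
  · intro q
    obtain ⟨⟨x, hx⟩, h⟩ := QuotientGroup.mk_surjective (E.symm (Multiplicative.ofAdd q))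
    refine ⟨x, hx, ?_⟩
    simp only [dif_pos hx, h]
    simp

variable {H K : Subgroup G} {n : ℕ} {π : G → ZMod n}

theorem Pi.one (h : Pi H K n π) : π 1 = 0 := by
  have := h.add 1 H.one_mem 1 H.one_mem
  simpa using this

theorem Pi.pow (h : Pi H K n π) {x} (hx : x ∈ H) (k : ℕ) : π (x ^ k) = k * π x := by
  induction k with
  | zero => simp [h.one]
  | succ k ih =>
    rw [pow_succ, h.add _ (H.pow_mem hx k) _ hx, ih]
    push_cast; ring

theorem Pi.inv_mul (h : Pi H K n π) {x y} (hx : x ∈ H) (hy : y ∈ H) : π (x⁻¹ * y) = π y - π x := by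
  have := h.add x hx (x⁻¹ * y) (H.mul_mem (H.inv_mem hx) hy)
  rw [mul_inv_cancel_left] at this
  rw [this]; ring

theorem Pi.eq_iff (h : Pi H K n π) {x y} (hx : x ∈ H) (hy : y ∈ H) : π x = π y ↔ x⁻¹ * y ∈ K := by
  rw [← h.ker _ (H.mul_mem (H.inv_mem hx) hy), h.inv_mul hx hy, sub_eq_zero, eq_comm]

theorem Pi.fib (h : Pi H K n π) (hKH : K ≤ H) :
    Fib (H : Set G) (eRelSet H) (eRelSet K) π (Nat.card K) :=
  fib_mk (cls_eRelSet H) (fun _ hx _ hy => h.eq_iff hx hy) (eRelSet_mono hKH) h.surj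
    (fun x _ => card_eRelSet K x)

/-- the multipliers preserving all saturated relations -/
def mulA (X : CohCfg G) (h : Pi H K n π) : Subgroup (ZMod n)ˣ where
  carrier := {a | ∀ ρ, IsRelationOf X ρ → Sat K ρ → ∀ x ∈ H, ∀ y ∈ H, ∀ x1 ∈ H, ∀ y1 ∈ H,
    π x1 = a * π x → π y1 = a * π y → (x, y) ∈ ρ → (x1, y1) ∈ ρ}
  mul_mem' := by
    intro a b ha hb ρ hρ hs x hx y hy x1 hx1 y1 hy1 e1 e2 hxy
    obtain ⟨x2, hx2, e3⟩ := h.surj (b * π x)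
    obtain ⟨y2, hy2, e4⟩ := h.surj (b * π y)
    refine ha ρ hρ hs x2 hx2 y2 hy2 x1 hx1 y1 hy1 ?_ ?_ (hb ρ hρ hs x hx y hy x2 hx2 y2 hy2 e3 e4 hxy)
    · rw [e1, e3, Units.val_mul, mul_assoc]
    · rw [e2, e4, Units.val_mul, mul_assoc]
  one_mem' := by
    intro ρ hρ hs x hx y hy x1 hx1 y1 hy1 e1 e2 hxy
    rw [Units.val_one, one_mul] at e1 e2
    exact hs x y x1 y1 hxy ((h.eq_iff hx hx1).mp e1.symm) ((h.eq_iff hy hy1).mp e2.symm)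
  inv_mem' := by
    intro a ha ρ hρ hs x hx y hy x1 hx1 y1 hy1 e1 e2 hxy
    by_contra hne
    refine ha ρᶜ ((rel_closed X).compl _ hρ) hs.compl x1 hx1 y1 hy1 x hx y hy ?_ ?_ hne hxy
    · rw [e1, Units.mul_inv_cancel_left]
    · rw [e2, Units.mul_inv_cancel_left]

theorem mulA_norm (hc : IsCirculant X) (h : Pi H K n π) (hni : NI X H K) :
    NormA (mulA X h) := by
  intro F hF hF0 hFA
  choose r hr1 hr2 using h.surj
  have hpa : PA X H K (fun x => r (F (π x))) := by
    refine ⟨fun x _ => hr1 _, ?_⟩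
    intro ρ hρ hs x hx y hy hxy
    obtain ⟨a, ha, e⟩ := hFA (π x) (π y)
    rw [← trans_one hc hρ] at hxy ⊢
    refine ha ρ hρ hs 1 H.one_mem (x⁻¹ * y) (H.mul_mem (H.inv_mem hx) hy) 1 H.one_mem _
      (H.mul_mem (H.inv_mem (hr1 _)) (hr1 _)) ?_ ?_ hxy
    · rw [h.one, mul_zero]
    · rw [h.inv_mul (hr1 _) (hr1 _), h.inv_mul hx hy, hr2, hr2, e]
  have h1 := hni _ hpa (by
    rw [← h.ker _ (hr1 _), hr2, h.one, hF0])
  intro x y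
  have := h1 (r x) (hr1 _) (r y) (hr1 _)
  rw [← h.eq_iff (H.mul_mem (hr1 _) (hr1 _)) (hr1 _), h.add _ (hr1 _) _ (hr1 _), hr2, hr2, hr2,
    h.add _ (hr1 _) _ (hr1 _), hr2, hr2] at this
  simp only [hr2] at this
  exact this.symm

theorem NI.pow (hni : NI X H K) {F : G → G} (hF : PA X H K F) (h1 : F 1 ∈ K) {x} (hx : x ∈ H) (k : ℕ) :
    (F x ^ k)⁻¹ * F (x ^ k) ∈ K := by
  induction k with
  | zero => simpa using h1
  | succ k ih =>
    have h2 := hni F hF h1 _ (H.pow_mem hx k) x hx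
    have := K.mul_mem ih h2
    rw [pow_succ, pow_succ]
    convert this using 1
    rw [mul_inv, mul_inv]
    group

theorem mulA_orb (hc : IsCirculant X) (h : Pi H K n π) [NeZero n] (hKH : K ≤ H)
    (hK : IsRelationOf X (eRelSet K)) (hni : NI X H K)
    (hsi : SI X H K) {x : G} (hx : x ∈ H) {s} (hs : s ∈ X.S) (hxs : (1, x) ∈ s) :
    orb (mulA X h) (π x) = pushRel (H : Set G) π s := by
  have hss := isRel_basic X hs
  ext ⟨p, q⟩
  constructor
  · rintro ⟨a, ha, e⟩
    obtain ⟨u, hu, rfl⟩ := h.surj p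
    obtain ⟨v, hv, rfl⟩ := h.surj q
    simp only at e
    have hr := satn_rel hK hss
    have h1 := ha _ hr (satn_sat K s) 1 H.one_mem x hx 1 H.one_mem (u⁻¹ * v)
      (H.mul_mem (H.inv_mem hu) hv) (by rw [h.one, mul_zero]) (by rw [h.inv_mul hu hv, e]) (subset_satn K s hxs)
    rw [trans_one hc hr] at h1
    obtain ⟨w, ⟨w', h2, h3⟩, h4⟩ := h1
    have hf := h.fib hKH
    have hw' : w' ∈ (H : Set G) := (cls_eRelSet H _ hu _).mp (hf.sub h2)
    have hw : w ∈ (H : Set G) := (cls_eRelSet H _ hv _).mp ((eqv_eRelSet H).symm _ _ (hf.sub h4))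
    exact ⟨w', hw', w, hw, ((hf.ker _ hu _ hw').mpr h2).symm, (hf.ker _ hw _ hv).mpr h4, h3⟩
  · rintro ⟨u, hu, v, hv, rfl, rfl, huv⟩
    rw [← trans_one hc hss] at huv
    have huv' := H.mul_mem (H.inv_mem hu) hv
    obtain ⟨F, hF, hF1, hFx⟩ := hsi s hs x hx _ huv' hxs huv
    obtain ⟨g, hg, hg1⟩ := h.surj 1
    have hmul : ∀ y ∈ H, π (F y) = π (F g) * π y := by
      intro y hy
      have e1 : π y = π (g ^ (π y).val) := by
        rw [h.pow hg, hg1, mul_one, ZMod.natCast_zmod_val]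
      have e2 : π (F y) = π (F (g ^ (π y).val)) := by
        rw [h.eq_iff (hF.1 _ hy) (hF.1 _ (H.pow_mem hg _))]
        rw [h.eq_iff hy (H.pow_mem hg _)] at e1
        exact hF.2 _ hK (sat_eRelSet le_rfl) _ hy _ (H.pow_mem hg _) e1
      have e3 := hni.pow hF hF1 hg (π y).val
      rw [← h.eq_iff (H.pow_mem (hF.1 _ hg) _) (hF.1 _ (H.pow_mem hg _)), h.pow (hF.1 _ hg),
        ZMod.natCast_zmod_val] at e3
      rw [e2, ← e3, mul_comm]
    have hunit : IsUnit (π (F g)) := by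
      have hinj : Function.Injective (fun b : ZMod n => π (F g) * b) := by
        intro b b' hb
        obtain ⟨y, hy, rfl⟩ := h.surj b
        obtain ⟨y', hy', rfl⟩ := h.surj b'
        simp only at hb
        rw [← hmul y hy, ← hmul y' hy', h.eq_iff (hF.1 _ hy) (hF.1 _ hy')] at hb
        rw [h.eq_iff hy hy']
        by_contra hne
        exact hF.2 _ ((rel_closed X).compl _ hK) (sat_eRelSet le_rfl).compl _ hy _ hy' hne hb
      obtain ⟨b, hb⟩ := (Finite.injective_iff_surjective.mp hinj) 1
      exact IsUnit.of_mul_eq_one b hb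
    obtain ⟨a, ha⟩ := hunit
    refine ⟨a, ?_, ?_⟩
    · intro ρ hρ hsat x hx y hy x1 hx1 y1 hy1 e1 e2 hxy
      refine hsat _ _ _ _ (hF.2 ρ hρ hsat x hx y hy hxy) ?_ ?_
      · rw [← h.eq_iff (hF.1 _ hx) hx1, e1, hmul x hx, ha]
      · rw [← h.eq_iff (hF.1 _ hy) hy1, e2, hmul y hy, ha]
    · simp only
      rw [ha, ← hmul x hx, ← h.inv_mul hu hv]
      exact (h.eq_iff huv' (hF.1 _ hx)).mpr hFx

end group
end Circ

namespace Circ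
open CohCfg

section kap
variable {G : Type u} [CommGroup G] {X : CohCfg G} {Ω' : Type u} {X' : CohCfg Ω'}
  {φ : Set (G × G) → Set (Ω' × Ω')}

structure Kap (X : CohCfg G) (φ : Set (G × G) → Set (Ω' × Ω')) (L : Subgroup G) (κ : Ω' → G) : Prop where
  k1 : ∀ x, ∃ x', x⁻¹ * κ x' ∈ L
  k3 : ∀ ρ ρ', algP X φ ρ ρ' → Sat L ρ → ∀ x' y', (κ x', κ y') ∈ ρ ↔ (x', y') ∈ ρ'

theorem Kap.translate {L : Subgroup G} {κ : Ω' → G} (h : Kap X φ L κ) (hc : IsCirculant X)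
    (hφ : IsAlgIso X X' φ) (g : G) : Kap X φ L (fun x' => κ x' * g) := by
  constructor
  · intro x
    obtain ⟨x', hx'⟩ := h.k1 (x * g⁻¹)
    refine ⟨x', ?_⟩
    convert hx' using 1
    rw [mul_inv, inv_inv]
    simp only [mul_assoc, mul_comm, mul_left_comm]
  · intro ρ ρ' hρ hs x' y'
    rw [trans_rel hc (hφ.rel_of_algP hρ)]
    exact h.k3 ρ ρ' hρ hs x' y'

theorem Eqv.cls {e : Set (Ω' × Ω')} (hE : Eqv e) (a : Ω') : ∀ x ∈ eClass e a, ∀ y, (x, y) ∈ e ↔ y ∈ eClass e a :=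
  fun _ hx _ => ⟨fun h => hE.trans _ _ _ hx h, fun h => hE.trans _ _ _ (hE.symm _ _ hx) h⟩

theorem sat_transport [Finite G] [Finite Ω'] (hφ : IsAlgIso X X' φ) {L : Subgroup G} {e' ρ ρ'}
    (he : algP X φ (eRelSet L) e')
    (hρ : algP X φ ρ ρ') (hs : Sat L ρ) {x y a b : Ω'} (h : (x, y) ∈ ρ') (h1 : (a, x) ∈ e') (h2 : (y, b) ∈ e') :
    (a, b) ∈ ρ' := by
  have h3 := hφ.bi.comp (hφ.bi.comp he hρ) he
  have h4 := (hφ.bi.subset_iff hφ.faithful h3 hρ).mp (by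
    rintro ⟨p, q⟩ ⟨w, ⟨z, h5, h6⟩, h7⟩
    simp only at h5 h6 h7
    exact hs _ _ _ _ h6 ((eqv_eRelSet L).symm _ _ h5) h7)
  exact h4 ⟨y, ⟨x, h1, h⟩, h2⟩

theorem exists_kap [Finite G] [Finite Ω'] (hs : IsScheme X) (hφ : SesquiclosedIso X X' φ)
    {L : Subgroup G} (hL : IsRelationOf X (eRelSet L))
    (h2a : ∀ Y0 : CohCfg (Sec (univ : Set G) (eRelSet L)),
       IsSectionCfg X univ (eRelSet L) Y0 → Schurian Y0 ∧ Sesquiseparable Y0) : ∃ κ, Kap X φ L κ := by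
  have hA := hφ.1
  obtain ⟨e', he⟩ : ∃ e', algP X φ (eRelSet L) e' := ⟨_, hA.algP_algImage hL⟩
  have hE := hA.bi.eqv hA.faithful he (eqv_eRelSet L)
  obtain ⟨⟨a', _⟩, -⟩ := hA.exr ((1 : G), (1 : G))
  have hF' : Fib (Set.univ : Set Ω') Set.univ e' (secπ (Set.univ : Set Ω') e' a' trivial) (Nat.card L) :=
    fib_sec hE (fun _ _ _ => by simp) (Set.subset_univ _)
      (fun x _ => hA.bi.card_class hA.faithful he (eqv_eRelSet L) (card_eRelSet L) x) a' (Set.mem_univ _)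
  have hF := fib_univ L
  obtain ⟨Y, Y', ψ, hY, hψ, hψ'⟩ := sec_sesqui hA (fun α _ α' _ => hφ.ext_all hs α α')
    hF hF' Nat.card_pos ⟨1, trivial⟩ ⟨a', trivial⟩ hA.bi.univ he
  obtain ⟨f, hf, h3⟩ := sec_iso hY hψ hψ' (h2a Y (isSectionCfg_univ hY)).2
  set π := secπ (Set.univ : Set G) (eRelSet L) 1 trivial with hπ
  set π' := secπ (Set.univ : Set Ω') e' a' trivial with hπ'
  have hex : ∀ x', ∃ x, f (π x) = π' x' := by
    intro x'
    obtain ⟨q, hq⟩ := hf.2 (π' x')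
    obtain ⟨x, -, hx⟩ := hF.surj q
    exact ⟨x, by rw [hx, hq]⟩
  choose κ hκ using hex
  have hk : ∀ ρ ρ', algP X φ ρ ρ' → Sat L ρ → ∀ x' y', (κ x', κ y') ∈ ρ → (x', y') ∈ ρ' := by
    intro ρ ρ' hρ hsat x' y' h
    obtain ⟨s, hs, hp⟩ := X.cover (κ x', κ y')
    obtain ⟨u, _, v, _, e1, e2, h4⟩ := h3 s hs _ trivial _ trivial hp
    have h5 : (u, v) ∈ ρ' :=
      (hA.bi.subset_iff hA.faithful (hA.algP_basic hs) hρ).mp (hA.rel_of_algP hρ s hs ⟨_, hp, h⟩) h4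
    rw [hκ] at e1 e2
    exact sat_transport hA he hρ hsat h5 ((hF'.ker _ trivial _ trivial).mp e1.symm)
      ((hF'.ker _ trivial _ trivial).mp e2)
  refine ⟨κ, ?_, ?_⟩
  · intro x
    obtain ⟨x', -, hx'⟩ := hF'.surj (f (π x))
    refine ⟨x', ?_⟩
    have := hf.1 ((hκ x').trans hx')
    exact (hF.ker _ trivial _ trivial).mp this.symm
  · intro ρ ρ' hρ hsat x' y'
    refine ⟨hk ρ ρ' hρ hsat x' y', ?_⟩
    intro h
    by_contra hne
    exact hk _ _ (hA.bi.compl _ _ hρ) hsat.compl x' y' hne h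

theorem kap_of_aut [Finite G] {L : Subgroup G} (hL : IsRelationOf X (eRelSet L)) {F : G → G}
    (hF : ∀ ρ, IsRelationOf X ρ → Sat L ρ → ∀ x y, (x, y) ∈ ρ → (F x, F y) ∈ ρ) : Kap X id L F := by
  have hk : ∀ ρ, IsRelationOf X ρ → Sat L ρ → ∀ x y, (F x, F y) ∈ ρ ↔ (x, y) ∈ ρ := by
    intro ρ hρ hs x y
    refine ⟨fun h => ?_, hF ρ hρ hs x y⟩
    by_contra hne
    exact hF _ ((rel_closed X).compl _ hρ) hs.compl x y hne h
  constructor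
  · have h1 : ∀ x y, (QuotientGroup.mk (F x) : G ⧸ L) = QuotientGroup.mk (F y) ↔
        (QuotientGroup.mk x : G ⧸ L) = QuotientGroup.mk y := by
      intro x y
      rw [QuotientGroup.eq, QuotientGroup.eq]
      exact hk _ hL (sat_eRelSet le_rfl) x y
    have hinj : Function.Injective (fun q : G ⧸ L => (QuotientGroup.mk (F q.out) : G ⧸ L)) := by
      intro q q' h
      have := (h1 _ _).mp h
      simpa using this
    intro x
    obtain ⟨q, hq⟩ := (Finite.injective_iff_surjective.mp hinj) (QuotientGroup.mk x)
    exact ⟨q.out, QuotientGroup.eq.mp hq.symm⟩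
  · intro ρ ρ' hρ hs x y
    have hr := (isAlgIso_id X).rel_of_algP hρ
    have := (isAlgIso_id X).bi.unique (isAlgIso_id X).faithful hρ (algP_id hr)
    rw [this]
    exact hk ρ hr hs x y

/-- local isomorphisms on `U` -/
def Loc (X : CohCfg G) (φ : Set (G × G) → Set (Ω' × Ω')) (U : Subgroup G) (f : G → Ω') : Prop :=
  ∀ s ∈ X.S, ∀ u ∈ U, ∀ v ∈ U, (u, v) ∈ s → (f u, f v) ∈ φ s

theorem Loc.iff {U : Subgroup G} {f : G → Ω'} (h : Loc X φ U f) (hφ : IsAlgIso X X' φ) {ρ ρ'}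
    (hρ : algP X φ ρ ρ') {u v} (hu : u ∈ U) (hv : v ∈ U) : (f u, f v) ∈ ρ' ↔ (u, v) ∈ ρ := by
  have key : ∀ ρ ρ', algP X φ ρ ρ' → (u, v) ∈ ρ → (f u, f v) ∈ ρ' := by
    intro ρ ρ' hρ h1
    obtain ⟨s, hs, hp⟩ := X.cover (u, v)
    exact (hφ.bi.subset_iff hφ.faithful (hφ.algP_basic hs) hρ).mp (hφ.rel_of_algP hρ s hs ⟨_, hp, h1⟩)
      (h s hs u hu v hv hp)
  refine ⟨fun h1 => ?_, key ρ ρ' hρ⟩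
  by_contra hne
  exact key _ _ (hφ.bi.compl _ _ hρ) hne h1

theorem Loc.bijOn [Finite G] [Finite Ω'] {U : Subgroup G} {f : G → Ω'} (h : Loc X φ U f) (hφ : IsAlgIso X X' φ) {d'}
    (hd : algP X φ (eRelSet U) d') : Set.BijOn f U (eClass d' (f 1)) := by
  have h1 : Set.MapsTo f U (eClass d' (f 1)) := fun u hu =>
    (h.iff hφ hd U.one_mem hu).mpr (by simpa [eRelSet] using hu)
  have h2 : Set.InjOn f U := by
    intro u hu v hv huv
    have := (h.iff hφ hφ.bi.diag hu hv).mp huv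
    exact this
  refine ⟨h1, h2, ?_⟩
  have h3 : f '' (U : Set G) = eClass d' (f 1) := by
    apply Set.eq_of_subset_of_ncard_le
    · exact h1.image_subset
    · rw [hφ.bi.card_class hφ.faithful hd (eqv_eRelSet U) (card_eRelSet U), h2.ncard_image]
      exact le_of_eq rfl
    · exact Set.toFinite _
  exact h3.ge

theorem exists_loc [Finite G] [Finite Ω'] (hs : IsScheme X) (hc : IsCirculant X) (hφ : SesquiclosedIso X X' φ)
    {U : Subgroup G} (hU : IsRelationOf X (eRelSet U))
    (h2b : ∀ X1 : CohCfg ↥(U : Set G), IsRestrictionCfg X (U : Set G) X1 → Schurian X1 ∧ Sesquiseparable X1)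
    (x' : Ω') : ∃ f, Loc X φ U f ∧ f 1 = x' := by
  have hA := hφ.1
  obtain ⟨d', hd⟩ : ∃ d', algP X φ (eRelSet U) d' := ⟨_, hA.algP_algImage hU⟩
  have hE := hA.bi.eqv hA.faithful hd (eqv_eRelSet U)
  have hx' : x' ∈ eClass d' x' := hE.refl x'
  have hF' : Fib (eClass d' x') d' {p | p.1 = p.2} (restπ (eClass d' x') x' hx') 1 :=
    fib_rest (hE.cls x') hE.refl x' hx'
  obtain ⟨Y, Y', ψ, hY, hψ, hψ'⟩ := sec_sesqui hA (fun α _ α' _ => hφ.ext_all hs α α')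
    (fib_U U) hF' one_pos ⟨1, U.one_mem⟩ ⟨x', hx'⟩ hd hA.bi.diag
  obtain ⟨f, hf, h3⟩ := sec_iso hY hψ hψ' (h2b Y (isRestrictionCfg_U hY)).2
  set π := restπ (U : Set G) 1 U.one_mem with hπ
  set π' := restπ (eClass d' x') x' hx' with hπ'
  have hv : ∀ a ∈ U, (π a).1 = a := fun a ha => restπ_val ha
  have hv1 : ∀ a ∈ eClass d' x', (π' a).1 = a := fun a ha => restπ_val ha
  obtain ⟨q, hq⟩ := hf.2 ⟨x', hx'⟩
  have hq' : π q.1 = q := Subtype.ext (hv _ q.2)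
  refine ⟨fun a => (f (π (a * q.1))).1, ?_, ?_⟩
  · intro s hs u hu v hv2 huv
    obtain ⟨x', hx', y', hy', e1, e2, h4⟩ := h3 s hs _ (U.mul_mem hu q.2) _ (U.mul_mem hv2 q.2)
      ((trans_basic hc hs q.1 u v).mpr huv)
    simp only
    rw [← e1, ← e2, hv1 _ hx', hv1 _ hy']
    exact h4
  · simp only [one_mul, hq', hq]

end kap
end Circ

namespace Circ
open CohCfg

section side
variable {G : Type u} [CommGroup G] [Finite G] {X : CohCfg G} {Ω' : Type u} [Finite Ω'] {X' : CohCfg Ω'}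
  {φ : Set (G × G) → Set (Ω' × Ω')}

theorem sideLemma (hc : IsCirculant X) (hφ : IsAlgIso X X' φ) {x' : Ω'} {P} (hE : Ext X φ (1 : G) x' P)
    {H K : Subgroup G} {n : ℕ} [NeZero n] {π : G → ZMod n} (h : Pi H K n π) (hKH : K ≤ H)
    (hH : IsRelationOf X (eRelSet H)) (hK : IsRelationOf X (eRelSet K)) (hni : NI X H K) (hsi : SI X H K)
    {D' : Set Ω'} {g : Ω' → G} (hg1 : ∀ y ∈ D', g y ∈ H) (hg2 : ∀ x ∈ H, ∃ y ∈ D', x⁻¹ * g y ∈ K)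
    (hg3 : ∀ ρ ρ', algP X φ ρ ρ' → Sat K ρ → ∀ x ∈ D', ∀ y ∈ D', (g x, g y) ∈ ρ ↔ (x, y) ∈ ρ')
    {d'} (hd : algP X φ (eRelSet H) d') (hcls : ∀ x ∈ D', ∀ y, (x, y) ∈ d' ↔ y ∈ D')
    (hx' : x' ∈ D') (hgx : g x' ∈ K) :
    Closed {R | push P (H : Set G) D' π (fun y => π (g y)) R R} ∧
    (∀ k : ZMod n, push P (H : Set G) D' π (fun y => π (g y))
      {p : ZMod n × ZMod n | ∃ a ∈ mulA X h, p.1 = (a : ZMod n) ∧ p.2 = (a : ZMod n) * k}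
      {p : ZMod n × ZMod n | ∃ a ∈ mulA X h, p.1 = (a : ZMod n) ∧ p.2 = (a : ZMod n) * k}) ∧
    P ((H : Set G) ×ˢ (H : Set G)) (D' ×ˢ D') := by
  obtain ⟨e', he⟩ : ∃ e', algP X φ (eRelSet K) e' := ⟨_, hφ.algP_algImage hK⟩
  have hB := hφ.bi
  have hP := hE.bi
  have hF := h.fib hKH
  have hF' : Fib D' d' e' (fun y => π (g y)) (Nat.card K) := by
    refine fib_mk hcls ?_ ?_ ?_ ?_
    · intro x hx y hy
      rw [h.eq_iff (hg1 x hx) (hg1 y hy)]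
      exact hg3 _ _ he (sat_eRelSet le_rfl) x hx y hy
    · exact (hB.subset_iff hφ.faithful he hd).mp (eRelSet_mono hKH)
    · intro q
      obtain ⟨x, hx, rfl⟩ := h.surj q
      obtain ⟨y, hy, hy'⟩ := hg2 x hx
      exact ⟨y, hy, ((h.eq_iff hx (hg1 y hy)).mpr hy').symm⟩
    · intro x _
      exact hB.card_class hφ.faithful he (eqv_eRelSet K) (card_eRelSet K) x
  have toP : ∀ {R R'}, algP X φ R R' → P R R' := fun hR => bi_of_algP hφ hP hE.basic hR
  have hpb := push_bi hP hF hF' Nat.card_pos (toP hd) (toP he)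
  have hcl := hpb.same
  refine ⟨hcl, ?_, hP.prodΔ hE.pt hF hF' (toP hd) H.one_mem hx'⟩
  refine lemmaN (mulA_norm hc h hni) hcl ?_ ?_
  · intro d
    obtain ⟨x, hx, rfl⟩ := h.surj d
    obtain ⟨s, hs, hxs⟩ := X.cover (1, x)
    rw [mulA_orb hc h hKH hK hni hsi hx hs hxs]
    have hq := hB.comp (hB.comp he (hB.inter _ _ _ _ (hφ.algP_basic hs) hd)) he
    refine ⟨_, _, toP hq, fun u hu v hv => hF.pushRel_iff hu hv, ?_⟩
    intro u hu v hv
    rw [hF.pushRel_iff (hg1 u hu) (hg1 v hv)]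
    exact hg3 _ _ hq (satn_sat K _) u hu v hv
  · have := push_pt hP hE.pt hF hF' (toP he) H.one_mem hx'
    have e1 : π 1 = 0 := h.one
    have e2 : π (g x') = 0 := (h.ker _ (hg1 x' hx')).mpr hgx
    simp only [e1, e2] at this
    exact this

end side

section main
variable {G : Type u} [CommGroup G] 

structure Hyp (X : CohCfg G) (U L M N : Subgroup G) : Prop where
  hs : IsScheme X
  hc : IsCirculant X
  hsq : SesquiclosedIso X X id
  LU : L ≤ U
  UM : U ≤ M
  NL : N ≤ L
  hU : IsRelationOf X (eRelSet U)
  hL : IsRelationOf X (eRelSet L)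
  hM : IsRelationOf X (eRelSet M)
  hN : IsRelationOf X (eRelSet N)
  hw : WedgeCond X (eRelSet L) (eRelSet U)
  niM : NI X M L
  niN : NI X U N
  siM : SI X M L
  siN : SI X U N
  h2a : ∀ Y0 : CohCfg (Sec (univ : Set G) (eRelSet L)),
       IsSectionCfg X univ (eRelSet L) Y0 → Schurian Y0 ∧ Sesquiseparable Y0
  h2b : ∀ X1 : CohCfg ↥(U : Set G),
       IsRestrictionCfg X (U : Set G) X1 → Schurian X1 ∧ Sesquiseparable X1

variable {X : CohCfg G} {Ω' : Type u} {X' : CohCfg Ω'}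
  {φ : Set (G × G) → Set (Ω' × Ω')} {U L M N : Subgroup G}

theorem powLemma [Finite G] [Finite Ω'] [IsCyclic G] (hy : Hyp X U L M N) (hφ : SesquiclosedIso X X' φ) {κ : Ω' → G} (hκ : Kap X φ L κ)
    {f : G → Ω'} (hf : Loc X φ U f) (h1 : κ (f 1) ∈ L) :
    (∀ u ∈ U, κ (f u) ∈ U) ∧ ∃ γ ∈ U, (∀ u ∈ U, ∃ k : ℕ, u⁻¹ * γ ^ k ∈ N) ∧
      ∀ k : ℕ, (κ (f γ) ^ k)⁻¹ * κ (f (γ ^ k)) ∈ L := by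
  have hA := hφ.1
  obtain ⟨P, hE⟩ := ext_of_hasExtension (hφ.ext_all hy.hs 1 (f 1))
  obtain ⟨m, hm0, πM, hm⟩ := exists_pi (H := M) (K := L)
  obtain ⟨n, hn0, πN, hn⟩ := exists_pi (H := U) (K := N)
  have hUm : U ≤ M := hy.UM
  have hLM : L ≤ M := hy.LU.trans hy.UM
  have hNU : N ≤ U := hy.NL.trans hy.LU
  obtain ⟨dU, hdU⟩ : ∃ d', algP X φ (eRelSet U) d' := ⟨_, hA.algP_algImage hy.hU⟩
  obtain ⟨dM, hdM⟩ : ∃ d', algP X φ (eRelSet M) d' := ⟨_, hA.algP_algImage hy.hM⟩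
  have hEU := hA.bi.eqv hA.faithful hdU (eqv_eRelSet U)
  have hbij := hf.bijOn hA hdU
  have hκU : ∀ y ∈ eClass dU (f 1), κ y ∈ U := by
    intro y hy'
    have := (hκ.k3 _ _ hdU (sat_eRelSet hy.LU) _ _).mpr hy'
    exact (cls_eRelSet U _ (hy.LU h1) _).mp this
  obtain ⟨γ, hγ, hγ1⟩ := hn.surj 1
  have hgen : ∀ u ∈ U, ∃ k : ℕ, u⁻¹ * γ ^ k ∈ N := by
    intro u hu
    refine ⟨(πN u).val, ?_⟩
    rw [← hn.eq_iff hu (U.pow_mem hγ _), hn.pow hγ, hγ1, mul_one, ZMod.natCast_zmod_val]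
  refine ⟨fun u hu => hκU _ (hbij.mapsTo hu), γ, hγ, hgen, ?_⟩
  intro k
  -- side M
  obtain ⟨clM, TM, -⟩ := sideLemma hy.hc hA hE hm hLM hy.hM hy.hL hy.niM hy.siM
    (D' := {y | κ y ∈ M}) (g := κ) (fun y hy' => hy') (by
      intro x hx
      obtain ⟨x', hx'⟩ := hκ.k1 x
      refine ⟨x', ?_, hx'⟩
      have := M.mul_mem hx (hLM hx')
      rwa [mul_inv_cancel_left] at this) (fun ρ ρ' hρ hs x _ y _ => hκ.k3 ρ ρ' hρ hs x y) hdM (by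
      intro x hx y
      rw [← hκ.k3 _ _ hdM (sat_eRelSet hLM)]
      exact cls_eRelSet M _ hx _) (hLM h1) h1
  -- side N
  let g : Ω' → G := Function.invFunOn f U
  have hgU : ∀ y ∈ eClass dU (f 1), g y ∈ U := fun y hy' => Function.invFunOn_mem (hbij.surjOn hy')
  have hfg : ∀ y ∈ eClass dU (f 1), f (g y) = y := fun y hy' => Function.invFunOn_eq (hbij.surjOn hy')
  have hgf : ∀ u ∈ U, g (f u) = u := fun u hu =>
    hbij.injOn (hgU _ (hbij.mapsTo hu)) hu (hfg _ (hbij.mapsTo hu))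
  obtain ⟨-, TN, hPU⟩ := sideLemma hy.hc hA hE hn hNU hy.hU hy.hN hy.niN hy.siN
    (D' := eClass dU (f 1)) (g := g) hgU (by
      intro x hx
      refine ⟨f x, hbij.mapsTo hx, ?_⟩
      rw [hgf x hx, inv_mul_cancel]
      exact N.one_mem) (by
      intro ρ ρ' hρ _ x hx y hy'
      have := hf.iff hA hρ (hgU x hx) (hgU y hy')
      rw [hfg x hx, hfg y hy'] at this
      exact this.symm) hdU (hEU.cls _) (hEU.refl _) (by
      rw [hgf 1 U.one_mem]; exact N.one_mem)
  set j := πM γ with hj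
  have hTT := (clM.conv _ (TM j))
  have hTT2 : push P (M : Set G) {y | κ y ∈ M} πM (fun y => πM (κ y))
      {p : ZMod m × ZMod m | ∃ a ∈ mulA X hm, p.1 = (a : ZMod m) * j ∧ p.2 = (a : ZMod m) * (j * k)}
      {p : ZMod m × ZMod m | ∃ a ∈ mulA X hm, p.1 = (a : ZMod m) * j ∧ p.2 = (a : ZMod m) * (j * k)} := by
    have := clM.comp hTT (TM (j * k))
    have e : {p : ZMod m × ZMod m | ∃ a ∈ mulA X hm, p.1 = (a : ZMod m) * j ∧ p.2 = (a : ZMod m) * (j * k)} =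
      {p : ZMod m × ZMod m | ∃ z, (p.1, z) ∈ {p : ZMod m × ZMod m | (p.2, p.1) ∈
        {p : ZMod m × ZMod m | ∃ a ∈ mulA X hm, p.1 = (a : ZMod m) ∧ p.2 = (a : ZMod m) * j}} ∧
        (z, p.2) ∈ {p : ZMod m × ZMod m | ∃ a ∈ mulA X hm, p.1 = (a : ZMod m) ∧ p.2 = (a : ZMod m) * (j * k)}} := by
      ext ⟨b, c⟩
      constructor
      · rintro ⟨a, ha, e1, e2⟩
        exact ⟨a, ⟨a, ha, rfl, e1⟩, ⟨a, ha, rfl, e2⟩⟩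
      · rintro ⟨z, ⟨a, ha, rfl, e1⟩, ⟨a', ha', e2, e3⟩⟩
        simp only at e1 e2 e3
        refine ⟨a, ha, e1, ?_⟩
        rw [e3, e2]
    rw [e]
    exact this
  obtain ⟨ρM, ρM', hρM, hM1, hM2⟩ := hTT2
  obtain ⟨ρN, ρN', hρN, hN1, hN2⟩ := TN (k : ZMod n)
  have hsub : ρN ∩ ((U : Set G) ×ˢ (U : Set G)) ⊆ ρM := by
    rintro ⟨x, y⟩ ⟨hxy, hx, hy'⟩
    obtain ⟨a, ha, e1, e2⟩ := (hN1 x hx y hy').mpr hxy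
    simp only at e1 e2 hx hy'
    rw [← hM1 x (hUm hx) y (hUm hy')]
    obtain ⟨s, hs, hsγ⟩ := X.cover (1, γ)
    have h2 : ((0 : ZMod n), (a : ZMod n)) ∈ orb (mulA X hn) (πN γ) := ⟨a, ha, by simp [hγ1]⟩
    rw [mulA_orb hy.hc hn hNU hy.hN hy.niN hy.siN hγ hs hsγ] at h2
    obtain ⟨u, hu, v, hv, e3, e4, huv⟩ := h2
    have h3 : (πM u, πM v) ∈ pushRel (M : Set G) πM s := ⟨u, hUm hu, v, hUm hv, rfl, rfl, huv⟩
    rw [← mulA_orb hy.hc hm hLM hy.hL hy.niM hy.siM (hUm hγ) hs hsγ] at h3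
    obtain ⟨b, hb, e5⟩ := h3
    simp only at e3 e4 e5
    have e6 : πM u = 0 := (hm.ker u (hUm hu)).mpr (hy.NL ((hn.ker u hu).mp e3))
    have e7 : πM x = πM v := (hm.eq_iff (hUm hx) (hUm hv)).mpr
      (hy.NL ((hn.eq_iff hx hv).mp (by rw [e1, e4])))
    have e8 : πM x = b * j := by rw [e7, hj, ← e5, e6, sub_zero]
    have e9 : πM (x ^ k) = πM y := (hm.eq_iff (hUm (U.pow_mem hx k)) (hUm hy')).mpr
      (hy.NL ((hn.eq_iff (U.pow_mem hx k) hy').mp (by rw [hn.pow hx, e1, e2, mul_comm])))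
    refine ⟨b, hb, e8, ?_⟩
    simp only
    rw [← e9, hm.pow (hUm hx), e8]
    ring
  have hsub' := (hE.bi.subset_iff hE.faithful (hE.bi.inter _ _ _ _ hρN hPU) hρM).mp hsub
  have hγk := U.pow_mem hγ k
  have h4 : (f γ, f (γ ^ k)) ∈ ρN' := by
    rw [← hN2 _ (hbij.mapsTo hγ) _ (hbij.mapsTo hγk)]
    refine ⟨1, Subgroup.one_mem _, ?_, ?_⟩
    · simp only [hgf γ hγ, hγ1, Units.val_one]
    · simp only [hgf _ hγk, hn.pow hγ, hγ1, Units.val_one, mul_one, one_mul]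
  have h5 := hsub' ⟨h4, hbij.mapsTo hγ, hbij.mapsTo hγk⟩
  have h6 : κ (f γ) ∈ M := hUm (hκU _ (hbij.mapsTo hγ))
  have h7 : κ (f (γ ^ k)) ∈ M := hUm (hκU _ (hbij.mapsTo hγk))
  rw [← hM2 _ h6 _ h7] at h5
  obtain ⟨a, ha, e1, e2⟩ := h5
  simp only at e1 e2
  rw [← hm.eq_iff (M.pow_mem h6 k) h7, hm.pow h6, e1, e2]
  ring

end main
end Circ

namespace Circ
open CohCfg

section main
variable {G : Type u} [CommGroup G] {X : CohCfg G} {Ω' : Type u} {X' : CohCfg Ω'}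
  {φ : Set (G × G) → Set (Ω' × Ω')} {U L M N : Subgroup G}

theorem mod_trans {K : Subgroup G} {a b c : G} (h1 : a⁻¹ * b ∈ K) (h2 : b⁻¹ * c ∈ K) : a⁻¹ * c ∈ K :=
  (eqv_eRelSet K).trans a b c h1 h2

theorem mod_symm {K : Subgroup G} {a b : G} (h1 : a⁻¹ * b ∈ K) : b⁻¹ * a ∈ K :=
  (eqv_eRelSet K).symm a b h1

theorem mod_pow {K : Subgroup G} {a b : G} (h1 : a⁻¹ * b ∈ K) (k : ℕ) : (a ^ k)⁻¹ * b ^ k ∈ K := by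
  have := K.pow_mem h1 k
  rwa [mul_pow, inv_pow] at this

theorem klemma1 [Finite G] [Finite Ω'] [IsCyclic G] (hy : Hyp X U L M N) (hφ : SesquiclosedIso X X' φ)
    {κ : Ω' → G} (hκ : Kap X φ L κ) {x' : Ω'} (hx' : κ x' ∈ L) :
    ∃ f, Loc X φ U f ∧ f 1 = x' ∧ ∀ u ∈ U, u⁻¹ * κ (f u) ∈ L := by
  have hA := hφ.1
  obtain ⟨f, hf, rfl⟩ := exists_loc hy.hs hy.hc hφ hy.hU hy.h2b x'
  obtain ⟨hκU, γ, hγ, hgen, hpow⟩ := powLemma hy hφ hκ hf hx'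
  obtain ⟨s, hs, hsγ⟩ := X.cover (1, γ)
  have hr := satn_rel hy.hL (isRel_basic X hs)
  have h1 : (κ (f 1), κ (f γ)) ∈ satn L s := by
    rw [hκ.k3 _ _ (hA.algP_algImage hr) (satn_sat L s), hf.iff hA (hA.algP_algImage hr) U.one_mem hγ]
    exact subset_satn L s hsγ
  obtain ⟨w, ⟨w', h2, h3⟩, h4⟩ := h1
  simp only at h2 h3 h4
  rw [← trans_one hy.hc (isRel_basic X hs)] at h3
  have h5 : w' ∈ L := (cls_eRelSet L _ hx' _).mp h2
  have h6 : (w'⁻¹ * w)⁻¹ * κ (f γ) ∈ L := by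
    have := L.mul_mem h5 h4
    rw [mul_inv, inv_inv, mul_assoc]
    exact this
  have h7 : w'⁻¹ * w ∈ U := by
    have := U.mul_mem (hκU γ hγ) (U.inv_mem (hy.LU h6))
    simpa using this
  obtain ⟨F, hF, hF1, hFγ⟩ := exists_aut1 hy.hs hy.hsq hy.hU hy.h2b hs U.one_mem hγ U.one_mem h7 hsγ h3
  have hnear : ∀ u ∈ U, (F u)⁻¹ * κ (f u) ∈ L := by
    intro u hu
    obtain ⟨k, hk⟩ := hgen u hu
    have hγk := U.pow_mem hγ k
    have a1 : (F u)⁻¹ * F (γ ^ k) ∈ N := (hF.pa (K := N)).2 _ hy.hN (sat_eRelSet le_rfl) u hu _ hγk hk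
    have a2 := hy.niN.pow hF.pa (by rw [hF1]; exact N.one_mem) hγ k
    rw [hFγ] at a2
    have a3 := mod_pow h6 k
    have a4 := hpow k
    have a5 : (κ (f u))⁻¹ * κ (f (γ ^ k)) ∈ L := by
      have := hκ.k3 _ _ (hA.algP_algImage hy.hL) (sat_eRelSet le_rfl) (f u) (f (γ ^ k))
      rw [hf.iff hA (hA.algP_algImage hy.hL) hu hγk] at this
      exact this.mpr (hy.NL hk)
    exact mod_trans (hy.NL a1) (mod_trans (mod_symm (hy.NL a2)) (mod_trans a3 (mod_trans a4 (mod_symm a5))))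
  let g : G → G := Function.invFunOn F U
  have hgU : ∀ u ∈ U, g u ∈ U := fun u hu => Function.invFunOn_mem (hF.1.surjOn hu)
  have hFg : ∀ u ∈ U, F (g u) = u := fun u hu => Function.invFunOn_eq (hF.1.surjOn hu)
  have hg1 : g 1 = 1 := hF.1.injOn (hgU 1 U.one_mem) U.one_mem (by rw [hFg 1 U.one_mem, hF1])
  refine ⟨fun u => f (g u), ?_, by simp only [hg1], ?_⟩
  · intro t ht u hu v hv huv
    obtain ⟨t', ht', hp⟩ := X.cover (g u, g v)
    have := hF.2 t' ht' _ (hgU u hu) _ (hgU v hv) hp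
    rw [hFg u hu, hFg v hv] at this
    have e := cls_unique X ht' ht this huv
    subst e
    exact hf t' ht' _ (hgU u hu) _ (hgU v hv) hp
  · intro u hu
    have := hnear _ (hgU u hu)
    rwa [hFg u hu] at this

/-- local isomorphisms on the coset `q`, compatible with `κ` -/
def LocQ (X : CohCfg G) (φ : Set (G × G) → Set (Ω' × Ω')) (U L : Subgroup G) (κ : Ω' → G) (x : G)
    (f : G → Ω') : Prop :=
  (∀ s ∈ X.S, ∀ u v, x⁻¹ * u ∈ U → x⁻¹ * v ∈ U → (u, v) ∈ s → (f u, f v) ∈ φ s) ∧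
    ∀ u, x⁻¹ * u ∈ U → u⁻¹ * κ (f u) ∈ L

theorem LocQ.congr {κ : Ω' → G} {x y : G} {f : G → Ω'} (h : LocQ X φ U L κ x f) (hxy : x⁻¹ * y ∈ U) :
    LocQ X φ U L κ y f :=
  ⟨fun s hs u v hu hv huv => h.1 s hs u v (mod_trans hxy hu) (mod_trans hxy hv) huv,
    fun u hu => h.2 u (mod_trans hxy hu)⟩

theorem klemma [Finite G] [Finite Ω'] [IsCyclic G] (hy : Hyp X U L M N) (hφ : SesquiclosedIso X X' φ)
    {κ : Ω' → G} (hκ : Kap X φ L κ) {x : G} {x' : Ω'} (hx' : x⁻¹ * κ x' ∈ L) :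
    ∃ f, LocQ X φ U L κ x f ∧ f x = x' := by
  obtain ⟨f, hf, hf1, hf2⟩ := klemma1 hy hφ (hκ.translate hy.hc hφ.1 x⁻¹) (x' := x')
    (by simpa only [mul_comm] using hx')
  refine ⟨fun u => f (x⁻¹ * u), ⟨?_, ?_⟩, ?_⟩
  · intro s hs u v hu hv huv
    refine hf s hs _ hu _ hv ?_
    rw [mul_comm x⁻¹, mul_comm x⁻¹, trans_basic hy.hc hs]
    exact huv
  · intro u hu
    have := hf2 _ hu
    convert this using 1
    rw [mul_inv, inv_inv, mul_comm (κ _), ← mul_assoc, mul_comm x, mul_assoc u⁻¹, mul_inv_cancel, mul_one]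
  · simp only [inv_mul_cancel, hf1]

theorem glue [Finite G] [Finite Ω'] (hy : Hyp X U L M N) (hA : IsAlgIso X X' φ)
    {κ : Ω' → G} (hκ : Kap X φ L κ) {fam : G ⧸ U → G → Ω'}
    (hfam : ∀ x : G, LocQ X φ U L κ x (fam (QuotientGroup.mk x))) :
    InducedBy X X' φ (fun x => fam (QuotientGroup.mk x) x) := by
  set f : G → Ω' := fun x => fam (QuotientGroup.mk x) x with hf
  have hnear : ∀ x, x⁻¹ * κ (f x) ∈ L := fun x => (hfam x).2 x (by simp)
  have hpres : ∀ s ∈ X.S, ∀ x y, (x, y) ∈ s → (f x, f y) ∈ φ s := by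
    intro s hs x y hxy
    by_cases h : x⁻¹ * y ∈ U
    · have e : (QuotientGroup.mk y : G ⧸ U) = QuotientGroup.mk x := (QuotientGroup.eq.mpr h).symm
      have := (hfam x).1 s hs x y (by simp) h hxy
      rw [hf]
      simp only [e]
      exact this
    · have hdisj : s ∩ eRelSet U = ∅ := by
        by_contra hne
        exact h (hy.hU s hs (Set.nonempty_iff_ne_empty.mpr hne) hxy)
      have hsat : Sat L s := fun x y a b hxy ha hb => hy.hw s hs hdisj (x, y) hxy a b ha hb
      rw [← hκ.k3 _ _ (hA.algP_basic hs) hsat]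
      exact hsat x y _ _ hxy (hnear x) (hnear y)
  have hinj : Function.Injective f := by
    intro x y hxy
    obtain ⟨s, hs, hp⟩ := X.cover (x, y)
    have h1 := hpres s hs x y hp
    rw [← hxy] at h1
    exact hA.diag2 (p := (x, y)) (x := f x) ⟨s, hs, hp, h1⟩
  obtain ⟨⟨a', b'⟩, hab⟩ := hA.exr ((1 : G), (1 : G))
  obtain ⟨e, -⟩ := hA.equiv hab
  have hbij : Function.Bijective f := by
    have : Function.Bijective (fun x => e.symm (f x)) :=
      Finite.injective_iff_bijective.mp (e.symm.injective.comp hinj)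
    refine ⟨hinj, fun y => ?_⟩
    obtain ⟨x, hx⟩ := this.2 (e.symm y)
    exact ⟨x, e.symm.injective hx⟩
  refine ⟨hbij, ?_⟩
  intro s hs
  ext ⟨p, q⟩
  constructor
  · intro h
    obtain ⟨x, rfl⟩ := hbij.2 p
    obtain ⟨y, rfl⟩ := hbij.2 q
    obtain ⟨t, ht, hp⟩ := X.cover (x, y)
    have := hA.uniq ht hs (hpres t ht x y hp) h
    subst this
    exact ⟨(x, y), hp, rfl⟩
  · rintro ⟨⟨x, y⟩, h, e⟩
    rw [← e]
    exact hpres s hs x y h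

/-- the gluing with a prescribed property on each coset -/
theorem glue_exists [Finite G] [Finite Ω'] (hy : Hyp X U L M N) (hA : IsAlgIso X X' φ)
    {κ : Ω' → G} (hκ : Kap X φ L κ) (C : G → Ω' → Prop)
    (h : ∀ x : G, ∃ f, LocQ X φ U L κ x f ∧ ∀ u, x⁻¹ * u ∈ U → C u (f u)) :
    ∃ f, InducedBy X X' φ f ∧ ∀ u, C u (f u) := by
  choose f0 h1 h2 using h
  have hq : ∀ x : G, (Quotient.out (QuotientGroup.mk x : G ⧸ U))⁻¹ * x ∈ U := by
    intro x
    rw [← QuotientGroup.eq]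
    exact Quotient.out_eq (QuotientGroup.mk x : G ⧸ U)
  have h3 := glue hy hA hκ (fam := fun q => f0 (Quotient.out q)) (fun x => (h1 _).congr (hq x))
  exact ⟨_, h3, fun u => h2 _ u (hq u)⟩

theorem final_sep [Finite G] [IsCyclic G] (hy : Hyp X U L M N) : Sesquiseparable X := by
  intro Ω' X' φ hφ
  haveI := X'.finite
  obtain ⟨κ, hκ⟩ := exists_kap hy.hs hφ hy.hL hy.h2a
  obtain ⟨f, hf, -⟩ := glue_exists hy hφ.1 hκ (fun _ _ => True) (by
    intro x
    obtain ⟨x', hx'⟩ := hκ.k1 x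
    obtain ⟨f, hf, -⟩ := klemma hy hφ hκ hx'
    exact ⟨f, hf, fun _ _ => trivial⟩)
  exact ⟨f, hf⟩

theorem final_schur_one [Finite G] [IsCyclic G] (hy : Hyp X U L M N) {s} (hs : s ∈ X.S) {x y : G}
    (hx : (1, x) ∈ s) (hxy : (1, y) ∈ s) : ∃ f : G → G, InducedBy X X id f ∧ f 1 = 1 ∧ f x = y := by
  by_cases hxU : x ∈ U
  · have hyU : y ∈ U := by
      have h1 := hy.hU s hs ⟨(1, x), hx, by simpa [eRelSet] using hxU⟩ hxy
      simpa [eRelSet] using h1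
    obtain ⟨F1, hF, hF1, hFx⟩ := exists_aut1 hy.hs hy.hsq hy.hU hy.h2b hs U.one_mem hxU U.one_mem hyU hx hxy
    obtain ⟨n, hn0, πN, hn⟩ := exists_pi (H := U) (K := N)
    obtain ⟨γ, hγ, hγ1⟩ := hn.surj 1
    have hgen : ∀ u ∈ U, ∃ k : ℕ, u⁻¹ * γ ^ k ∈ N := by
      intro u hu
      refine ⟨(πN u).val, ?_⟩
      rw [← hn.eq_iff hu (U.pow_mem hγ _), hn.pow hγ, hγ1, mul_one, ZMod.natCast_zmod_val]
    obtain ⟨t, ht, htγ⟩ := X.cover (1, γ)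
    have ht1 := hF.2 t ht 1 U.one_mem γ hγ htγ
    rw [hF1] at ht1
    obtain ⟨F, hFp, h1, h2⟩ := exists_aut0 hy.hs hy.hsq hy.hL hy.h2a ht ht1 htγ
    have hκ := kap_of_aut hy.hL hFp
    have h1 : F 1 ∈ L := by simpa using h1
    have hpa : PA X M L F := by
      refine ⟨?_, fun ρ h1 h2 x _ y _ h => hFp ρ h1 h2 x y h⟩
      intro a ha
      have := hFp _ hy.hM (sat_eRelSet (hy.LU.trans hy.UM)) 1 a (by simpa [eRelSet] using ha)
      exact (cls_eRelSet M _ (hy.UM (hy.LU h1)) _).mp this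
    have hL : ∀ a b, a⁻¹ * b ∈ L → (F a)⁻¹ * F b ∈ L := fun a b h => hFp _ hy.hL (sat_eRelSet le_rfl) a b h
    have hnear : ∀ u ∈ U, u⁻¹ * F (F1 u) ∈ L := by
      intro u hu
      obtain ⟨k, hk⟩ := hgen u hu
      have hγk := U.pow_mem hγ k
      have a1 : (F1 u)⁻¹ * F1 (γ ^ k) ∈ N := (hF.pa (K := N)).2 _ hy.hN (sat_eRelSet le_rfl) u hu _ hγk hk
      have a2 := hy.niN.pow hF.pa (by rw [hF1]; exact N.one_mem) hγ k
      have a3 := hL _ _ (hy.NL (mod_trans a2 (mod_symm a1)))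
      have a4 := hy.niM.pow hpa h1 (hy.UM (hF.1.mapsTo hγ)) k
      have a5 := mod_pow h2 k
      exact mod_trans (hy.NL hk) (mod_trans a5 (mod_trans a4 a3))
    obtain ⟨f, hf, hC⟩ := glue_exists hy (isAlgIso_id X) hκ (fun u v => u ∈ U → v = F1 u) (by
      intro z
      by_cases hz : z ∈ U
      · have hm : ∀ u, z⁻¹ * u ∈ U → u ∈ U := fun u hu => by
          have := U.mul_mem hz hu
          rwa [mul_inv_cancel_left] at this
        refine ⟨F1, ⟨?_, ?_⟩, fun _ _ _ => rfl⟩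
        · intro s hs u v hu hv huv
          exact hF.2 s hs u (hm u hu) v (hm v hv) huv
        · intro u hu
          exact hnear u (hm u hu)
      · obtain ⟨x', hx'⟩ := hκ.k1 z
        obtain ⟨f, hf, -⟩ := klemma hy hy.hsq hκ hx'
        refine ⟨f, hf, ?_⟩
        intro u hu huU
        refine absurd ?_ hz
        have := U.mul_mem huU (U.inv_mem hu)
        simpa using this)
    refine ⟨f, hf, ?_, ?_⟩
    · rw [hC 1 U.one_mem, hF1]
    · rw [hC x hxU, hFx]
  · obtain ⟨F, hFp, h1, h2⟩ := exists_aut0 hy.hs hy.hsq hy.hL hy.h2a hs hxy hx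
    have hκ := kap_of_aut hy.hL hFp
    obtain ⟨f, hf, hC⟩ := glue_exists hy (isAlgIso_id X) hκ (fun u v => (u = 1 → v = 1) ∧ (u = x → v = y)) (by
      intro z
      by_cases hz : z ∈ U
      · obtain ⟨f, hf, hf1⟩ := klemma hy hy.hsq hκ h1
        refine ⟨f, hf.congr (by simpa using hz), ?_⟩
        intro u hu
        refine ⟨fun e => by rw [e, hf1], fun e => ?_⟩
        refine absurd ?_ hxU
        have := U.mul_mem hz hu
        rwa [mul_inv_cancel_left, e] at this
      · by_cases hzx : x⁻¹ * z ∈ U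
        · obtain ⟨f, hf, hf1⟩ := klemma hy hy.hsq hκ h2
          refine ⟨f, hf.congr hzx, ?_⟩
          intro u hu
          refine ⟨fun e => ?_, fun e => by rw [e, hf1]⟩
          refine absurd ?_ hz
          rw [e] at hu
          simpa using hu
        · obtain ⟨x', hx'⟩ := hκ.k1 z
          obtain ⟨f, hf, -⟩ := klemma hy hy.hsq hκ hx'
          refine ⟨f, hf, ?_⟩
          intro u hu
          refine ⟨fun e => ?_, fun e => ?_⟩
          · refine absurd ?_ hz
            rw [e] at hu
            simpa using hu
          · refine absurd ?_ hzx
            rw [e] at hu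
            exact mod_symm hu)
    exact ⟨f, hf, (hC 1).1 rfl, (hC x).2 rfl⟩

theorem final_schur [Finite G] [IsCyclic G] (hy : Hyp X U L M N) : Schurian X := by
  rintro s hs ⟨a, b⟩ hp ⟨a', b'⟩ hq
  obtain ⟨f, ⟨hf1, hf2⟩, e1, e2⟩ := final_schur_one hy hs
    ((trans_one hy.hc (isRel_basic X hs) a b).mpr hp) ((trans_one hy.hc (isRel_basic X hs) a' b').mpr hq)
  refine ⟨fun z => f (z * a⁻¹) * a', ⟨?_, ?_⟩, ?_⟩
  · exact (Equiv.mulRight a').bijective.comp (hf1.comp (Equiv.mulRight a⁻¹).bijective)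
  · intro t ht
    have h1 : relImage (fun z => f (z * a⁻¹) * a') t =
        relImage (fun z => z * a') (relImage f (relImage (fun z => z * a⁻¹) t)) := by
      unfold relImage
      rw [Set.image_image, Set.image_image]
    rw [h1, hy.hc a⁻¹ t ht, ← hf2 t ht]
    exact hy.hc a' t ht
  · simp only [mul_inv_cancel, e1, one_mul]
    rw [mul_comm b, e2, mul_comm a'⁻¹, inv_mul_cancel_right]

theorem final [Finite G] [IsCyclic G]
    (X : CohCfg G) (hs : IsScheme X) (hc : IsCirculant X) (hsq : SesquiclosedCfg X)
    (U L : Subgroup G) (hLU : L ≤ U) (hU : IsXGroup X U) (hL : IsXGroup X L)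
    (hw : WedgeCond X (eRelSet L) (eRelSet U))
    (h1a : ∃ M : Subgroup G, IsXGroup X M ∧ U ≤ M ∧
       ∀ Y : CohCfg (Sec (M : Set G) (eRelSet L)),
         IsSectionCfg X (M : Set G) (eRelSet L) Y → IsNormalSec (M : Set G) (eRelSet L) Y)
    (h1b : ∃ N : Subgroup G, SubXGroup X U N ∧ N ≤ L ∧
       ∀ Y : CohCfg (Sec (U : Set G) (eRelSet N)),
         IsSectionCfg X (U : Set G) (eRelSet N) Y → IsNormalSec (U : Set G) (eRelSet N) Y)
    (h2a : ∀ Y0 : CohCfg (Sec (univ : Set G) (eRelSet L)),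
       IsSectionCfg X univ (eRelSet L) Y0 → Schurian Y0 ∧ Sesquiseparable Y0)
    (h2b : ∀ X1 : CohCfg ↥(U : Set G),
       IsRestrictionCfg X (U : Set G) X1 → Schurian X1 ∧ Sesquiseparable X1) :
    Schurian X ∧ Sesquiseparable X := by
  obtain ⟨M, hM, hUM, hnM⟩ := h1a
  obtain ⟨N, hN, hNL, hnN⟩ := h1b
  have hNr := sub_isXGroup hc hU hN
  have hy : Hyp X U L M N :=
    { hs := hs, hc := hc, hsq := hsq.2, LU := hLU, UM := hUM, NL := hNL, hU := hU.1, hL := hL.1, hM := hM.1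
      hN := hNr, hw := hw
      niM := ni_of_normal hs hsq.2 hM.1 hL.1 (hLU.trans hUM) hnM
      niN := ni_of_normal hs hsq.2 hU.1 hNr (hNL.trans hLU) hnN
      siM := si_M hs hsq.2 hL.1 hM.1 (hLU.trans hUM) h2a
      siN := si_U hs hsq.2 hU.1 h2b N
      h2a := h2a, h2b := h2b }
  exact ⟨final_schur hy, final_sep hy⟩

end main
end Circ

open CohCfg in
/-- Theorem: let `X` be a circulant sesquiclosed scheme on a finite cyclic group
`G` which is the `𝔖`-wreath product over `𝔖 = U/L ∈ 𝔖₀(X)` of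
`X₀ = X_{G/e(L)}` and `X₁ = X_U`.  If (1) `𝔖` is subnormal in both operands
(i.e. there is an `X₀`-group `M ⊇ U` with `M/L` normal, and an `X₁`-group
`N ⊆ L` with `U/N` normal) and (2) the operands are schurian and
sesquiseparable, then `X` is schurian and sesquiseparable. -/
theorem stmt_16 {G : Type u} [CommGroup G] [IsCyclic G] [Finite G]
    (X : CohCfg G) (hs : IsScheme X) (hc : IsCirculant X) (hsq : SesquiclosedCfg X)
    (U L : Subgroup G) (hLU : L ≤ U) (hU : IsXGroup X U) (hL : IsXGroup X L)
    -- X is the 𝔖-wreath product, 𝔖 = U/L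
    (hw : WedgeCond X (eRelSet L) (eRelSet U))
    -- (1) 𝔖 is subnormal in X₀ = X_{G/e(L)}
    (h1a : ∃ M : Subgroup G, IsXGroup X M ∧ U ≤ M ∧
       ∀ Y : CohCfg (Sec (M : Set G) (eRelSet L)),
         IsSectionCfg X (M : Set G) (eRelSet L) Y → IsNormalSec (M : Set G) (eRelSet L) Y)
    -- (1) 𝔖 is subnormal in X₁ = X_U
    (h1b : ∃ N : Subgroup G, SubXGroup X U N ∧ N ≤ L ∧
       ∀ Y : CohCfg (Sec (U : Set G) (eRelSet N)),
         IsSectionCfg X (U : Set G) (eRelSet N) Y → IsNormalSec (U : Set G) (eRelSet N) Y)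
    -- (2) the operands are schurian and sesquiseparable
    (h2a : ∀ Y0 : CohCfg (Sec (univ : Set G) (eRelSet L)),
       IsSectionCfg X univ (eRelSet L) Y0 → Schurian Y0 ∧ Sesquiseparable Y0)
    (h2b : ∀ X1 : CohCfg ↥(U : Set G),
       IsRestrictionCfg X (U : Set G) X1 → Schurian X1 ∧ Sesquiseparable X1) :
    Schurian X ∧ Sesquiseparable X := by
  exact Circ.final X hs hc hsq U L hLU hU hL hw h1a h1b h2a h2b
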